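/- arXiv:1203.5244 — 3 statements merged into one kernel-verified Lean document; each statement's English description precedes it below -/
import Mathlib

section
/- Let $q\geq3$, $m\geq2$, $0\leq a\leq m-2$, $2\leq b\leq q-1$, and let $f\in R_q(a(q-1)+b,m)$ have weight $|f|=(q-b+1)(q-1)q^{m-a-2}$ with support $S$. If $H$ is an affine hyperplane with $S\cap H\neq\emptyset$ and $S\cap H\neq S$, then exactly one of the following holds: (i) $S$ meets every hyperplane parallel to $H$; (ii) $S$ meets exactly $q-b+1$ of the hyperplanes parallel to $H$, each in $(q-1)q^{m-a-2}$ points; (iii) $S$ meets exactly $q-1$ of the hyperplanes parallel to $H$, each in $(q-b+1)q^{m-a-2}$ points. -/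
/-- Membership in the generalized Reed–Muller code `R_q(r,m)`: `f` is represented by a
polynomial of total degree at most `r` (equivalently, its reduced form has degree ≤ r). -/
def RM (F : Type) [Field F] (r m : ℕ) (f : (Fin m → F) → F) : Prop :=
  ∃ P : MvPolynomial (Fin m) F, P.totalDegree ≤ r ∧ ∀ x, MvPolynomial.eval x P = f x

/-- Hamming weight: the size of the support of `f`. -/
def wt {F : Type} [Field F] [Fintype F] [DecidableEq F] {m : ℕ} (f : (Fin m → F) → F) : ℕ :=
  (Finset.univ.filter fun x => f x ≠ 0).card

set_option linter.unusedSectionVars false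
section Aux
open Finset
variable {F : Type} [Field F]

/-- degree strictly less than `d` -/
def DL (F : Type) [Field F] (d m : ℕ) (f : (Fin m → F) → F) : Prop :=
  ∃ P : MvPolynomial (Fin m) F, (P = 0 ∨ P.totalDegree < d) ∧ ∀ x, MvPolynomial.eval x P = f x

lemma DL.mono {d e m : ℕ} {f : (Fin m → F) → F} (h : DL F d m f) (hde : d ≤ e) : DL F e m f := by
  obtain ⟨P, hP, h⟩ := h
  exact ⟨P, hP.imp id (fun h => by omega), h⟩

lemma DL.zero (d m : ℕ) : DL F d m (fun _ => 0) := ⟨0, Or.inl rfl, by simp⟩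

lemma DL.eq_zero {m : ℕ} {f : (Fin m → F) → F} (h : DL F 0 m f) : f = 0 := by
  obtain ⟨P, hP, h⟩ := h
  rcases hP with rfl | hP
  · ext x; simp [← h]
  · omega

lemma DL.add {d m : ℕ} {f g : (Fin m → F) → F} (hf : DL F d m f) (hg : DL F d m g) :
    DL F d m (fun x => f x + g x) := by
  obtain ⟨P, hP, hf⟩ := hf
  obtain ⟨Q, hQ, hg⟩ := hg
  refine ⟨P + Q, ?_, by simp [hf, hg]⟩
  rcases hP with rfl | hP
  · simpa using hQ
  rcases hQ with rfl | hQ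
  · simpa using Or.inr hP
  · right
    exact (MvPolynomial.totalDegree_add _ _).trans_lt (max_lt hP hQ)

lemma DL.sum {ι : Type*} {d m : ℕ} (s : Finset ι) (f : ι → (Fin m → F) → F)
    (hf : ∀ i ∈ s, DL F d m (f i)) : DL F d m (fun x => ∑ i ∈ s, f i x) := by
  classical
  induction s using Finset.induction_on with
  | empty => simpa using DL.zero d m
  | insert a s ha ih =>
    simp only [Finset.sum_insert ha]
    exact (hf a (by simp)).add (ih fun i hi => hf i (by simp [hi]))

lemma DL.mul {d e m : ℕ} {f g : (Fin m → F) → F} (hf : DL F (d+1) m f) (hg : DL F (e+1) m g) :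
    DL F (d+e+1) m (fun x => f x * g x) := by
  obtain ⟨P, hP, hf⟩ := hf
  obtain ⟨Q, hQ, hg⟩ := hg
  refine ⟨P * Q, ?_, by simp [hf, hg]⟩
  rcases hP with rfl | hP
  · simp
  rcases hQ with rfl | hQ
  · simp
  · right
    have := MvPolynomial.totalDegree_mul P Q
    omega

lemma DL.const {m : ℕ} (c : F) : DL F 1 m (fun _ => c) :=
  ⟨MvPolynomial.C c, Or.inr (by simp), by simp⟩

lemma DL.smul {d m : ℕ} {f : (Fin m → F) → F} (c : F) (hf : DL F d m f) :
    DL F d m (fun x => c * f x) := by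
  obtain ⟨P, hP, hf⟩ := hf
  refine ⟨MvPolynomial.C c * P, ?_, by simp [hf]⟩
  rcases hP with rfl | hP
  · simp
  · right
    have := MvPolynomial.totalDegree_mul (MvPolynomial.C c) P
    simp at this
    omega

lemma DL.lin {m : ℕ} (L : (Fin m → F) →ₗ[F] F) : DL F 2 m (fun x => L x) := by
  have : (fun x => L x) = fun x => ∑ i, L (Pi.single i 1) * x i := by
    ext x
    rw [LinearMap.pi_apply_eq_sum_univ L x]
    refine Finset.sum_congr rfl fun i _ => ?_
    rw [smul_eq_mul, mul_comm]
    congr 2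
    ext j
    simp [Pi.single_apply, eq_comm]
  rw [this]
  refine DL.sum _ _ fun i _ => DL.smul _ ⟨MvPolynomial.X i, Or.inr ?_, by simp⟩
  simp

lemma DL.aff {m : ℕ} (L : (Fin m → F) →ₗ[F] F) (c : F) : DL F 2 m (fun x => L x - c) := by
  have := (DL.lin L).add ((DL.const (m := m) (-c)).mono (by norm_num : 1 ≤ 2))
  simpa [sub_eq_add_neg] using this

lemma DL.prod {ι : Type*} {m : ℕ} (s : Finset ι) (e : ι → ℕ) (f : ι → (Fin m → F) → F)
    (hf : ∀ i ∈ s, DL F (e i + 1) m (f i)) :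
    DL F (∑ i ∈ s, e i + 1) m (fun x => ∏ i ∈ s, f i x) := by
  classical
  induction s using Finset.induction_on with
  | empty => simpa using DL.const 1
  | insert a s ha ih =>
    simp only [Finset.prod_insert ha, Finset.sum_insert ha]
    exact (hf a (by simp)).mul (ih fun i hi => hf i (by simp [hi]))

lemma DL.pow {m : ℕ} {f : (Fin m → F) → F} (hf : DL F 2 m f) (n : ℕ) :
    DL F (n + 1) m (fun x => f x ^ n) := by
  have := DL.prod (Finset.range n) (fun _ => 1) (fun _ => f) (fun _ _ => hf)
  simpa using this

lemma DL.comp {d m n : ℕ} {f : (Fin m → F) → F} (hf : DL F d m f)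
    (L : (Fin n → F) →ₗ[F] (Fin m → F)) : DL F d n (fun x => f (L x)) := by
  obtain ⟨P, hP, hf⟩ := hf
  rcases hP with rfl | hP
  · have : (fun x => f (L x)) = fun _ => 0 := by ext x; simp [← hf]
    rw [this]; exact DL.zero _ _
  have : (fun x => f (L x)) = fun x => ∑ s ∈ P.support, P.coeff s * ∏ i, (L x i) ^ s i := by
    ext x
    rw [← hf, MvPolynomial.eval_eq']
  rw [this]
  refine DL.sum _ _ fun s hs => DL.smul _ ?_
  have h1 := DL.prod (Finset.univ) (fun i => s i) (fun i (x : Fin n → F) => (L x i) ^ s i)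
    (fun i _ => DL.pow (DL.lin ((LinearMap.proj i).comp L)) (s i))
  refine h1.mono ?_
  have := MvPolynomial.le_totalDegree hs
  rw [Finsupp.sum_fintype _ _ (by simp)] at this
  omega

lemma DL.coeffs {d m : ℕ} {f : (Fin (m+1) → F) → F} (hf : DL F d (m+1) f) :
    ∃ g : ℕ → (Fin m → F) → F, (∀ i, DL F (d - i) m (g i)) ∧
      ∀ x w, f (Fin.cons x w) = ∑ i ∈ range d, x ^ i * g i w := by
  obtain ⟨P, hP, hf⟩ := hf
  have hz : ∀ i, (MvPolynomial.finSuccEquiv F m P).coeff i = 0 ∨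
      ((MvPolynomial.finSuccEquiv F m P).coeff i).totalDegree < d - i := by
    intro i
    rcases hP with rfl | hP
    · simp
    by_cases h : (MvPolynomial.finSuccEquiv F m P).coeff i = 0
    · exact Or.inl h
    · right
      have := MvPolynomial.totalDegree_coeff_finSuccEquiv_add_le P i h
      omega
  refine ⟨fun i w => MvPolynomial.eval w ((MvPolynomial.finSuccEquiv F m P).coeff i),
    fun i => ⟨_, hz i, fun _ => rfl⟩, fun x w => ?_⟩
  rw [← hf, MvPolynomial.eval_eq_eval_mv_eval', Polynomial.eval_map, Polynomial.eval₂_eq_sum,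
    Polynomial.sum_over_range' _ (by simp) (d + 1 + (MvPolynomial.finSuccEquiv F m P).natDegree) (by omega)]
  symm
  apply Finset.sum_subset_zero_on_sdiff
  · intro i hi; simp at *; omega
  · intro i hi
    simp only [mem_sdiff, mem_range] at hi
    have : (MvPolynomial.finSuccEquiv F m P).coeff i = 0 := (hz i).resolve_right (by omega)
    simp [this]
  · intro i _; ring

variable [Fintype F] [DecidableEq F]

lemma pow_red (x : F) (i : ℕ) :
    x ^ (if i = 0 then 0 else (i-1) % (Fintype.card F - 1) + 1) = x ^ i := by
  have hq : 1 < Fintype.card F := Fintype.one_lt_card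
  split_ifs with h
  · rw [h]
  by_cases hx : x = 0
  · simp [hx, h]
  · have h1 := FiniteField.pow_card_sub_one_eq_one x hx
    conv_rhs => rw [show i = (i-1) % (Fintype.card F - 1) + 1 + (Fintype.card F - 1) * ((i-1)/ (Fintype.card F - 1)) by
      have := Nat.mod_add_div (i-1) (Fintype.card F - 1); omega]
    rw [pow_add _ _ (_ * _), pow_mul, h1]; simp

lemma DL.rep {d m : ℕ} {f : (Fin (m+1) → F) → F} (hf : DL F d (m+1) f) :
    ∃ g : ℕ → (Fin m → F) → F, (∀ i, DL F (d - i) m (g i)) ∧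
      ∀ x w, f (Fin.cons x w) = ∑ i ∈ range (Fintype.card F), x ^ i * g i w := by
  have hq : 1 < Fintype.card F := Fintype.one_lt_card
  obtain ⟨g, hg, hfg⟩ := hf.coeffs
  let red : ℕ → ℕ := fun i => if i = 0 then 0 else (i-1) % (Fintype.card F - 1) + 1
  have hred : ∀ i, red i ≤ i := by
    intro i
    simp only [red]; split_ifs with h
    · omega
    · have := Nat.mod_le (i-1) (Fintype.card F - 1); omega
  have hred2 : ∀ i, red i < Fintype.card F := by
    intro i
    simp only [red]; split_ifs with h
    · omega
    · have := Nat.mod_lt (i-1) (show 0 < Fintype.card F - 1 by omega); omega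
  refine ⟨fun j w => ∑ i ∈ (range d).filter (fun i => red i = j), g i w, ?_, ?_⟩
  · intro j
    refine DL.sum _ _ fun i hi => (hg i).mono ?_
    have := hred i
    simp at hi; omega
  · intro x w
    rw [hfg, ← Finset.sum_fiberwise_of_maps_to (t := range (Fintype.card F)) (g := red)
      (fun i _ => by simpa using hred2 i)]
    refine Finset.sum_congr rfl fun j hj => ?_
    rw [Finset.mul_sum]
    refine Finset.sum_congr rfl fun i hi => ?_
    rw [← (mem_filter.1 hi).2, pow_red]

lemma DL.sect {d m : ℕ} {f : (Fin (m+1) → F) → F} (hf : DL F d (m+1) f) (K : Finset F)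
    (hK : ∀ κ ∈ K, ∀ w, f (Fin.cons κ w) = 0) (c : F) :
    DL F (d - K.card) m (fun w => f (Fin.cons c w)) := by
  obtain ⟨g, hg, hfg⟩ := hf.coeffs
  let lam : F → F := fun κ => (Lagrange.basis K id κ).eval c
  have key : ∀ i < K.card, c ^ i = ∑ κ ∈ K, lam κ * κ ^ i := by
    intro i hi
    have := Lagrange.eq_interpolate (s := K) (v := id) (f := (Polynomial.X ^ i : Polynomial F))
      (Set.injOn_id _) (by rw [Polynomial.degree_X_pow]; exact_mod_cast hi)
    have := congrArg (Polynomial.eval c) this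
    rw [Lagrange.interpolate_apply, Polynomial.eval_finsetSum] at this
    simp only [Polynomial.eval_pow, Polynomial.eval_X, Polynomial.eval_mul, Polynomial.eval_C, id] at this
    rw [this]
    exact Finset.sum_congr rfl fun κ _ => by simp only [lam]; rw [mul_comm]
  have : (fun w => f (Fin.cons c w)) =
      fun w => ∑ i ∈ range d, (c ^ i - ∑ κ ∈ K, lam κ * κ ^ i) * g i w := by
    ext w
    have h0 : ∑ κ ∈ K, lam κ * f (Fin.cons κ w) = 0 :=
      Finset.sum_eq_zero fun κ hκ => by rw [hK κ hκ]; simp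
    rw [← sub_zero (f _), ← h0]
    simp only [hfg, sub_mul, Finset.sum_sub_distrib]
    congr 1
    simp only [Finset.mul_sum, Finset.sum_mul]
    rw [Finset.sum_comm]
    exact Finset.sum_congr rfl fun _ _ => Finset.sum_congr rfl fun _ _ => by ring
  rw [this]
  refine DL.sum _ _ fun i _ => ?_
  by_cases h : i < K.card
  · rw [← key i h]; simpa using DL.zero _ _
  · exact ((hg i).mono (by omega)).smul _

lemma wt_sections {m : ℕ} (f : (Fin (m+1) → F) → F) :
    wt f = ∑ c : F, wt (fun w => f (Fin.cons c w)) := by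
  simp only [wt, Finset.card_filter]
  rw [← (Fin.consEquiv (fun _ : Fin (m+1) => F)).sum_comp, Fintype.sum_prod_type]
  rfl

lemma wt_fibers {m : ℕ} (f : (Fin (m+1) → F) → F) :
    wt f = ∑ w : Fin m → F, (univ.filter fun x => f (Fin.cons x w) ≠ 0).card := by
  simp only [wt, Finset.card_filter]
  rw [← (Fin.consEquiv (fun _ : Fin (m+1) => F)).sum_comp, Fintype.sum_prod_type, Finset.sum_comm]
  rfl

lemma wt_pos {m : ℕ} {f : (Fin m → F) → F} (hf : f ≠ 0) : 0 < wt f := by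
  obtain ⟨x, hx⟩ := Function.ne_iff.1 hf
  exact Finset.card_pos.2 ⟨x, by simpa using hx⟩

lemma wt_comp {m : ℕ} (f : (Fin m → F) → F) (e : (Fin m → F) ≃ₗ[F] (Fin m → F)) :
    wt (fun x => f (e x)) = wt f := by
  simp only [wt, Finset.card_filter]
  exact e.toEquiv.sum_comp (fun x => if f x ≠ 0 then 1 else 0)

lemma DL.top {d m : ℕ} {f : (Fin (m+1) → F) → F} (hf : DL F d (m+1) f) (h0 : f ≠ 0) :
    ∃ i < Fintype.card F, ∃ g : (Fin m → F) → F, g ≠ 0 ∧ DL F (d - i) m g ∧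
      (Fintype.card F - i) * wt g ≤ wt f ∧ (∀ w, g w ≠ 0 → ∃ x, f (Fin.cons x w) ≠ 0) ∧
      (i = 0 → ∀ x w, f (Fin.cons x w) = g w) := by
  obtain ⟨g, hg, hfg⟩ := hf.rep
  set q := Fintype.card F with hq
  have hex : ∃ i ∈ range q, g i ≠ 0 := by
    by_contra! h
    apply h0
    ext x
    rw [← Fin.cons_self_tail x, hfg]
    exact Finset.sum_eq_zero fun i hi => by rw [h i hi]; simp
  obtain ⟨i, hi, hmax⟩ := Finset.exists_max_image ((range q).filter fun i => g i ≠ 0) id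
    (by obtain ⟨i, h1, h2⟩ := hex; exact ⟨i, Finset.mem_filter.2 ⟨h1, h2⟩⟩)
  simp only [mem_filter, mem_range, id] at hi hmax
  have hz : ∀ j, i < j → j < q → g j = 0 := by
    intro j h1 h2
    by_contra h
    have := hmax j ⟨h2, h⟩
    omega
  have hfg' : ∀ x w, f (Fin.cons x w) = ∑ j ∈ range (i+1), x ^ j * g j w := by
    intro x w
    rw [hfg]; symm
    apply Finset.sum_subset
    · intro j hj; simp at *; omega
    · intro j h1 h2
      simp at h1 h2
      rw [hz j (by omega) h1]; simp
  have hcount : ∀ w, g i w ≠ 0 → q - i ≤ (univ.filter fun x => f (Fin.cons x w) ≠ 0).card := by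
    intro w hw
    let p : Polynomial F := ∑ j ∈ range (i+1), Polynomial.C (g j w) * Polynomial.X ^ j
    have hp : ∀ x, p.eval x = f (Fin.cons x w) := by
      intro x
      rw [hfg', Polynomial.eval_finsetSum]
      exact Finset.sum_congr rfl fun j _ => by
        rw [Polynomial.eval_mul, Polynomial.eval_C, Polynomial.eval_pow, Polynomial.eval_X, mul_comm]
    have hc : p.coeff i = g i w := by
      simp [p, Polynomial.finsetSum_coeff, Polynomial.coeff_X_pow]
    have hp0 : p ≠ 0 := by
      intro h; rw [h] at hc; exact hw (by simpa using hc.symm)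
    have hd : p.natDegree ≤ i := by
      apply Polynomial.natDegree_sum_le_of_forall_le
      intro j hj
      refine (Polynomial.natDegree_C_mul_X_pow_le _ _).trans ?_
      simp at hj; omega
    have h1 : (univ.filter fun x => f (Fin.cons x w) = 0).card ≤ i := by
      refine le_trans ?_ hd
      refine le_trans ?_ (Polynomial.card_roots' p)
      refine le_trans (Finset.card_le_card ?_) (Multiset.toFinset_card_le p.roots)
      intro x hx
      simp at hx
      simp [hp0, hp, hx]
    have h2 := Finset.card_filter_add_card_filter_not (s := (univ : Finset F)) (fun x => f (Fin.cons x w) = 0)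
    rw [Finset.card_univ, ← hq] at h2
    simp only [ne_eq]
    omega
  refine ⟨i, hi.1, g i, hi.2, hg i, ?_, ?_, ?_⟩
  · rw [wt_fibers f, wt, mul_comm, ← smul_eq_mul, ← Finset.sum_const]
    refine le_trans ?_ (Finset.sum_le_univ_sum_of_nonneg (s := univ.filter fun x => g i x ≠ 0) (by simp))
    exact Finset.sum_le_sum fun w hw => hcount w (by simpa using hw)
  · intro w hw
    have := hcount w hw
    obtain ⟨x, hx⟩ := Finset.card_pos.1 (show 0 < (univ.filter fun x => f (Fin.cons x w) ≠ 0).card by omega)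
    exact ⟨x, by simpa using hx⟩
  · rintro rfl x w
    rw [hfg']; simp

lemma minwt (m : ℕ) : ∀ (t s : ℕ) (f : (Fin m → F) → F), s ≤ Fintype.card F - 1 → f ≠ 0 →
    DL F (t * (Fintype.card F - 1) + s + 1) m f →
    (Fintype.card F - s) * Fintype.card F ^ m ≤ Fintype.card F ^ (t+1) * wt f := by
  have hq : 1 < Fintype.card F := Fintype.one_lt_card
  induction m with
  | zero =>
    intro t s f hs h0 hf
    have := wt_pos h0
    calc _ ≤ Fintype.card F := by simp
      _ = Fintype.card F ^ 1 * 1 := by simp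
      _ ≤ _ := Nat.mul_le_mul (Nat.pow_le_pow_right (by omega) (by omega)) this
  | succ m ih =>
    intro t s f hs h0 hf
    obtain ⟨i, hi, g, hg0, hg, hw, -, -⟩ := hf.top h0
    set q := Fintype.card F with hqq
    by_cases his : i ≤ s
    · have := ih t (s - i) g (by omega) hg0 (hg.mono (by omega))
      have h3 : (q - s) * q ≤ (q - i) * (q - (s - i)) := by
        obtain ⟨j, rfl⟩ := Nat.exists_eq_add_of_le his
        obtain ⟨k, hk⟩ := Nat.exists_eq_add_of_le (show i + j ≤ q by omega)
        rw [show q - (i+j) = k by omega, show q - i = j + k by omega, show i + j - i = j by omega,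
          show q - j = i + k by omega, hk]
        nlinarith [Nat.zero_le (i*j)]
      calc (q - s) * q ^ (m+1) = ((q - s) * q) * q ^ m := by ring
        _ ≤ ((q - i) * (q - (s - i))) * q ^ m := Nat.mul_le_mul_right _ h3
        _ = (q - i) * ((q - (s - i)) * q ^ m) := by ring
        _ ≤ (q - i) * (q ^ (t+1) * wt g) := Nat.mul_le_mul_left _ this
        _ = q ^ (t+1) * ((q - i) * wt g) := by ring
        _ ≤ _ := Nat.mul_le_mul_left _ hw
    · obtain _ | t := t
      · exfalso
        apply hg0
        have : DL F 0 m g := hg.mono (by simp; omega)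
        exact this.eq_zero
      have := ih t (q - 1 + s - i) g (by omega) hg0 (hg.mono (by rw [add_mul]; omega))
      rw [show q - (q - 1 + s - i) = 1 + i - s by omega] at this
      have h3 : (q - s) ≤ (q - i) * (1 + i - s) := by
        obtain ⟨j, rfl⟩ := Nat.exists_eq_add_of_lt (show s < i by omega)
        obtain ⟨k, hk⟩ := Nat.exists_eq_add_of_lt hi
        rw [show q - (s + j + 1) = k + 1 by omega, show 1 + (s + j + 1) - s = j + 2 by omega,
          show q - s = j + k + 2 by omega]
        nlinarith [Nat.zero_le (j*k)]
      calc (q - s) * q ^ (m+1) ≤ ((q - i) * (1 + i - s)) * q ^ (m+1) := Nat.mul_le_mul_right _ h3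
        _ = q * (q - i) * ((1 + i - s) * q ^ m) := by ring
        _ ≤ q * (q - i) * (q ^ (t+1) * wt g) := Nat.mul_le_mul_left _ this
        _ = q ^ (t+1+1) * ((q - i) * wt g) := by ring
        _ ≤ _ := Nat.mul_le_mul_left _ hw

lemma exists_coords {n : ℕ} (φ : (Fin (n+1) → F) →ₗ[F] F) (v : Fin (n+1) → F) (hv : φ v = 1) :
    ∃ e : (Fin (n+1) → F) ≃ₗ[F] (Fin (n+1) → F), (∀ x, φ (e x) = x 0) ∧
      ∀ x w, e (Fin.cons x w) = x • v + e (Fin.cons 0 w) := by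
  have hφ : φ ≠ 0 := by rintro rfl; simp at hv
  have hr : Module.finrank F (LinearMap.ker φ) = n := by
    have h1 := LinearMap.finrank_range_add_finrank_ker φ
    rw [LinearMap.range_eq_top.2 (LinearMap.surjective hφ)] at h1
    simp at h1
    omega
  let κ : (Fin n → F) ≃ₗ[F] LinearMap.ker φ := LinearEquiv.ofFinrankEq _ _ (by simp [hr])
  let L : (Fin (n+1) → F) →ₗ[F] (Fin (n+1) → F) :=
    (LinearMap.proj (R := F) (φ := fun _ : Fin (n+1) => F) 0).smulRight v +
      (LinearMap.ker φ).subtype ∘ₗ κ.toLinearMap ∘ₗ (LinearMap.funLeft F F Fin.succ)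
  have hL : ∀ x, L x = x 0 • v + (κ (fun i => x i.succ) : Fin (n+1) → F) := fun x => rfl
  have hφL : ∀ x, φ (L x) = x 0 := by
    intro x
    have := (κ (fun i => x i.succ)).2
    rw [LinearMap.mem_ker] at this
    rw [hL, map_add, map_smul, hv, this]; simp
  have hinj : Function.Injective L := by
    rw [← LinearMap.ker_eq_bot, LinearMap.ker_eq_bot']
    intro x hx
    have h0 : x 0 = 0 := by rw [← hφL x, hx]; simp
    have h1 := hL x
    rw [hx, h0, zero_smul, zero_add] at h1
    have h2 : κ (fun i => x i.succ) = 0 := Subtype.ext h1.symm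
    have h3 := (LinearEquiv.map_eq_zero_iff κ).1 h2
    ext i
    refine Fin.cases h0 (fun j => congrFun h3 j) i
  refine ⟨LinearEquiv.ofInjectiveEndo L hinj, fun x => hφL x, fun x w => ?_⟩
  rw [LinearEquiv.coe_ofInjectiveEndo, hL, hL]
  simp

def InH {m : ℕ} (f : (Fin m → F) → F) : Prop :=
  ∃ ψ : (Fin m → F) →ₗ[F] F, ψ ≠ 0 ∧ ∃ c, ∀ x, f x ≠ 0 → ψ x = c

lemma InH.of_comp {m : ℕ} {f : (Fin m → F) → F} (e : (Fin m → F) ≃ₗ[F] (Fin m → F))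
    (h : InH (fun x => f (e x))) : InH f := by
  obtain ⟨ψ, h0, c, h⟩ := h
  refine ⟨ψ ∘ₗ e.symm.toLinearMap, ?_, c, fun x hx => ?_⟩
  · intro h1
    apply h0
    have := LinearMap.congr_fun h1
    refine LinearMap.ext fun y => ?_
    simpa using this (e y)
  · exact h _ (by simpa using hx)

lemma exists_one {m : ℕ} {ψ : (Fin m → F) →ₗ[F] F} (h : ψ ≠ 0) : ∃ v, ψ v = 1 :=
  LinearMap.surjective h 1

lemma exists_line {n : ℕ} (hn : 2 ≤ n) {ψ : (Fin n → F) →ₗ[F] F} (h : ψ ≠ 0) (d : F) :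
    ∃ p v, v ≠ 0 ∧ ∀ x : F, ψ (p + x • v) = d := by
  obtain ⟨p, hp⟩ := LinearMap.surjective h d
  have := LinearMap.ker_ne_bot_of_finrank_lt (f := ψ) (by simp; omega)
  obtain ⟨v, hv, hv0⟩ := Submodule.exists_mem_ne_zero_of_ne_bot this
  refine ⟨p, v, hv0, fun x => ?_⟩
  rw [LinearMap.mem_ker] at hv
  simp [hp, hv]

lemma DL.const_of_one {m : ℕ} {f : (Fin m → F) → F} (hf : DL F 1 m f) : ∃ c, ∀ x, f x = c := by
  obtain ⟨P, hP, hf⟩ := hf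
  rcases hP with rfl | hP
  · exact ⟨0, fun x => by simp [← hf]⟩
  · have h := MvPolynomial.totalDegree_eq_zero_iff_eq_C.1 (show P.totalDegree = 0 by omega)
    exact ⟨P.coeff 0, fun x => by rw [← hf, h]; simp⟩

def dotL {n : ℕ} (a : Fin n → F) : (Fin n → F) →ₗ[F] F :=
  ∑ i, a i • LinearMap.proj (R := F) (φ := fun _ : Fin n => F) i

lemma dotL_apply {n : ℕ} (a x : Fin n → F) : dotL a x = ∑ i, a i * x i := by
  simp [dotL]

lemma dotL_ne {n : ℕ} {a : Fin n → F} (h : a ≠ 0) : dotL a ≠ 0 := by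
  obtain ⟨i, hi⟩ := Function.ne_iff.1 h
  intro h
  have := LinearMap.congr_fun h (Pi.single i 1)
  rw [dotL_apply] at this
  simp [Pi.single_apply] at this
  exact hi this

/-- Jamison in the plane -/
lemma jamison (hq : 3 ≤ Fintype.card F) (f : (Fin 2 → F) → F)
    (hl : ∀ p v : Fin 2 → F, v ≠ 0 → ∃ x : F, f (p + x • v) ≠ 0) :
    2 * (Fintype.card F - 1) ≤ wt f := by
  classical
  by_contra! hw
  obtain ⟨x0, hx0⟩ := hl 0 (fun _ => 1) (by intro h; have := congrFun h 0; simp at this)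
  generalize (0 + x0 • (fun _ => 1) : Fin 2 → F) = s0 at hx0
  let T := (univ.filter fun x => f x ≠ 0).erase s0
  have hT : T.card + 1 = wt f := by
    rw [wt]; exact Finset.card_erase_add_one (by simpa using hx0)
  let J : (Fin 2 → F) → F := fun u => ∏ s ∈ T, (dotL (s - s0) u - 1)
  have hJ : DL F (T.card + 1) 2 J := by
    have := DL.prod T (fun _ => 1) (fun s u => dotL (s - s0) u - 1) (fun s _ => DL.aff _ _)
    simpa using this
  have hJ0 : J 0 ≠ 0 := by simp [J]
  have hJ1 : ∀ u, u ≠ 0 → J u = 0 := by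
    intro u hu
    obtain ⟨p, v, hv, h⟩ := exists_line (le_refl 2) (dotL_ne hu) (1 + dotL u s0)
    obtain ⟨x, hx⟩ := hl p v hv
    have h := h x
    generalize p + x • v = s at hx h
    apply Finset.prod_eq_zero (i := s)
    · simp only [T, mem_erase, mem_filter, mem_univ, true_and]
      refine ⟨?_, hx⟩
      rintro rfl
      simp at h
    · have h2 : dotL (s - s0) u = dotL u s - dotL u s0 := by
        simp only [dotL_apply, ← Finset.sum_sub_distrib]
        exact Finset.sum_congr rfl fun i _ => by simp; ring
      rw [h2, h]; ring
  have hwJ : wt J = 1 := by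
    rw [wt, Finset.card_eq_one]
    refine ⟨0, ?_⟩
    ext u
    simp only [mem_filter, mem_univ, true_and, mem_singleton]
    constructor
    · intro h; by_contra h'; exact h (hJ1 u h')
    · rintro rfl; exact hJ0
  have := minwt 2 1 (Fintype.card F - 2) J (by omega) (by intro h; apply hJ0; rw [h]; rfl)
    (hJ.mono (by omega))
  rw [hwJ, show Fintype.card F - (Fintype.card F - 2) = 2 by omega] at this
  have : 0 < Fintype.card F ^ 2 := by positivity
  simp at *
  omega

lemma second (hq : 3 ≤ Fintype.card F) (m : ℕ) : ∀ (t : ℕ) (f : (Fin m → F) → F), f ≠ 0 →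
    DL F (t * (Fintype.card F - 1) + 1) m f →
    Fintype.card F ^ (t+1) * wt f < 2 * (Fintype.card F - 1) * Fintype.card F ^ m →
    Fintype.card F ^ t * wt f = Fintype.card F ^ m ∧ (1 ≤ t → InH f) := by
  induction m with
  | zero =>
    intro t f h0 hf hw
    have h1 := wt_pos h0
    have h2 : wt f ≤ 1 := by
      refine (Finset.card_le_univ _).trans ?_
      simp
    have h3 : wt f = 1 := by omega
    rw [h3] at hw ⊢
    obtain _ | t := t
    · simp
    · exfalso
      have : Fintype.card F ^ 2 ≤ Fintype.card F ^ (t+1+1) := Nat.pow_le_pow_right (by omega) (by omega)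
      have h4 : Fintype.card F - 1 + 1 = Fintype.card F := by omega
      simp only [pow_zero, mul_one] at hw
      nlinarith
  | succ m ih =>
    intro t f h0 hf hw
    obtain _ | t := t
    · refine ⟨?_, by simp⟩
      obtain ⟨c, hc⟩ := DL.const_of_one (hf.mono (by simp))
      have hc0 : c ≠ 0 := by
        rintro rfl; apply h0; ext x; simp [hc]
      simp [wt, hc, hc0]
    have hw' : Fintype.card F ^ (t+1) * wt f < 2 * (Fintype.card F - 1) * Fintype.card F ^ m := by
      have h1 : Fintype.card F * (Fintype.card F ^ (t+1) * wt f) <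
        Fintype.card F * (2 * (Fintype.card F - 1) * Fintype.card F ^ m) := by
        calc _ = _ := by ring
          _ < _ := hw
          _ = _ := by ring
      exact lt_of_mul_lt_mul_left h1 (by omega)
    by_cases hH : InH f
    · refine ⟨?_, fun _ => hH⟩
      obtain ⟨ψ, hψ, c, hc⟩ := hH
      obtain ⟨v, hv⟩ := exists_one hψ
      obtain ⟨e, he, -⟩ := exists_coords ψ v hv
      have hf' := hf.comp e.toLinearMap
      have hz : ∀ x w, x ≠ c → f (e (Fin.cons x w)) = 0 := by
        intro x w hx
        by_contra h
        apply hx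
        rw [← hc _ h, he]; simp
      have hs := hf'.sect (univ.erase c) (fun κ hκ w => hz κ w (by simpa using hκ)) c
      have hwt : wt f = wt (fun w => f (e (Fin.cons c w))) := by
        rw [← wt_comp f e, wt_sections, Finset.sum_eq_single c]
        · intro b _ hb
          simp [wt, hz b _ hb]
        · simp
      rw [Finset.card_erase_of_mem (mem_univ _), Finset.card_univ] at hs
      have := ih t (fun w => f (e (Fin.cons c w))) ?_ (hs.mono ?_) (by rw [← hwt]; exact hw')
      · rw [hwt, pow_succ, pow_succ, mul_right_comm, this.1]
      · intro h
        have h1 : wt f = 0 := by rw [hwt, h]; simp [wt]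
        have := wt_pos h0; omega
      · rw [add_mul]; omega
    exfalso
    -- top coefficient in every coordinate system
    have claim : ∀ e : (Fin (m+1) → F) ≃ₗ[F] (Fin (m+1) → F), ∃ g : (Fin m → F) → F, g ≠ 0 ∧
        DL F (t * (Fintype.card F - 1) + 1) m g ∧ wt g ≤ wt f ∧
        (∀ w, g w ≠ 0 → ∃ x, f (e (Fin.cons x w)) ≠ 0) := by
      intro e
      have hf' := hf.comp e.toLinearMap
      have h0' : (fun x => f (e x)) ≠ 0 := by
        intro h
        apply h0
        ext x
        have := congrFun h (e.symm x)
        simpa using this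
      obtain ⟨i, hi, g, hg0, hg, hwg, hgx, hgi⟩ := DL.top hf' h0'
      have hwe := wt_comp f e
      simp only [LinearEquiv.coe_coe] at hwg hgx hgi
      rw [hwe] at hwg
      rcases Nat.eq_zero_or_pos i with rfl | hipos
      · exfalso
        have h1 := (ih (t+1) g hg0 (hg.mono (by omega)) (by
          have h1 : Fintype.card F * (Fintype.card F ^ (t+1+1) * wt g) <
            Fintype.card F * (2 * (Fintype.card F - 1) * Fintype.card F ^ m) := by
            calc _ = Fintype.card F ^ (t+1+1) * ((Fintype.card F - 0) * wt g) := by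
                  rw [Nat.sub_zero]; ring
              _ ≤ Fintype.card F ^ (t+1+1) * wt f := Nat.mul_le_mul_left _ hwg
              _ < _ := hw
              _ = _ := by ring
          exact lt_of_mul_lt_mul_left h1 (by omega))).2 (by omega)
        apply hH
        apply InH.of_comp e
        obtain ⟨ψ, hψ, c, hc⟩ := h1
        refine ⟨ψ ∘ₗ LinearMap.funLeft F F Fin.succ, ?_, c, ?_⟩
        · intro h
          apply hψ
          refine LinearMap.ext fun w => ?_
          have := LinearMap.congr_fun h (Fin.cons 0 w)
          simpa [LinearMap.funLeft, Function.comp_def] using this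
        · intro x hx
          rw [← Fin.cons_self_tail x] at hx
          simp only [hgi rfl] at hx
          exact hc _ hx
      by_cases hi2 : i = Fintype.card F - 1
      · refine ⟨g, hg0, hg.mono ?_, ?_, hgx⟩
        · rw [hi2, add_mul]; omega
        · rw [hi2, show Fintype.card F - (Fintype.card F - 1) = 1 by omega] at hwg
          simpa using hwg
      · exfalso
        have h1 := minwt m t (Fintype.card F - 1 - i) g (by omega) hg0
          (hg.mono (by rw [add_mul]; omega))
        rw [show Fintype.card F - (Fintype.card F - 1 - i) = 1 + i by omega] at h1
        have h3 : 2 * (Fintype.card F - 1) ≤ (Fintype.card F - i) * (1 + i) := by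
          obtain ⟨k, hk⟩ := Nat.exists_eq_add_of_le (show i + 2 ≤ Fintype.card F by omega)
          obtain ⟨j, rfl⟩ := Nat.exists_eq_add_of_le' hipos
          rw [hk, show j + 1 + 2 + k - 1 = j + 2 + k by omega,
            show j + 1 + 2 + k - (j + 1) = k + 2 by omega]
          nlinarith [Nat.zero_le (j*k)]
        refine absurd hw (not_lt.2 ?_)
        calc 2 * (Fintype.card F - 1) * Fintype.card F ^ (m+1)
          ≤ (Fintype.card F - i) * (1 + i) * Fintype.card F ^ (m+1) := Nat.mul_le_mul_right _ h3
          _ = Fintype.card F * (Fintype.card F - i) * ((1 + i) * Fintype.card F ^ m) := by ring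
          _ ≤ Fintype.card F * (Fintype.card F - i) * (Fintype.card F ^ (t+1) * wt g) :=
            Nat.mul_le_mul_left _ h1
          _ = Fintype.card F ^ (t+1+1) * ((Fintype.card F - i) * wt g) := by ring
          _ ≤ _ := Nat.mul_le_mul_left _ hwg
    rcases Nat.eq_zero_or_pos t with rfl | ht
    · -- every line meets the support
      have hline : ∀ p v : Fin (m+1) → F, v ≠ 0 → ∃ x : F, f (p + x • v) ≠ 0 := by
        intro p v hv
        obtain ⟨φ, hφ⟩ : ∃ φ : (Fin (m+1) → F) →ₗ[F] F, φ v = 1 := by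
          obtain ⟨i, hi⟩ := Function.ne_iff.1 hv
          refine ⟨(v i)⁻¹ • LinearMap.proj i, ?_⟩
          simp at hi
          simp [hi]
        obtain ⟨e, he, he2⟩ := exists_coords φ v hφ
        obtain ⟨g, hg0, hg, -, hgx⟩ := claim e
        obtain ⟨c, hc⟩ := DL.const_of_one (hg.mono (by simp))
        have hc0 : c ≠ 0 := by
          rintro rfl; apply hg0; ext x; simp [hc]
        obtain ⟨x, hx⟩ := hgx (Fin.tail (e.symm p)) (by rw [hc]; exact hc0)
        refine ⟨x - e.symm p 0, ?_⟩
        have h1 : p = e (Fin.cons (e.symm p 0) (Fin.tail (e.symm p))) := by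
          rw [Fin.cons_self_tail]; simp
        rw [he2] at h1 hx
        convert hx using 2
        generalize e (Fin.cons 0 (Fin.tail (e.symm p))) = A at *
        generalize e.symm p 0 = p0 at *
        rw [h1]; module
      obtain _ | _ | m := m
      · apply hH
        have h1 : wt f < 2 := by
          by_contra! h2
          have h3 : Fintype.card F - 1 + 1 = Fintype.card F := by omega
          simp only [zero_add, pow_one, Nat.reduceAdd] at hw
          nlinarith [Nat.mul_le_mul_left (Fintype.card F ^ 2) h2]
        obtain ⟨x0, hx0⟩ := Function.ne_iff.1 h0
        refine ⟨LinearMap.proj 0, ?_, x0 0, ?_⟩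
        · intro h
          have := LinearMap.congr_fun h (fun _ => 1)
          simp at this
        · intro x hx
          have := Finset.card_le_one.1 (Nat.le_of_lt_succ h1) x (by simpa using hx) x0 (by simpa using hx0)
          rw [this]; rfl
      · have := jamison hq f hline
        refine absurd hw (not_lt.2 ?_)
        simp only [zero_add, Nat.reduceAdd]
        nlinarith [Nat.mul_le_mul_left (Fintype.card F ^ 2) this]
      · have hex : ∃ c : F, Fintype.card F ^ 2 * wt (fun w => f (Fin.cons c w)) <
            2 * (Fintype.card F - 1) * Fintype.card F ^ (m+2) := by
          by_contra! h
          have h1 : ∑ c : F, 2 * (Fintype.card F - 1) * Fintype.card F ^ (m+2) ≤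
              ∑ c : F, Fintype.card F ^ 2 * wt (fun w => f (Fin.cons c w)) :=
            Finset.sum_le_sum fun c _ => h c
          rw [← Finset.mul_sum univ (fun c => wt (fun w => f (Fin.cons c w))), ← wt_sections, Finset.sum_const, Finset.card_univ, smul_eq_mul] at h1
          refine absurd hw (not_lt.2 ?_)
          calc _ = _ := by ring
            _ ≤ _ := h1
            _ = _ := by ring
        obtain ⟨c, hc⟩ := hex
        have hs := hf.sect ∅ (by simp) c
        have hs0 : (fun w => f (Fin.cons c w)) ≠ 0 := by
          intro h
          obtain ⟨x, hx⟩ := hline (Fin.cons c 0) (Fin.cons 0 (fun _ => 1)) (by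
            intro h; have := congrFun h 1; 
            rw [show (1 : Fin (m+1+1+1)) = Fin.succ 0 from rfl, Fin.cons_succ] at this
            simp at this)
          apply hx
          have := congrFun h (fun _ => x)
          simp only [Pi.zero_apply] at this
          have h5 : (Fin.cons c 0 + x • Fin.cons 0 (fun _ => 1) : Fin (m+1+1+1) → F) =
              Fin.cons c (fun _ => x) := by
            ext i
            refine Fin.cases ?_ (fun j => ?_) i <;> simp
          rw [h5]; exact this
        obtain ⟨ψ, hψ, d, hd⟩ := (ih 1 _ hs0 (hs.mono (by simp)) hc).2 le_rfl
        obtain ⟨p, v, hv, hpv⟩ := exists_line (by omega) hψ (d + 1)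
        obtain ⟨x, hx⟩ := hline (Fin.cons c p) (Fin.cons 0 v) (by
          intro h; apply hv; ext j; have := congrFun h j.succ; simpa using this)
        have h1 : (Fin.cons c p + x • Fin.cons 0 v : Fin (m+1+1+1) → F) = Fin.cons c (p + x • v) := by
          ext i
          refine Fin.cases ?_ (fun j => ?_) i <;> simp
        rw [h1] at hx
        have h2 := hd _ hx
        rw [hpv] at h2
        simp at h2
    · obtain ⟨g, hg0, hg, hwg, hgx⟩ := claim (LinearEquiv.refl F _)
      simp only [LinearEquiv.refl_apply] at hgx
      obtain ⟨hgw, hgH⟩ := ih t g hg0 hg ((Nat.mul_le_mul_left _ hwg).trans_lt hw')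
      obtain ⟨ψ, hψ, c, hc⟩ := hgH ht
      let Ψ : (Fin (m+1) → F) →ₗ[F] F := ψ ∘ₗ LinearMap.funLeft F F Fin.succ
      have hΨ : ∀ x w, Ψ (Fin.cons x w) = ψ w := by
        intro x w
        simp [Ψ, LinearMap.funLeft, Function.comp_def]
      let h : (Fin (m+1) → F) → F := fun x => (Ψ x - c) * f x
      have hh : DL F ((t+1) * (Fintype.card F - 1) + 1 + 1) (m+1) h := by
        have := (DL.aff Ψ c).mul hf
        refine this.mono (by omega)
      have hh0 : h ≠ 0 := by
        intro h1
        apply hH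
        refine ⟨Ψ, ?_, c, ?_⟩
        · intro h2
          apply hψ
          refine LinearMap.ext fun w => ?_
          rw [← hΨ 0 w, h2]; rfl
        · intro x hx
          have := congrFun h1 x
          simp only [h, Pi.zero_apply, mul_eq_zero, hx, or_false] at this
          exact sub_eq_zero.1 this
      have h1 := minwt (m+1) (t+1) 1 h (by omega) hh0 hh
      have h2 : wt h + wt g ≤ wt f := by
        choose! X hX using hgx
        have hd : Disjoint (univ.filter fun x => h x ≠ 0)
            ((univ.filter fun w => g w ≠ 0).image fun w => (Fin.cons (X w) w : Fin (m+1) → F)) := by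
          rw [Finset.disjoint_left]
          intro x hx hx2
          simp only [mem_image, mem_filter, mem_univ, true_and] at hx hx2
          obtain ⟨w, hw, rfl⟩ := hx2
          apply hx
          simp [h, hΨ, hc w hw]
        have hcard : ((univ.filter fun w => g w ≠ 0).image fun w => (Fin.cons (X w) w : Fin (m+1) → F)).card
            = wt g := by
          rw [Finset.card_image_of_injective]
          · rfl
          · intro w w' hww
            exact (Fin.cons_inj.1 hww).2
        rw [← hcard, wt, ← Finset.card_union_of_disjoint hd]
        apply Finset.card_le_card
        intro x hx
        simp only [mem_union, mem_image, mem_filter, mem_univ, true_and] at hx ⊢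
        rcases hx with hx | ⟨w, hw, rfl⟩
        · exact right_ne_zero_of_mul hx
        · exact hX w hw
      refine absurd hw (not_lt.2 ?_)
      calc 2 * (Fintype.card F - 1) * Fintype.card F ^ (m+1)
          ≤ (Fintype.card F - 1) * Fintype.card F ^ (m+1) + Fintype.card F * Fintype.card F ^ (m+1) := by
            rw [← add_mul]
            exact Nat.mul_le_mul_right _ (by omega)
        _ = (Fintype.card F - 1) * Fintype.card F ^ (m+1) +
            Fintype.card F ^ 2 * (Fintype.card F ^ t * wt g) := by rw [hgw]; ring
        _ ≤ Fintype.card F ^ (t+1+1) * wt h + Fintype.card F ^ 2 * (Fintype.card F ^ t * wt g) :=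
            Nat.add_le_add_right h1 _
        _ = Fintype.card F ^ (t+1+1) * (wt h + wt g) := by ring
        _ ≤ _ := Nat.mul_le_mul_left _ h2

lemma arith_main (q a b n N : ℕ) (W : F → ℕ) (hqc : Fintype.card F = q) (hq : 3 ≤ q)
    (hb1 : 2 ≤ b) (hb2 : b ≤ q - 1) (hN : 0 < N)
    (K : Finset F) (hKc : K = univ.filter fun c => W c = 0)
    (hK1 : 1 ≤ K.card) (hK2 : 2 ≤ (univ.filter fun c => W c ≠ 0).card)
    (hsum : ∑ c, W c = (q - b + 1) * (q - 1) * N)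
    (hlow1 : K.card ≤ b → ∀ c, W c ≠ 0 → (q - b + K.card) * N ≤ W c)
    (hlow2 : b < K.card → ∀ c, W c ≠ 0 → (1 + K.card - b) * q * N ≤ W c)
    (hsec : K.card = b → ∀ c, W c ≠ 0 → W c = q * N ∨ 2 * (q - 1) * N ≤ W c) :
    ((univ.filter fun c => W c ≠ 0).card = q - b + 1 ∧ ∀ c, W c ≠ 0 → W c = (q - 1) * N) ∨
    ((univ.filter fun c => W c ≠ 0).card = q - 1 ∧ ∀ c, W c ≠ 0 → W c = (q - b + 1) * N) := by
  set M := univ.filter fun c => W c ≠ 0 with hM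
  have hcard : K.card + M.card = q := by
    rw [hKc, hM, ← hqc, ← Finset.card_univ]
    exact Finset.card_filter_add_card_filter_not (s := (univ : Finset F)) (fun c => W c = 0)
  have hsumM : ∑ c ∈ M, W c = (q - b + 1) * (q - 1) * N := by
    rw [← hsum]
    exact Finset.sum_filter_ne_zero univ
  have hmem : ∀ c, c ∈ M ↔ W c ≠ 0 := by simp [hM]
  have hlow : ∀ L, (∀ c, W c ≠ 0 → L ≤ W c) → M.card * L ≤ (q - b + 1) * (q - 1) * N := by
    intro L hL
    rw [← hsumM, ← smul_eq_mul]
    exact Finset.card_nsmul_le_sum M W L fun c hc => hL c ((hmem c).1 hc)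
  have heq : ∀ L, (∀ c, W c ≠ 0 → L ≤ W c) → M.card * L = (q - b + 1) * (q - 1) * N →
      ∀ c, W c ≠ 0 → W c = L := by
    intro L hL h c hc
    have h1 : ∑ c ∈ M, L = ∑ c ∈ M, W c := by
      rw [hsumM, ← h, Finset.sum_const, smul_eq_mul]
    exact ((Finset.sum_eq_sum_iff_of_le (fun c hc => hL c ((hmem c).1 hc))).1 h1 c ((hmem c).2 hc)).symm
  generalize K.card = k at *
  have hMk : M.card = q - k := by omega
  rw [hMk] at hlow heq ⊢
  by_cases h1 : k = 1
  · subst h1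
    right
    refine ⟨rfl, fun c hc => ?_⟩
    exact heq _ (hlow1 (by omega)) (by ring) c hc
  by_cases h2 : k = b - 1
  · left
    refine ⟨by omega, fun c hc => ?_⟩
    have h3 : q - b + k = q - 1 := by omega
    have h4 : q - k = q - b + 1 := by omega
    rw [h3] at hlow1
    exact heq _ (hlow1 (by omega)) (by rw [h4]; ring) c hc
  exfalso
  rcases lt_trichotomy k b with h3 | h3 | h3
  · have h := hlow _ (hlow1 h3.le)
    rw [← mul_assoc] at h
    have h := Nat.le_of_mul_le_mul_right h hN
    obtain ⟨i, rfl⟩ := Nat.exists_eq_add_of_le (show 2 ≤ k by omega)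
    obtain ⟨j, rfl⟩ := Nat.exists_eq_add_of_le (show 2 + i + 2 ≤ b by omega)
    obtain ⟨l, rfl⟩ := Nat.exists_eq_add_of_le (show 2 + i + 2 + j ≤ q by omega)
    rw [show 2 + i + 2 + j + l - (2 + i) = 2 + j + l by omega,
      show 2 + i + 2 + j + l - (2 + i + 2 + j) = l by omega,
      show 2 + i + 2 + j + l - 1 = i + 3 + j + l by omega] at h
    nlinarith [Nat.zero_le (i * j)]
  · subst h3
    obtain ⟨l, rfl⟩ := Nat.exists_eq_add_of_le (show k + 2 ≤ q by omega)
    rw [show k + 2 + l - k = l + 2 by omega, show k + 2 + l - 1 = k + 1 + l by omega] at *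
    by_cases hall : ∀ c ∈ M, W c = (k + 2 + l) * N
    · rw [Finset.sum_congr rfl hall, Finset.sum_const, hMk, smul_eq_mul, ← mul_assoc] at hsumM
      have := Nat.eq_of_mul_eq_mul_right hN hsumM
      nlinarith
    · push Not at hall
      obtain ⟨c0, hc0, hne⟩ := hall
      have h5 := ((hsec rfl) c0 ((hmem c0).1 hc0)).resolve_left hne
      have h6 : ∀ c ∈ M.erase c0, (k + 2 + l) * N ≤ W c := by
        intro c hc
        have := hlow1 le_rfl c ((hmem c).1 (Finset.mem_of_mem_erase hc))
        rwa [show l + 2 + k = k + 2 + l by omega] at this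
      have h7 := Finset.card_nsmul_le_sum (M.erase c0) W _ h6
      rw [Finset.card_erase_of_mem hc0, hMk, smul_eq_mul] at h7
      rw [← Finset.add_sum_erase M W hc0] at hsumM
      rw [show l + 2 - 1 = l + 1 by omega] at h7
      have h8 : (2 * (k + 1 + l) + (l+1) * (k + 2 + l)) * N ≤ (l + 2 + 1) * (k + 1 + l) * N := by
        nlinarith
      have := Nat.le_of_mul_le_mul_right h8 hN
      nlinarith
  · have h := hlow _ (hlow2 h3)
    rw [← mul_assoc] at h
    have h := Nat.le_of_mul_le_mul_right h hN
    obtain ⟨i, rfl⟩ := Nat.exists_eq_add_of_le (show b + 1 ≤ k by omega)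
    obtain ⟨j, rfl⟩ := Nat.exists_eq_add_of_le (show b + 1 + i + 2 ≤ q by omega)
    rw [show b + 1 + i + 2 + j - (b + 1 + i) = 2 + j by omega,
      show b + 1 + i + 2 + j - b = i + 3 + j by omega,
      show 1 + (b + 1 + i) - b = i + 2 by omega,
      show b + 1 + i + 2 + j - 1 = b + i + 2 + j by omega] at h
    nlinarith [Nat.zero_le (i * j), Nat.zero_le (i * j * (b + 1 + i + 2 + j))]

end Aux


/-- Key lemma: for a second-weight codeword of `R_q(a(q-1)+b, m)` with support `S`, and a
hyperplane `H = {φ = c₀}` meeting `S` properly, either `S` meets all hyperplanes parallel to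
`H`, or it meets exactly `q-b+1` of them, each in `(q-1)q^(m-a-2)` points, or it meets
exactly `q-1` of them, each in `(q-b+1)q^(m-a-2)` points. -/
theorem stmt7 {F : Type} [Field F] [Fintype F] [DecidableEq F] {m a b : ℕ}
    (hq : 3 ≤ Fintype.card F) (hm : 2 ≤ m) (ha : a ≤ m - 2)
    (hb1 : 2 ≤ b) (hb2 : b ≤ Fintype.card F - 1)
    (f : (Fin m → F) → F)
    (hf : RM F (a * (Fintype.card F - 1) + b) m f)
    (hw : wt f = (Fintype.card F - b + 1) * (Fintype.card F - 1) *
      Fintype.card F ^ (m - a - 2))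
    (φ : (Fin m → F) →ₗ[F] F) (hφ : φ ≠ 0) (c₀ : F)
    (hmeet : ∃ x, f x ≠ 0 ∧ φ x = c₀) (hproper : ∃ x, f x ≠ 0 ∧ φ x ≠ c₀) :
    (∀ c : F, ∃ x, f x ≠ 0 ∧ φ x = c) ∨
    ((Finset.univ.filter fun c : F => ∃ x, f x ≠ 0 ∧ φ x = c).card
        = Fintype.card F - b + 1 ∧
      ∀ c : F, (∃ x, f x ≠ 0 ∧ φ x = c) →
        (Finset.univ.filter fun x : Fin m → F => f x ≠ 0 ∧ φ x = c).card
          = (Fintype.card F - 1) * Fintype.card F ^ (m - a - 2)) ∨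
    ((Finset.univ.filter fun c : F => ∃ x, f x ≠ 0 ∧ φ x = c).card
        = Fintype.card F - 1 ∧
      ∀ c : F, (∃ x, f x ≠ 0 ∧ φ x = c) →
        (Finset.univ.filter fun x : Fin m → F => f x ≠ 0 ∧ φ x = c).card
          = (Fintype.card F - b + 1) * Fintype.card F ^ (m - a - 2)) := by
  obtain ⟨n, rfl⟩ := Nat.exists_eq_add_of_le' (show 1 ≤ m by omega)
  obtain ⟨v, hv⟩ := exists_one hφ
  obtain ⟨e, he, -⟩ := exists_coords φ v hv
  have hDL : DL F (a * (Fintype.card F - 1) + b + 1) (n+1) f := by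
    obtain ⟨P, hP, hf⟩ := hf
    exact ⟨P, Or.inr (by omega), hf⟩
  have hf' := hDL.comp e.toLinearMap
  simp only [LinearEquiv.coe_coe] at hf'
  let W : F → ℕ := fun c => wt (fun w => f (e (Fin.cons c w)))
  have hWc : ∀ c, (Finset.univ.filter fun x : Fin (n+1) → F => f x ≠ 0 ∧ φ x = c).card = W c := by
    intro c
    symm
    refine Finset.card_bij (fun w _ => e (Fin.cons c w)) ?_ ?_ ?_
    · intro w hw
      simp only [Finset.mem_filter, Finset.mem_univ, true_and] at hw ⊢
      exact ⟨hw, by rw [he]; simp⟩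
    · intro w _ w' _ h
      exact (Fin.cons_inj.1 (e.injective h)).2
    · intro x hx
      simp only [Finset.mem_filter, Finset.mem_univ, true_and] at hx
      have h0 : e.symm x 0 = c := by rw [← he (e.symm x), ← hx.2]; simp
      have h1 : e (Fin.cons c (Fin.tail (e.symm x))) = x := by
        rw [← h0, Fin.cons_self_tail]; simp
      refine ⟨Fin.tail (e.symm x), ?_, h1⟩
      simp only [Finset.mem_filter, Finset.mem_univ, true_and]
      rw [h1]; exact hx.1
  have hW0 : ∀ c, (∃ x, f x ≠ 0 ∧ φ x = c) ↔ W c ≠ 0 := by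
    intro c
    rw [← hWc, Finset.card_ne_zero]
    constructor
    · rintro ⟨x, hx⟩; exact ⟨x, by simpa using hx⟩
    · rintro ⟨x, hx⟩; exact ⟨x, by simpa using hx⟩
  have hWz : ∀ c, W c = 0 → ∀ w, f (e (Fin.cons c w)) = 0 := by
    intro c hc w
    have h1 := Finset.card_eq_zero.1 hc
    by_contra h
    have : w ∈ (Finset.univ.filter fun w => f (e (Fin.cons c w)) ≠ 0) := by simpa using h
    rw [h1] at this
    simp at this
  have hWnz : ∀ c, W c ≠ 0 → (fun w => f (e (Fin.cons c w))) ≠ 0 := by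
    intro c hc h
    apply hc
    simp only [W, h]
    simp [wt]
  simp only [hWc, hW0]
  by_cases hall : ∀ c, W c ≠ 0
  · exact Or.inl hall
  right
  push Not at hall
  set K := Finset.univ.filter fun c => W c = 0 with hK
  have hsect : ∀ c, DL F (a * (Fintype.card F - 1) + b + 1 - K.card) n (fun w => f (e (Fin.cons c w))) :=
    fun c => hf'.sect K (fun κ hκ w => hWz κ (by simpa [hK] using hκ) w) c
  have hpow : Fintype.card F ^ (a+1) * Fintype.card F ^ (n + 1 - a - 2) = Fintype.card F ^ n := by
    rw [← pow_add]; congr 1; omega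
  have hqa : 0 < Fintype.card F ^ (a+1) := by positivity
  refine arith_main (Fintype.card F) a b n (Fintype.card F ^ (n + 1 - a - 2)) W rfl hq hb1 hb2
    (by positivity) K hK ?_ ?_ ?_ ?_ ?_ ?_
  · obtain ⟨c, hc⟩ := hall
    exact Finset.card_pos.2 ⟨c, by simpa [hK] using hc⟩
  · have h1 := (hW0 c₀).1 hmeet
    obtain ⟨x, hx, hx2⟩ := hproper
    have h2 := (hW0 (φ x)).1 ⟨x, hx, rfl⟩
    exact Finset.one_lt_card.2 ⟨φ x, by simpa using h2, c₀, by simpa using h1, hx2⟩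
  · rw [← hw, ← wt_comp f e, wt_sections]
  · intro hk c hc
    have := minwt n a (b - K.card) _ (by omega) (hWnz c hc) ((hsect c).mono (by omega))
    rw [← hpow, show Fintype.card F - (b - K.card) = Fintype.card F - b + K.card by omega] at this
    refine Nat.le_of_mul_le_mul_left ?_ hqa
    calc _ = _ := by ring
      _ ≤ _ := this
  · intro hk c hc
    have hkq : K.card ≤ Fintype.card F - 1 := by
      have h1 : K.card < Fintype.card F := by
        rw [← Finset.card_univ]
        refine Finset.card_lt_card ((Finset.ssubset_univ_iff).2 ?_)
        intro h
        have : c ∈ K := h ▸ Finset.mem_univ c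
        exact hc (by simpa [hK] using this)
      omega
    obtain _ | a := a
    · exfalso
      apply hWnz c hc
      exact ((hsect c).mono (by omega : _ ≤ 0)).eq_zero
    have := minwt n a (Fintype.card F - 1 + b - K.card) _ (by omega) (hWnz c hc)
      ((hsect c).mono (by rw [add_mul]; omega))
    rw [← hpow, show Fintype.card F - (Fintype.card F - 1 + b - K.card) = 1 + K.card - b by omega] at this
    refine Nat.le_of_mul_le_mul_left ?_ (show 0 < Fintype.card F ^ (a+1) by positivity)
    calc _ = _ := by ring
      _ ≤ _ := this
  · intro hk c hc
    by_cases hlt : W c < 2 * (Fintype.card F - 1) * Fintype.card F ^ (n + 1 - a - 2)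
    · left
      have := (second hq n a _ (hWnz c hc) ((hsect c).mono (by omega)) (by
        rw [← hpow]
        calc _ < _ := Nat.mul_lt_mul_of_pos_left hlt hqa
          _ = _ := by ring)).1
      rw [← hpow] at this
      refine Nat.eq_of_mul_eq_mul_left (show 0 < Fintype.card F ^ a by positivity) ?_
      calc _ = _ := this
        _ = _ := by ring
    · exact Or.inr (not_lt.1 hlt)
end

section
/- Let $q\geq3$ and $2\leq b\leq q-1$. If $f\in R_q(b,2)$ satisfies $|f|\leq(q-b+1)(q-1)$, then the reduced form of $f$ is a product of $b$ polynomials of degree 1 (i.e., $f$ factors into linear factors). -/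
open Polynomial

def TD {F : Type} [Field F] (n : ℕ) (p : Polynomial (Polynomial F)) : Prop :=
  ∀ i j, (p.coeff j).coeff i ≠ 0 → i + j ≤ n

section
variable {F : Type} [Field F]

theorem TD.mono {m n : ℕ} {p : Polynomial (Polynomial F)} (h : TD m p) (hmn : m ≤ n) : TD n p :=
  fun i j hij => (h i j hij).trans hmn

theorem TD.add {n : ℕ} {p r : Polynomial (Polynomial F)} (hp : TD n p) (hr : TD n r) :
    TD n (p + r) := by
  intro i j h
  by_cases h1 : (p.coeff j).coeff i = 0
  · apply hr
    intro h2
    apply h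
    simp [h1, h2]
  · exact hp i j h1

theorem TD.neg {n : ℕ} {p : Polynomial (Polynomial F)} (hp : TD n p) : TD n (-p) := by
  intro i j h
  apply hp
  simpa using h

theorem TD.sub {n : ℕ} {p r : Polynomial (Polynomial F)} (hp : TD n p) (hr : TD n r) :
    TD n (p - r) := by
  rw [sub_eq_add_neg]; exact hp.add hr.neg

theorem TD.mul {m n : ℕ} {p r : Polynomial (Polynomial F)} (hp : TD m p) (hr : TD n r) :
    TD (m + n) (p * r) := by
  intro i j h
  rw [Polynomial.coeff_mul, Polynomial.finsetSum_coeff] at h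
  obtain ⟨x, hx, h⟩ := Finset.exists_ne_zero_of_sum_ne_zero h
  rw [Polynomial.coeff_mul] at h
  obtain ⟨y, hy, h⟩ := Finset.exists_ne_zero_of_sum_ne_zero h
  have h1 := hp _ _ (left_ne_zero_of_mul h)
  have h2 := hr _ _ (right_ne_zero_of_mul h)
  have h3 := Finset.HasAntidiagonal.mem_antidiagonal.mp hx
  have h4 := Finset.HasAntidiagonal.mem_antidiagonal.mp hy
  omega

theorem TD.CC (a : F) : TD 0 (C (C a)) := by
  intro i j h
  rw [Polynomial.coeff_C] at h
  split_ifs at h with h1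
  · rw [Polynomial.coeff_C] at h
    split_ifs at h with h2
    · omega
    · simp at h
  · simp at h

theorem TD.CX : TD 1 (C (X : Polynomial F)) := by
  intro i j h
  rw [Polynomial.coeff_C] at h
  split_ifs at h with h1
  · rw [Polynomial.coeff_X] at h
    split_ifs at h with h2
    · omega
    · simp at h
  · simp at h

theorem TD.Y : TD 1 (X : Polynomial (Polynomial F)) := by
  intro i j h
  rw [Polynomial.coeff_X] at h
  split_ifs at h with h1
  · rw [Polynomial.coeff_one] at h
    split_ifs at h with h2
    · omega
    · simp at h
  · simp at h

theorem TD.lin (a b c : F) : TD 1 (C (C a * X + C c) + C (C b) * X) := by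
  rw [C_add, C_mul]
  refine ((?_ : TD 1 _).add ?_).add ?_
  · simpa using (TD.CC a).mul TD.CX
  · exact (TD.CC c).mono (by omega)
  · simpa using (TD.CC b).mul TD.Y

theorem TD.prod {ι : Type*} (s : Finset ι) (p : ι → Polynomial (Polynomial F))
    (h : ∀ i ∈ s, TD 1 (p i)) : TD s.card (∏ i ∈ s, p i) := by
  classical
  induction s using Finset.induction_on with
  | empty => simpa using TD.CC (1 : F)
  | insert a s ha ih =>
    rw [Finset.prod_insert ha, Finset.card_insert_of_notMem ha, add_comm]
    exact (h a (by simp)).mul (ih fun i hi => h i (by simp [hi]))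

theorem jam [Fintype F] [DecidableEq F] (S : Finset (F × F)) (h0 : (0, 0) ∈ S) (t : ℕ) (ht : 1 ≤ t)
    (h : ∀ a v : F, (a ≠ 0 ∨ v ≠ 0) → t ≤ (S.filter fun s => 1 + a * s.1 + v * s.2 = 0).card) :
    (t + 1) * (Fintype.card F - 1) + 1 ≤ S.card := by
  set S' := S.erase (0, 0) with hS'
  have hcard : S'.card + 1 = S.card := Finset.card_erase_add_one h0
  have h' : ∀ a v : F, (a ≠ 0 ∨ v ≠ 0) →
      t ≤ (S'.filter fun s => 1 + a * s.1 + v * s.2 = 0).card := by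
    intro a v hav
    refine (h a v hav).trans (Finset.card_le_card ?_)
    intro s hs
    simp only [Finset.mem_filter, hS', Finset.mem_erase] at hs ⊢
    refine ⟨⟨?_, hs.1⟩, hs.2⟩
    rintro rfl
    simp at hs
  let Q : Polynomial (Polynomial F) := ∏ s ∈ S', (C (C s.1 * X + C 1) + C (C s.2) * X)
  have hQ : TD S'.card Q := TD.prod _ _ fun s _ => TD.lin _ _ _
  let P : F → Polynomial F := fun v => ∏ s ∈ S', (C s.1 * X + C (1 + v * s.2))
  have hP : ∀ v, P v = Q.eval (C v) := by
    intro v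
    simp only [P, Q, Polynomial.eval_prod]
    refine Finset.prod_congr rfl fun s _ => ?_
    simp
    ring
  let R := ∑ v, P v
  have hRdeg : ∀ k, R.coeff k ≠ 0 → k + (Fintype.card F - 1) ≤ S'.card := by
    intro k hk
    have : R.coeff k = ∑ j ∈ Q.support, (Q.coeff j).coeff k * ∑ v : F, v ^ j := by
      simp only [R, Polynomial.finsetSum_coeff, hP, Polynomial.eval_eq_sum, Polynomial.sum,
        ← C_pow, Polynomial.coeff_mul_C, Finset.mul_sum]
      rw [Finset.sum_comm]
    rw [this] at hk
    obtain ⟨j, hj, hk⟩ := Finset.exists_ne_zero_of_sum_ne_zero hk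
    have h1 := hQ _ _ (left_ne_zero_of_mul hk)
    have h2 : Fintype.card F - 1 ≤ j := by
      by_contra hlt
      exact right_ne_zero_of_mul hk (FiniteField.sum_pow_lt_card_sub_one F j (by omega))
    omega
  have hR0 : R.eval 0 = 1 := by
    simp only [R, Polynomial.eval_finsetSum]
    rw [Finset.sum_eq_single 0]
    · simp [P, Polynomial.eval_prod]
    · intro v _ hv
      have := h' 0 v (Or.inr hv)
      obtain ⟨s, hs⟩ := Finset.card_pos.mp (lt_of_lt_of_le ht this)
      rw [Finset.mem_filter] at hs
      simp only [P, Polynomial.eval_prod]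
      refine Finset.prod_eq_zero hs.1 ?_
      simpa using hs.2
    · simp
  have hRne : R ≠ 0 := by
    intro h; rw [h] at hR0; simp at hR0
  have hdiv : ∏ a ∈ Finset.univ.erase (0 : F), (X - C a) ^ t ∣ R := by
    refine Finset.prod_dvd_of_coprime ?_ ?_
    · intro a _ b _ hab
      exact (Polynomial.pairwise_coprime_X_sub_C Function.injective_id hab).pow
    · intro a ha
      refine Finset.dvd_sum fun v _ => ?_
      have ha : a ≠ 0 := by simpa using ha
      have h1 := h' a v (Or.inl ha)
      refine (pow_dvd_pow _ h1).trans ?_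
      rw [← Finset.prod_const]
      have e1 : (∏ s ∈ S'.filter (fun s => 1 + a * s.1 + v * s.2 = 0), (C s.1 * X + C (1 + v * s.2)))
        ∣ P v := Finset.prod_dvd_prod_of_subset _ _ _ (Finset.filter_subset _ _)
      refine dvd_trans (Finset.prod_dvd_prod_of_dvd _ _ ?_) e1
      intro s hs
      rw [Polynomial.dvd_iff_isRoot]
      have := (Finset.mem_filter.mp hs).2
      simp
      linear_combination this
  have hd := Polynomial.natDegree_le_of_dvd hdiv hRne
  rw [Polynomial.natDegree_prod_of_monic _ _ (fun a _ => (Polynomial.monic_X_sub_C a).pow t)] at hd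
  simp at hd
  have := hRdeg R.natDegree (by simpa using hRne)
  rw [mul_comm] at hd
  rw [add_mul]
  omega
end
section
variable {F : Type} [Field F]

theorem eis (π : Polynomial F) (hπ : Prime π) (p : Polynomial (Polynomial F)) (hp : p.Monic)
    (hd : 0 < p.natDegree) (h : ∀ i < p.natDegree, π ∣ p.coeff i) (h2 : ¬ π ^ 2 ∣ p.coeff 0) :
    Irreducible p := by
  refine Polynomial.irreducible_of_eisenstein_criterion (P := Ideal.span {π}) ?_ ?_ ?_ ?_ ?_ ?_
  · exact (Ideal.span_singleton_prime hπ.ne_zero).mpr hπ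
  · rw [hp.leadingCoeff, Ideal.mem_span_singleton]
    exact fun h => hπ.not_isUnit (isUnit_of_dvd_one h)
  · intro n hn
    rw [Ideal.mem_span_singleton]
    exact h n (Polynomial.coe_lt_degree.mp hn)
  · exact Polynomial.natDegree_pos_iff_degree_pos.mp hd
  · rwa [Ideal.span_singleton_pow, Ideal.mem_span_singleton]
  · exact hp.isPrimitive

theorem exπ (u : Polynomial F) (hu : u.Separable) (hd : 0 < u.natDegree) :
    ∃ π, Prime π ∧ π ∣ u ∧ ¬ π ^ 2 ∣ u := by
  have hu0 : u ≠ 0 := by rintro rfl; simp at hd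
  obtain ⟨π, h1, h2⟩ := WfDvdMonoid.exists_irreducible_factor
    (fun h => by have := Polynomial.natDegree_eq_zero_of_isUnit h; omega) hu0
  refine ⟨π, h1.prime, h2, fun h => ?_⟩
  rw [sq] at h
  exact h1.not_isUnit (hu.squarefree π h)

theorem irr1 (u : Polynomial F) (hu : u.Separable) (hd : 0 < u.natDegree) (n : ℕ) (hn : 0 < n) :
    Irreducible (X ^ n - C u : Polynomial (Polynomial F)) := by
  obtain ⟨π, h1, h2, h3⟩ := exπ u hu hd
  have hdeg : (X ^ n - C u : Polynomial (Polynomial F)).natDegree = n := natDegree_X_pow_sub_C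
  refine eis π h1 _ (monic_X_pow_sub_C u hn.ne') (by omega) ?_ ?_
  · intro i hi
    rw [hdeg] at hi
    rw [coeff_sub, coeff_X_pow, coeff_C, if_neg (by omega)]
    split_ifs
    · simpa using h2
    · simp
  · rw [coeff_sub, coeff_X_pow, coeff_C, if_neg (by omega)]
    simpa using h3

theorem irr_contra {p g : Polynomial (Polynomial F)} (hp : Irreducible p)
    (hg : g.Monic) (h : g ∣ p) (h0 : 0 < g.natDegree) (h1 : g.natDegree < p.natDegree) : False := by
  rcases hp.dvd_iff.mp h with h | h
  · have := Polynomial.natDegree_eq_zero_of_isUnit h; omega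
  · have := Polynomial.natDegree_le_of_dvd h.dvd hg.ne_zero
    omega

def Fac (g : Polynomial (Polynomial F)) : Prop :=
  ∃ m : Multiset (Polynomial F), (∀ l ∈ m, l.natDegree ≤ 1) ∧ g = (m.map fun l => X - C l).prod

theorem fac_of [Fintype F] (p g : Polynomial (Polynomial F)) (hg : g.Monic) (h : g ∣ p) (hp : p ≠ 0)
    (hd : p.natDegree ≤ Fintype.card F) (l : F → Polynomial F) (hl : Function.Injective l)
    (hl1 : ∀ k, (l k).natDegree ≤ 1) (hr : ∀ k, p.eval (l k) = 0) : Fac g := by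
  have hroots : p.roots = (Finset.univ : Finset F).val.map l := by
    symm
    apply Multiset.eq_of_le_of_card_le
    · rw [Multiset.le_iff_subset (Finset.univ.nodup.map hl)]
      intro x hx
      rw [Multiset.mem_map] at hx
      obtain ⟨k, -, rfl⟩ := hx
      rw [mem_roots hp]; exact hr k
    · refine (Polynomial.card_roots' p).trans (hd.trans ?_)
      simp
  have hs : p.Splits := by
    rw [splits_iff_card_roots]
    apply le_antisymm (card_roots' p)
    rw [hroots]
    simpa using hd
  have hgs := hs.of_dvd hp h
  refine ⟨g.roots, ?_, hgs.eq_prod_roots_of_monic hg⟩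
  intro r hr
  have := Multiset.mem_of_le (roots.le_of_dvd hp h) hr
  rw [hroots, Multiset.mem_map] at this
  obtain ⟨k, -, rfl⟩ := this
  exact hl1 k

theorem frobA [Fintype F] {A : Type*} [CommRing A] [Algebra F A] (a b : A) :
    (a + b) ^ Fintype.card F = a ^ Fintype.card F + b ^ Fintype.card F :=
  map_add (FiniteField.frobeniusAlgHom F A) a b

theorem CCpow [Fintype F] (a : F) (n : ℕ) (hn : Fintype.card F = n + 1) :
    (C (C a) : Polynomial (Polynomial F)) ^ (n+1) = C (C a) := by
  rw [← C_pow, ← C_pow, ← hn, FiniteField.pow_card]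

theorem cls [Fintype F] (n c : ℕ) (hn : Fintype.card F = n + 1) (hc : 2 ≤ c) (hcn : c < n)
    (g : Polynomial (Polynomial F)) (hg : g.Monic) (hgc : g.natDegree = c) (α β γ : F)
    (h : g ∣ X ^ (n+1) - X - C (X ^ n - 1) * (C (C γ) * X + C (C α * X + C β))) : Fac g := by
  set Φ : Polynomial (Polynomial F) :=
    X ^ (n+1) - X - C (X ^ n - 1) * (C (C γ) * X + C (C α * X + C β)) with hΦ
  have hqF : ((n : F) + 1) = 0 := by
    have := FiniteField.cast_card_eq_zero F
    rw [hn] at this; simpa using this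
  have hfr : ∀ a b : Polynomial (Polynomial F), (a + b) ^ (n+1) = a ^ (n+1) + b ^ (n+1) := by
    intro a b; rw [← hn]; exact frobA a b
  have hfr1 : ∀ a b : Polynomial F, (a + b) ^ (n+1) = a ^ (n+1) + b ^ (n+1) := by
    intro a b; rw [← hn]; exact frobA a b
  have hCC : ∀ a : F, (C (C a) : Polynomial (Polynomial F)) ^ (n+1) = C (C a) :=
    fun a => CCpow a n hn
  have hC1 : ∀ a : F, (C a : Polynomial F) ^ (n+1) = C a := by
    intro a; rw [← C_pow, ← hn, FiniteField.pow_card]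
  have hΦd : Φ.natDegree = n + 1 ∧ Φ.Monic := by
    have e : Φ = X ^ (n+1) - (X + C (X ^ n - 1) * (C (C γ) * X + C (C α * X + C β))) := by
      rw [hΦ]; ring
    have hlt : (X + C (X ^ n - 1) * (C (C γ) * X + C (C α * X + C β))
      : Polynomial (Polynomial F)).degree < (n+1 : ℕ) := by
      refine lt_of_le_of_lt (b := (1 : WithBot ℕ)) ?_ (by exact_mod_cast (by omega : 1 < n + 1))
      compute_degree!
    constructor
    · rw [e]
      refine natDegree_eq_of_degree_eq_some ?_
      rw [degree_sub_eq_left_of_degree_lt] <;> rw [degree_X_pow]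
      exact hlt
    · rw [e, sub_eq_add_neg]
      exact monic_X_pow_add (by rwa [degree_neg])
  have shift : ∀ s : Polynomial F, (g.comp (X + C s)).Monic ∧ (g.comp (X + C s)).natDegree = c ∧
      g.comp (X + C s) ∣ Φ.comp (X + C s) ∧ (Φ.comp (X + C s)).natDegree = n + 1 ∧
      (Φ.comp (X + C s)).Monic := by
    intro s
    refine ⟨hg.comp_X_add_C s, ?_, ?_, ?_, hΦd.2.comp_X_add_C s⟩
    · rw [natDegree_comp, natDegree_X_add_C, hgc, mul_one]
    · obtain ⟨k, hk⟩ := h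
      rw [hk, mul_comp]; exact dvd_mul_right _ _
    · rw [natDegree_comp, natDegree_X_add_C, hΦd.1, mul_one]
  by_cases h0 : γ = 0
  · by_cases hb : β = 0
    · refine fac_of Φ g hg h hΦd.2.ne_zero (by omega) (fun k => C α * X + C k) ?_ ?_ ?_
      · intro a b hab
        simpa using hab
      · intro k; compute_degree
      · intro k
        simp only [hΦ, h0, hb, eval_sub, eval_add, eval_mul, eval_pow, eval_X, eval_C, hfr1, mul_pow, hC1]
        simp only [C_0]; ring
    · exfalso
      obtain ⟨e1, e2, e3, e4, e5⟩ := shift (C α * X)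
      have e6 : Φ.comp (X + C (C α * X)) = X ^ (n+1) - X - C (C β) * C (X ^ n - 1) := by
        simp only [hΦ, h0, sub_comp, zero_comp, one_comp, add_comp, mul_comp, pow_comp, X_comp, C_comp, hfr, mul_pow,
          hCC, C_mul, C_add, C_sub, C_pow, C_0, C_1]
        ring
      have hirr : Irreducible (Φ.comp (X + C (C α * X))) := by
        rw [← MulEquiv.irreducible_iff (Bivariate.swap (R := F)).toMulEquiv]
        have : (Bivariate.swap (R := F)) (Φ.comp (X + C (C α * X))) =
            C (C (-β)) * (X ^ n - C (C β⁻¹ * (X ^ (n + 1) - X) + 1)) := by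
          have hb' : (C (C β) : Polynomial (Polynomial F)) * C (C β⁻¹) = 1 := by
            rw [← C_mul, ← C_mul, mul_inv_cancel₀ hb]; simp
          rw [e6]
          simp only [map_sub, map_mul, map_pow, map_add, map_one, map_neg, Bivariate.swap_X, Bivariate.swap_Y,
            Bivariate.swap_C_C]
          linear_combination (-(C X) ^ (n+1) + C X) * hb'
        show Irreducible ((Bivariate.swap (R := F)) (Φ.comp (X + C (C α * X))))
        rw [this]
        have hun : IsUnit (C (C (-β)) : Polynomial (Polynomial F)) := by
          rw [isUnit_C, isUnit_C]; simpa using hb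
        rw [irreducible_isUnit_mul hun]
        refine irr1 _ ?_ ?_ n (by omega)
        · have hder : derivative (C β⁻¹ * (X ^ (n + 1) - X) + 1 : Polynomial F) = C (-β⁻¹) := by
            simp [derivative_X_pow, hqF]
          rw [separable_def, hder]
          refine ⟨0, C (-β), ?_⟩
          rw [← C_mul]
          simp [hb]
        · have : (C β⁻¹ * (X ^ (n + 1) - X) + 1 : Polynomial F).natDegree = n + 1 := by
            compute_degree!
            · rw [if_neg (by omega)]; simpa using hb
          omega
      exact irr_contra hirr e1 e3 (by omega) (by omega)
  by_cases h1 : γ = 1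
  · by_cases ha : α = 0
    · refine fac_of Φ g hg h hΦd.2.ne_zero (by omega) (fun k => C k * X + C (-β)) ?_ ?_ ?_
      · intro a b hab
        simpa using hab
      · intro k; compute_degree
      · intro k
        simp only [hΦ, h1, ha, eval_sub, eval_add, eval_mul, eval_pow, eval_X, eval_C, hfr1, mul_pow, hC1]
        simp only [C_0, C_1, C_neg]; ring
    · exfalso
      obtain ⟨e1, e2, e3, e4, e5⟩ := shift (C (-β))
      have e6 : Φ.comp (X + C (C (-β))) = X ^ (n+1) + C (-X ^ n) * X
          + C (X * (C α - C α * X ^ n)) := by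
        simp only [hΦ, h1, sub_comp, zero_comp, one_comp, add_comp, mul_comp, pow_comp, X_comp, C_comp, hfr,
          hCC, C_mul, C_add, C_sub, C_pow, C_1]
        simp only [C_neg, C_pow]
        ring
      refine irr_contra (eis X prime_X _ e5 (by omega) ?_ ?_) e1 e3 (by omega) (by omega)
      · intro i hi
        rw [e4] at hi
        rw [e6, coeff_add, coeff_add, coeff_X_pow, if_neg (by omega), coeff_C_mul, coeff_C]
        refine dvd_add (dvd_add (dvd_zero _) ?_) ?_
        · refine Dvd.dvd.mul_right ?_ _
          rw [dvd_neg]; exact dvd_pow_self _ (by omega)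
        · split_ifs
          · exact dvd_mul_right _ _
          · exact dvd_zero _
      · rw [e6, coeff_add, coeff_add, coeff_X_pow, if_neg (by omega), coeff_C_mul, coeff_C]
        simp only [coeff_X_zero, mul_zero, zero_add, if_true]
        rw [sq, mul_dvd_mul_iff_left X_ne_zero, X_dvd_iff]
        simp [coeff_X_pow, show ¬ (0 = n) by omega, show n ≠ 0 by omega, ha]
  · exfalso
    have h1' : 1 - γ ≠ 0 := fun h => h1 (by linear_combination -h)
    obtain ⟨δ, hδ⟩ : ∃ δ, γ * δ + α = δ := ⟨α / (1 - γ), by field_simp; ring⟩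
    obtain ⟨ε, hε⟩ : ∃ ε, γ * ε + β = 0 := ⟨-β / γ, by field_simp; ring⟩
    obtain ⟨e1, e2, e3, e4, e5⟩ := shift (C δ * X + C ε)
    have hδ' : (C (C γ) * C (C δ) + C (C α) : Polynomial (Polynomial F)) = C (C δ) := by
      simp only [← C_mul, ← C_add, hδ]
    have hε' : (C (C γ) * C (C ε) + C (C β) : Polynomial (Polynomial F)) = 0 := by
      simp only [← C_mul, ← C_add, hε, C_0]
    have e6 : Φ.comp (X + C (C δ * X + C ε)) = (X ^ n - C (C γ * X ^ n + C (1 - γ))) * X := by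
      simp only [hΦ, sub_comp, zero_comp, one_comp, add_comp, mul_comp, pow_comp, X_comp, C_comp, hfr, mul_pow,
          hCC, C_mul, C_add, C_sub, C_pow, C_1]
      linear_combination (1 - C X ^ n) * C X * hδ' + (1 - C X ^ n) * hε'
    have hI : Irreducible (X ^ n - C (C γ * X ^ n + C (1 - γ)) : Polynomial (Polynomial F)) := by
      refine irr1 _ ?_ ?_ n (by omega)
      · rw [separable_def]
        have hder : (C γ * X ^ n + C (1 - γ) : Polynomial F) + X * derivative (C γ * X ^ n + C (1 - γ) : Polynomial F) = C (1 - γ) := by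
          have hqF' : (C (n : F) : Polynomial F) + 1 = 0 := by rw [← C_1, ← C_add, hqF, C_0]
          obtain ⟨m, rfl⟩ : ∃ m, n = m + 1 := ⟨n - 1, by omega⟩
          simp only [derivative_add, derivative_C_mul, derivative_X_pow, derivative_C, add_zero]
          simp only [Nat.add_sub_cancel]
          linear_combination C γ * X ^ (m+1) * hqF'
        refine ⟨C (1-γ)⁻¹, C (1-γ)⁻¹ * X, ?_⟩
        have : (C (1-γ)⁻¹ : Polynomial F) * C (1-γ) = 1 := by
          rw [← C_mul, inv_mul_cancel₀ h1', C_1]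
        linear_combination C (1-γ)⁻¹ * hder + this
      · have : (C γ * X ^ n + C (1 - γ) : Polynomial F).natDegree = n := by
          compute_degree!
          rw [if_neg (by omega)]; simpa using h0
        omega
    rw [e6] at e3
    by_cases hdv : (X ^ n - C (C γ * X ^ n + C (1 - γ))) ∣ g.comp (X + C (C δ * X + C ε))
    · have := natDegree_le_of_dvd hdv e1.ne_zero
      rw [natDegree_X_pow_sub_C] at this
      omega
    · have := ((hI.isRelPrime_iff_not_dvd.mpr hdv).symm.dvd_of_dvd_mul_left e3)
      have := natDegree_le_of_dvd this X_ne_zero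
      rw [natDegree_X] at this
      omega
end
section
variable {F : Type} [Field F]

theorem TD.coeff_eq_zero {n j : ℕ} {p : Polynomial (Polynomial F)} (h : TD n p) (hj : n < j) :
    p.coeff j = 0 := by
  ext i
  by_contra hne
  have := h i j (by simpa using hne)
  omega

theorem TD.natDegree_le {n : ℕ} {p : Polynomial (Polynomial F)} (h : TD n p) : p.natDegree ≤ n := by
  rw [Polynomial.natDegree_le_iff_coeff_eq_zero]
  intro j hj
  exact h.coeff_eq_zero hj

theorem TD.coeff_natDegree {n j : ℕ} {p : Polynomial (Polynomial F)} (h : TD n p)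
    (hj : p.coeff j ≠ 0) : (p.coeff j).natDegree + j ≤ n :=
  h _ _ (by simpa using hj)

theorem red (c : ℕ) (hc : 1 ≤ c) (g : Polynomial (Polynomial F)) (hg : g.Monic)
    (hgc : g.natDegree = c) (hT : TD c g) (n : ℕ) :
    ∃ r : Polynomial (Polynomial F), g ∣ X ^ n - r ∧ TD n r ∧ ∀ j, c ≤ j → r.coeff j = 0 := by
  induction n with
  | zero =>
    refine ⟨1, by simp, by simpa using TD.CC (1 : F), ?_⟩
    intro j hj
    rw [coeff_one, if_neg (by omega)]
  | succ n ih =>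
    obtain ⟨r, h1, h2, h3⟩ := ih
    refine ⟨X * r - C (r.coeff (c - 1)) * g, ?_, ?_, ?_⟩
    · obtain ⟨k, hk⟩ := h1
      exact ⟨X * k + C (r.coeff (c - 1)), by linear_combination X * hk⟩
    · refine TD.sub ?_ ?_
      · rw [add_comm n 1]; exact TD.Y.mul h2
      · by_cases h0 : r.coeff (c - 1) = 0
        · rw [h0]; intro i j hij; simp at hij
        · have h4 := h2.coeff_natDegree h0
          have h5 : TD (n + 1 - c) (C (r.coeff (c - 1))) := by
            intro i j hij
            rw [coeff_C] at hij
            split_ifs at hij with hj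
            · have := h2 _ _ hij
              omega
            · simp at hij
          exact (h5.mul hT).mono (by omega)
    · intro j hj
      obtain ⟨i, rfl⟩ : ∃ i, j = i + 1 := ⟨j - 1, by omega⟩
      rw [coeff_sub, coeff_X_mul, coeff_C_mul]
      by_cases hi : i + 1 = c
      · have : g.coeff (i + 1) = 1 := by rw [hi, ← hgc]; exact hg
        rw [this, ← hi]; simp
      · rw [h3 i (by omega), coeff_eq_zero_of_natDegree_lt (p := g) (by omega)]; simp

theorem evE (p : Polynomial (Polynomial F)) (x y : F) :
    p.evalEval x y = (p.map (evalRingHom x)).eval y := (Polynomial.map_evalRingHom_eval x y p).symm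

theorem pzero [Fintype F] [DecidableEq F] (p : Polynomial F) (c : ℕ) (hp : p.natDegree < c)
    (h : c ≤ (Finset.univ.filter fun y => p.eval y = 0).card) : p = 0 := by
  refine Polynomial.eq_zero_of_natDegree_lt_card_of_eval_eq_zero' p _ ?_ (lt_of_lt_of_le hp h)
  intro y hy; simpa using hy

theorem dvdN (A : Finset F) (p : Polynomial F) (h : ∀ a ∈ A, p.eval a = 0) :
    ∏ a ∈ A, (X - C a) ∣ p := by
  refine Finset.prod_dvd_of_coprime ?_ ?_
  · intro a _ b _ hab
    exact Polynomial.pairwise_coprime_X_sub_C Function.injective_id hab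
  · intro a ha
    rw [Polynomial.dvd_iff_isRoot]; exact h a ha

theorem natDegN (A : Finset F) : (∏ a ∈ A, (X - C a)).natDegree = A.card := by
  rw [natDegree_prod_of_monic _ _ (fun a _ => monic_X_sub_C a)]; simp

theorem prodN [Fintype F] [DecidableEq F] (n : ℕ) (hn0 : 0 < n) (hn : Fintype.card F = n + 1) :
    ∏ a ∈ Finset.univ.erase (0 : F), (X - C a) = X ^ n - 1 := by
  have hm : (∏ a ∈ Finset.univ.erase (0 : F), (X - C a)).Monic :=
    monic_prod_of_monic _ _ fun a _ => monic_X_sub_C a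
  have hm2 : (X ^ n - 1 : Polynomial F).Monic := by
    simpa using monic_X_pow_sub_C (1 : F) hn0.ne'
  refine (eq_of_monic_of_dvd_of_natDegree_le hm hm2 ?_ ?_).symm
  · apply dvdN
    intro a ha
    have : a ≠ 0 := by simpa using ha
    have h2 := FiniteField.pow_card_sub_one_eq_one a this
    rw [hn, Nat.add_sub_cancel] at h2
    simp [h2]
  · rw [natDegN]
    have : (X ^ n - 1 : Polynomial F).natDegree = n := by
      simpa using natDegree_X_pow_sub_C (n := n) (r := (1 : F))
    rw [this]; simp [hn]

theorem sect [Fintype F] [DecidableEq F] (n c : ℕ) (hn : Fintype.card F = n + 1) (hc : 2 ≤ c)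
    (hcn : c < n) (g : Polynomial (Polynomial F)) (hg : g.Monic) (hgc : g.natDegree = c)
    (hT : TD c g)
    (h : ∀ a : F, a ≠ 0 → c ≤ (Finset.univ.filter fun y => g.evalEval a y = 0).card) : Fac g := by
  obtain ⟨r, h1, h2, h3⟩ := red c (by omega) g hg hgc hT (n + 1)
  set r2 := r - X with hr2
  have hd : g ∣ X ^ (n+1) - X - r2 := by
    rw [hr2]; convert h1 using 1; ring
  have hT2 : TD (n + 1) r2 := h2.sub (TD.Y.mono (by omega))
  have hr2c : ∀ j, c ≤ j → r2.coeff j = 0 := by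
    intro j hj
    rw [hr2, coeff_sub, h3 j hj, coeff_X, if_neg (by omega)]; simp
  have hr2d : r2.natDegree < c := by
    have : r2.natDegree ≤ c - 1 := by
      rw [natDegree_le_iff_coeff_eq_zero]
      intro j hj; exact hr2c j (by omega)
    omega
  have hz : ∀ a : F, a ≠ 0 → r2.map (evalRingHom a) = 0 := by
    intro a ha
    refine pzero _ c (lt_of_le_of_lt natDegree_map_le hr2d) ((h a ha).trans (Finset.card_le_card ?_))
    intro y hy
    simp only [Finset.mem_filter, Finset.mem_univ, true_and] at hy ⊢
    rw [← evE]
    obtain ⟨k, hk⟩ := hd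
    have h4 : (X ^ (n+1) - X - r2 : Polynomial (Polynomial F)).evalEval a y = (g * k).evalEval a y := by
      rw [hk]
    rw [evalEval_mul, hy, zero_mul, evalEval_sub, evalEval_sub, evalEval_pow, evalEval_X, ← hn,
      FiniteField.pow_card] at h4
    linear_combination -h4
  have hdv : ∀ j, (X ^ n - 1 : Polynomial F) ∣ r2.coeff j := by
    intro j
    rw [← prodN n (by omega) hn]
    apply dvdN
    intro a ha
    have h5 := hz a (by simpa using ha)
    have h6 : (r2.map (evalRingHom a)).coeff j = 0 := by rw [h5]; simp
    rw [coeff_map] at h6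
    simpa using h6
  have hnd : (X ^ n - 1 : Polynomial F).natDegree = n := by
    simpa using natDegree_X_pow_sub_C (n := n) (r := (1 : F))
  have hne : (X ^ n - 1 : Polynomial F) ≠ 0 := by
    intro h; rw [h] at hnd; simp at hnd; omega
  have hw : ∀ j, ∃ w : Polynomial F, r2.coeff j = (X ^ n - 1) * w ∧ (w ≠ 0 → w.natDegree + j ≤ 1) := by
    intro j
    obtain ⟨w, hw⟩ := hdv j
    refine ⟨w, hw, fun hw0 => ?_⟩
    have h7 := hT2.coeff_natDegree (j := j) (by rw [hw]; exact mul_ne_zero hne hw0)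
    rw [hw, natDegree_mul hne hw0, hnd] at h7
    omega
  obtain ⟨w0, hw0, hw0'⟩ := hw 0
  obtain ⟨w1, hw1, hw1'⟩ := hw 1
  have e1 : w1 = C (w1.coeff 0) := by
    apply eq_C_of_natDegree_eq_zero
    by_cases h : w1 = 0
    · simp [h]
    · have := hw1' h; omega
  have e0 : w0 = C (w0.coeff 1) * X + C (w0.coeff 0) := by
    apply eq_X_add_C_of_natDegree_le_one
    by_cases h : w0 = 0
    · simp [h]
    · have := hw0' h; omega
  have er : r2 = C (r2.coeff 1) * X + C (r2.coeff 0) := by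
    apply eq_X_add_C_of_natDegree_le_one
    rw [natDegree_le_iff_coeff_eq_zero]
    intro j hj
    obtain ⟨w, hw, hw'⟩ := hw j
    rw [hw]
    by_cases h : w = 0
    · simp [h]
    · have := hw' h; omega
  refine cls n c hn hc hcn g hg hgc (w0.coeff 1) (w0.coeff 0) (w1.coeff 0) ?_
  convert hd using 2
  rw [er, ← e0, ← e1, hw0, hw1]
  simp only [C_mul]; ring
end
section
variable {F : Type} [Field F]

def PL (b : ℕ) (f : F → F → F) : Prop :=
  ∃ (κ : F) (s : Multiset (F × F × F)), Multiset.card s ≤ b ∧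
    ∀ x y, f x y = κ * (s.map fun l => l.1 * x + l.2.1 * y + l.2.2).prod

theorem PL.comp {b : ℕ} {f : F → F → F} (h : PL b f) (a1 b1 c1 a2 b2 c2 : F) :
    PL b fun x y => f (a1 * x + b1 * y + c1) (a2 * x + b2 * y + c2) := by
  obtain ⟨κ, s, hs, h⟩ := h
  refine ⟨κ, s.map fun l => (l.1 * a1 + l.2.1 * a2, l.1 * b1 + l.2.1 * b2,
    l.1 * c1 + l.2.1 * c2 + l.2.2), by simpa using hs, ?_⟩
  intro x y
  beta_reduce
  rw [h, Multiset.map_map]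
  congr 2
  apply Multiset.map_congr rfl
  intro l _
  simp only [Function.comp]
  ring

theorem TD.one_eval {g : Polynomial (Polynomial F)} (h : TD 1 g) (x y : F) :
    g.evalEval x y = (g.coeff 0).coeff 1 * x + (g.coeff 1).coeff 0 * y + (g.coeff 0).coeff 0 := by
  have e : g = C (g.coeff 1) * X + C (g.coeff 0) := eq_X_add_C_of_natDegree_le_one h.natDegree_le
  have e1 : g.coeff 1 = C ((g.coeff 1).coeff 0) := by
    apply eq_C_of_natDegree_eq_zero
    by_cases h0 : g.coeff 1 = 0
    · simp [h0]
    · have := h.coeff_natDegree h0; omega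
  have e0 : g.coeff 0 = C ((g.coeff 0).coeff 1) * X + C ((g.coeff 0).coeff 0) := by
    apply eq_X_add_C_of_natDegree_le_one
    by_cases h0 : g.coeff 0 = 0
    · simp [h0]
    · have := h.coeff_natDegree h0; omega
  conv_lhs => rw [e, e1, e0]
  simp [evalEval]
  ring

theorem card_nz [Fintype F] [DecidableEq F] (p : Polynomial F) (c : ℕ) (hp : p.natDegree ≤ c)
    (h0 : p ≠ 0) : Fintype.card F ≤ (Finset.univ.filter fun y => p.eval y ≠ 0).card + c := by
  have h1 := Finset.card_filter_add_card_filter_not (s := (Finset.univ : Finset F)) (fun y => p.eval y = 0)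
  have h2 : (Finset.univ.filter fun y => p.eval y = 0).card ≤ c := by
    by_contra hlt
    exact h0 (pzero p (c + 1) (by omega) (by omega))
  rw [Finset.card_univ] at h1
  simp only [ne_eq]
  omega

theorem arith (q b k : ℕ) (hk : 2 ≤ k) (hkb : k + 2 ≤ b) (hbq : b < q)
    (h : (q - k) * (q - b + k) ≤ (q - b + 1) * (q - 1)) : False := by
  obtain ⟨v, rfl⟩ : ∃ v, b = k + 2 + v := ⟨b - (k + 2), by omega⟩
  obtain ⟨u, rfl⟩ : ∃ u, q = k + 2 + v + u := ⟨q - (k + 2 + v), by omega⟩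
  rw [show k + 2 + v + u - k = 2 + v + u by omega, show k + 2 + v + u - (k + 2 + v) = u by omega,
    show k + 2 + v + u - 1 = k + 1 + v + u by omega] at h
  nlinarith [Nat.mul_le_mul hk (le_refl (1 + v))]

theorem main2 [Fintype F] [DecidableEq F] (b : ℕ) (hb1 : 2 ≤ b) (hb2 : b < Fintype.card F)
    (p : Polynomial (Polynomial F)) (hp : TD b p) (h0 : ∀ y, p.evalEval 0 y = 0)
    (hw : (Finset.univ.filter fun v : F × F => p.evalEval v.1 v.2 ≠ 0).card ≤
      (Fintype.card F - b + 1) * (Fintype.card F - 1)) : PL b fun x y => p.evalEval x y := by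
  by_cases hp0 : p = 0
  · refine ⟨0, 0, by simp, ?_⟩
    intro x y; rw [hp0]; simp
  set q := Fintype.card F with hq
  let A : Finset F := Finset.univ.filter fun a => ∀ y, p.evalEval a y = 0
  have hA : ∀ a, a ∈ A ↔ ∀ y, p.evalEval a y = 0 := by intro a; simp [A]
  have hcol : ∀ a ∈ A, ∀ j, (p.coeff j).eval a = 0 := by
    intro a ha j
    have h1 : p.map (evalRingHom a) = 0 := by
      refine pzero _ q (lt_of_le_of_lt (natDegree_map_le.trans hp.natDegree_le) hb2) ?_
      rw [Finset.filter_true_of_mem, Finset.card_univ]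
      intro y _
      rw [← evE]; exact (hA a).mp ha y
    have h2 : (p.map (evalRingHom a)).coeff j = 0 := by rw [h1]; simp
    simpa [coeff_map] using h2
  let N : Polynomial F := ∏ a ∈ A, (X - C a)
  have hNm : N.Monic := monic_prod_of_monic _ _ fun a _ => monic_X_sub_C a
  have hNd : N.natDegree = A.card := natDegN A
  obtain ⟨g, hg⟩ : C N ∣ p := by
    rw [C_dvd_iff_dvd_coeff]
    intro j
    exact dvdN A _ fun a ha => hcol a ha j
  set k := A.card with hk
  have hgT : ∀ i j, (g.coeff j).coeff i ≠ 0 → i + j + k ≤ b := by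
    intro i j hij
    have hgj : g.coeff j ≠ 0 := by rintro h; rw [h] at hij; simp at hij
    have h3 := hp.coeff_natDegree (j := j) (by rw [hg, coeff_C_mul]; exact mul_ne_zero hNm.ne_zero hgj)
    rw [hg, coeff_C_mul, natDegree_mul hNm.ne_zero hgj, hNd] at h3
    have := le_natDegree_of_ne_zero hij
    omega
  have hg0 : g ≠ 0 := by rintro rfl; simp at hg; exact hp0 hg
  have hkb : k ≤ b := by
    have := hgT (g.coeff g.natDegree).natDegree g.natDegree (by simpa using hg0)
    omega
  have hgT' : TD (b - k) g := fun i j hij => by have := hgT i j hij; omega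
  have hev : ∀ x y, p.evalEval x y = (∏ a ∈ A, (x - a)) * g.evalEval x y := by
    intro x y
    rw [hg, evalEval_mul, evalEval_C]
    simp [N, eval_prod]
  have h0A : (0 : F) ∈ A := (hA 0).mpr h0
  have hk1 : 1 ≤ k := Finset.card_pos.mpr ⟨0, h0A⟩
  have hPA : ∀ x y : F, ∏ a ∈ A, (x - a) =
      ((A.val.map fun a => ((1 : F), (0 : F), -a)).map fun l => l.1 * x + l.2.1 * y + l.2.2).prod := by
    intro x y
    rw [Multiset.map_map, Finset.prod_eq_multiset_prod]
    congr 1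
    apply Multiset.map_congr rfl
    intro a _
    simp; ring
  by_cases hkb2 : b ≤ k + 1
  · by_cases hkb3 : k = b
    · have hgc : g = C (C ((g.coeff 0).coeff 0)) := by
        have hT0 : TD 0 g := by rw [hkb3, Nat.sub_self] at hgT'; exact hgT'
        have e1 := eq_C_of_natDegree_eq_zero (Nat.le_zero.mp hT0.natDegree_le)
        have e2 : g.coeff 0 = C ((g.coeff 0).coeff 0) := by
          apply eq_C_of_natDegree_eq_zero
          by_cases h : g.coeff 0 = 0
          · simp [h]
          · have := hT0.coeff_natDegree h; omega
        rw [← e2]; exact e1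
      refine ⟨(g.coeff 0).coeff 0, A.val.map fun a => ((1 : F), (0 : F), -a), ?_, ?_⟩
      · simp only [Multiset.card_map, Finset.card_val]; omega
      · intro x y
        beta_reduce
        rw [hev, hPA x y, mul_comm]
        congr 1
        rw [hgc]
        simp [evalEval]
    · have hT1 : TD 1 g := hgT'.mono (by omega)
      refine ⟨1, ((g.coeff 0).coeff 1, (g.coeff 1).coeff 0, (g.coeff 0).coeff 0) ::ₘ
        A.val.map fun a => ((1 : F), (0 : F), -a), ?_, ?_⟩
      · simp only [Multiset.card_cons, Multiset.card_map, Finset.card_val]; omega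
      · intro x y
        beta_reduce
        rw [hev, hPA x y, hT1.one_eval, Multiset.map_cons, Multiset.prod_cons]
        ring
  -- column counts
  have hgne : ∀ a, a ∉ A → g.map (evalRingHom a) ≠ 0 := by
    intro a ha hz
    apply ha
    rw [hA]
    intro y
    rw [hev, evE, hz]; simp
  have hsame : ∀ a, a ∉ A → ∀ y, p.evalEval a y ≠ 0 ↔ (g.map (evalRingHom a)).eval y ≠ 0 := by
    intro a ha y
    rw [hev, ← evE, mul_ne_zero_iff]
    refine and_iff_right ?_
    rw [Finset.prod_ne_zero_iff]
    intro a' ha' h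
    rw [sub_eq_zero] at h
    exact ha (h ▸ ha')
  let nz : F → ℕ := fun a => (Finset.univ.filter fun y => (g.map (evalRingHom a)).eval y ≠ 0).card
  have hnz : ∀ a, a ∉ A → q - b + k ≤ nz a := by
    intro a ha
    have := card_nz (g.map (evalRingHom a)) (b - k) (natDegree_map_le.trans hgT'.natDegree_le) (hgne a ha)
    simp only [nz]
    omega
  have hsum : ∑ a ∈ Finset.univ \ A, nz a ≤ (q - b + 1) * (q - 1) := by
    refine le_trans ?_ hw
    have e : (Finset.univ.filter fun v : F × F => p.evalEval v.1 v.2 ≠ 0).card =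
        ∑ a, (Finset.univ.filter fun y => p.evalEval a y ≠ 0).card := by
      rw [Finset.card_filter, Fintype.sum_prod_type]
      refine Finset.sum_congr rfl fun a _ => ?_
      rw [Finset.card_filter]
    rw [e]
    refine le_trans (le_of_eq ?_) (Finset.sum_le_sum_of_subset (Finset.subset_univ (Finset.univ \ A)))
    refine Finset.sum_congr rfl fun a ha => ?_
    have ha : a ∉ A := by simpa using ha
    simp only [nz]
    congr 1
    ext y
    simp only [Finset.mem_filter, Finset.mem_univ, true_and]
    exact (hsame a ha y).symm
  have hcardc : (Finset.univ \ A).card = q - k := by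
    rw [Finset.card_sdiff_of_subset (Finset.subset_univ _), Finset.card_univ]
  by_cases hk2 : 2 ≤ k
  · exfalso
    refine arith q b k hk2 (by omega) hb2 (le_trans ?_ hsum)
    rw [← hcardc, ← smul_eq_mul]
    exact Finset.card_nsmul_le_sum _ _ _ fun a ha => hnz a (by simpa using ha)
  have hk1' : k = 1 := by omega
  have hAeq : A = {0} := by
    obtain ⟨a, ha⟩ := Finset.card_eq_one.mp (hk ▸ hk1')
    rw [ha, Finset.mem_singleton] at h0A
    rw [ha, h0A]
  have hz : ∀ a : F, a ≠ 0 → b - 1 ≤ (Finset.univ.filter fun y => g.evalEval a y = 0).card := by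
    intro a ha
    have haA : a ∉ A := by rw [hAeq]; simpa using ha
    have hle : nz a ≤ q - b + 1 := by
      by_contra hlt
      have hs : ∑ a' ∈ Finset.univ \ A, (q - b + 1) < ∑ a' ∈ Finset.univ \ A, nz a' := by
        refine Finset.sum_lt_sum ?_ ⟨a, by simpa using haA, by omega⟩
        intro a' ha'
        have := hnz a' (by simpa using ha')
        omega
      rw [Finset.sum_const, hcardc, hk1', smul_eq_mul, mul_comm] at hs
      omega
    have h1 := Finset.card_filter_add_card_filter_not (s := (Finset.univ : Finset F)) (fun y => g.evalEval a y = 0)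
    rw [Finset.card_univ] at h1
    have h2 : nz a = (Finset.univ.filter fun y => ¬ g.evalEval a y = 0).card := by
      simp only [nz, evE, ne_eq]
    omega
  have hT : TD (b - 1) g := by rw [hk1'] at hgT'; exact hgT'
  have hcc : g.coeff (b - 1) ≠ 0 := by
    intro hc
    refine hgne 1 (by rw [hAeq]; simp) (pzero _ (b - 1) ?_ ?_)
    · have : g.natDegree ≤ b - 2 := by
        rw [natDegree_le_iff_coeff_eq_zero]
        intro j hj
        by_cases hj2 : j = b - 1
        · rw [hj2]; exact hc
        · exact hT.coeff_eq_zero (by omega)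
      have h2 : (g.map (evalRingHom 1)).natDegree ≤ g.natDegree := natDegree_map_le
      omega
    · simpa only [evE] using hz 1 one_ne_zero
  have hcC : g.coeff (b - 1) = C ((g.coeff (b - 1)).coeff 0) := by
    apply eq_C_of_natDegree_eq_zero
    have := hT.coeff_natDegree hcc
    omega
  set κ := (g.coeff (b - 1)).coeff 0 with hκ
  have hκ0 : κ ≠ 0 := by
    intro h; rw [hcC, h] at hcc; simp at hcc
  have hgd : g.natDegree = b - 1 := le_antisymm hT.natDegree_le (le_natDegree_of_ne_zero hcc)
  let g' := C (C κ⁻¹) * g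
  have hg'd : g'.natDegree = b - 1 := by
    rw [← hgd]
    exact natDegree_C_mul (by simpa using hκ0)
  have hg'm : g'.Monic := by
    rw [Monic, leadingCoeff, hg'd, coeff_C_mul, hcC, ← C_mul, inv_mul_cancel₀ hκ0, C_1]
  have hg'T : TD (b - 1) g' := by simpa using (TD.CC κ⁻¹).mul hT
  have hg'e : ∀ x y, g'.evalEval x y = κ⁻¹ * g.evalEval x y := by
    intro x y
    simp [g', evalEval]
  obtain ⟨m, hm1, hm2⟩ : Fac g' := by
    refine sect (q - 1) (b - 1) (by omega) (by omega) (by omega) g' hg'm hg'd hg'T ?_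
    intro a ha
    refine (hz a ha).trans (Finset.card_le_card ?_)
    intro y hy
    simp only [Finset.mem_filter, Finset.mem_univ, true_and] at hy ⊢
    rw [hg'e, hy, mul_zero]
  have hmc : Multiset.card m = b - 1 := by
    rw [← hg'd, hm2, natDegree_multiset_prod_X_sub_C_eq_card]
  refine ⟨κ, (1, 0, 0) ::ₘ m.map fun l => (-l.coeff 1, 1, -l.coeff 0), ?_, ?_⟩
  · simp only [Multiset.card_cons, Multiset.card_map]; omega
  · intro x y
    have e1 : g.evalEval x y = κ * g'.evalEval x y := by
      rw [hg'e]; field_simp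
    have e2 : g'.evalEval x y = (m.map fun l => y - l.eval x).prod := by
      rw [hm2, evalEval, eval_multiset_prod, Multiset.map_map, ← coe_evalRingHom,
        map_multiset_prod, Multiset.map_map]
      congr 1
      apply Multiset.map_congr rfl
      intro l _
      simp
    beta_reduce
    rw [hev, e1, e2, hAeq, Multiset.map_cons, Multiset.prod_cons, Multiset.map_map]
    have e3 : (m.map fun l => y - l.eval x) = (m.map ((fun l : F × F × F => l.1 * x + l.2.1 * y + l.2.2) ∘
        fun l : Polynomial F => (-l.coeff 1, 1, -l.coeff 0))) := by
      apply Multiset.map_congr rfl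
      intro l hl
      have := eq_X_add_C_of_natDegree_le_one (hm1 l hl)
      conv_lhs => rw [this]
      simp; ring
    rw [e3]
    simp; ring
end
section
variable {F : Type} [Field F]

theorem TD.sum {ι : Type*} (s : Finset ι) (n : ℕ) (p : ι → Polynomial (Polynomial F))
    (h : ∀ i ∈ s, TD n (p i)) : TD n (∑ i ∈ s, p i) := by
  classical
  induction s using Finset.induction_on with
  | empty => intro i j hij; simp at hij
  | insert a s ha ih =>
    rw [Finset.sum_insert ha]
    exact (h a (by simp)).add (ih fun i hi => h i (by simp [hi]))

theorem TD.pow {p : Polynomial (Polynomial F)} (h : TD 1 p) (n : ℕ) : TD n (p ^ n) := by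
  induction n with
  | zero => simpa using TD.CC (1 : F)
  | succ n ih => rw [pow_succ]; exact ih.mul h

theorem toTD (b : ℕ) (P : MvPolynomial (Fin 2) F) (hP : P.totalDegree ≤ b) (a1 b1 c1 a2 b2 c2 : F) :
    ∃ p : Polynomial (Polynomial F), TD b p ∧ ∀ x y, p.evalEval x y =
      MvPolynomial.eval ![a1 * x + b1 * y + c1, a2 * x + b2 * y + c2] P := by
  refine ⟨∑ d ∈ P.support, C (C (P.coeff d)) * ((C (C a1 * X + C c1) + C (C b1) * X) ^ (d 0) *
    (C (C a2 * X + C c2) + C (C b2) * X) ^ (d 1)), ?_, ?_⟩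
  · refine TD.sum _ _ _ fun d hd => ?_
    have h1 := MvPolynomial.le_totalDegree hd
    have h2 : (d.sum fun _ e => e) = d 0 + d 1 := by
      rw [Finsupp.sum_fintype _ _ (by simp)]; simp
    refine ((TD.CC _).mul (((TD.lin a1 b1 c1).pow (d 0)).mul ((TD.lin a2 b2 c2).pow (d 1)))).mono ?_
    omega
  · intro x y
    rw [MvPolynomial.eval_eq']
    simp only [evalEval, eval_finsetSum, eval_mul, eval_pow, eval_add, eval_C, eval_X, Fin.prod_univ_two]
    refine Finset.sum_congr rfl fun d _ => ?_
    simp only [Matrix.cons_val_zero, Matrix.cons_val_one]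
    ring

theorem fin [Fintype F] [DecidableEq F] (b : ℕ) (hb1 : 2 ≤ b) (hb2 : b < Fintype.card F)
    (P : MvPolynomial (Fin 2) F) (hP : P.totalDegree ≤ b)
    (hw : (Finset.univ.filter fun v : F × F => MvPolynomial.eval ![v.1, v.2] P ≠ 0).card ≤
      (Fintype.card F - b + 1) * (Fintype.card F - 1)) :
    PL b fun x y => MvPolynomial.eval ![x, y] P := by
  by_cases hl : ∃ s1 s2 d1 d2 e1 e2 : F, e1 * d2 - d1 * e2 ≠ 0 ∧
      ∀ y, MvPolynomial.eval ![s1 + y * d1, s2 + y * d2] P = 0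
  · obtain ⟨s1, s2, d1, d2, e1, e2, hD, hz⟩ := hl
    obtain ⟨p, hpT, hpe⟩ := toTD b P hP e1 d1 s1 e2 d2 s2
    have hm := main2 b hb1 hb2 p hpT ?_ ?_
    · set D := e1 * d2 - d1 * e2 with hDd
      have := hm.comp (d2 / D) (-d1 / D) ((d1 * s2 - s1 * d2) / D)
        (-e2 / D) (e1 / D) ((e2 * s1 - e1 * s2) / D)
      convert this using 3 with x y
      rw [hpe]
      congr 2
      congr 1
      · field_simp
        rw [hDd]; ring
      · congr 1
        field_simp
        rw [hDd]; ring
    · intro y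
      rw [hpe]
      refine Eq.trans ?_ (hz y)
      congr 2
      congr 1
      · ring
      · congr 1
        ring
    · refine le_trans ?_ hw
      refine Finset.card_le_card_of_injOn
        (fun v => (e1 * v.1 + d1 * v.2 + s1, e2 * v.1 + d2 * v.2 + s2)) ?_ ?_
      · intro v hv
        simp only [Finset.coe_filter, Finset.mem_univ, true_and, Set.mem_setOf_eq] at hv ⊢
        rwa [hpe] at hv
      · rintro ⟨x, y⟩ _ ⟨x', y'⟩ _ h
        simp only [Prod.mk.injEq] at h ⊢
        obtain ⟨h1, h2⟩ := h
        constructor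
        · apply mul_left_cancel₀ hD
          linear_combination d2 * h1 - d1 * h2
        · apply mul_left_cancel₀ hD
          linear_combination e1 * h2 - e2 * h1
  · exfalso
    push Not at hl
    have hline : ∀ s1 s2 d1 d2 e1 e2 : F, e1 * d2 - d1 * e2 ≠ 0 →
        Fintype.card F - b ≤
          (Finset.univ.filter fun y => MvPolynomial.eval ![s1 + y * d1, s2 + y * d2] P ≠ 0).card := by
      intro s1 s2 d1 d2 e1 e2 hD
      obtain ⟨y0, hy0⟩ := hl s1 s2 d1 d2 e1 e2 hD
      obtain ⟨p, hpT, hpe⟩ := toTD b P hP 0 d1 s1 0 d2 s2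
      have hpe' : ∀ y, (p.map (evalRingHom 0)).eval y =
          MvPolynomial.eval ![s1 + y * d1, s2 + y * d2] P := by
        intro y
        rw [← evE, hpe]
        congr 2
        congr 1
        · ring
        · congr 1
          ring
      have := card_nz (p.map (evalRingHom 0)) b (natDegree_map_le.trans hpT.natDegree_le) (by
        intro h
        apply hy0
        rw [← hpe', h]; simp)
      simp only [hpe'] at this
      omega
    obtain ⟨y0, hy0⟩ := hl 0 0 1 0 0 1 (by simp)
    set u1 : F := 0 + y0 * 1
    set u2 : F := 0 + y0 * 0
    have hj := jam (Finset.univ.filter fun v : F × F =>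
      MvPolynomial.eval ![u1 + v.1, u2 + v.2] P ≠ 0) (by simpa using hy0)
      (Fintype.card F - b) (by omega) ?_
    · have hle : (Finset.univ.filter fun v : F × F =>
          MvPolynomial.eval ![u1 + v.1, u2 + v.2] P ≠ 0).card ≤
          (Finset.univ.filter fun v : F × F => MvPolynomial.eval ![v.1, v.2] P ≠ 0).card := by
        refine Finset.card_le_card_of_injOn (fun v => (u1 + v.1, u2 + v.2)) ?_ ?_
        · intro v hv
          simpa using hv
        · rintro ⟨x, y⟩ _ ⟨x', y'⟩ _ h
          simpa using h
      omega
    · have key : ∀ a v s1 s2 d1 d2 e1 e2 : F, e1 * d2 - d1 * e2 ≠ 0 → (d1 ≠ 0 ∨ d2 ≠ 0) →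
          1 + a * s1 + v * s2 = 0 → a * d1 + v * d2 = 0 →
          Fintype.card F - b ≤ (((Finset.univ.filter fun v : F × F =>
            MvPolynomial.eval ![u1 + v.1, u2 + v.2] P ≠ 0)).filter
              fun s => 1 + a * s.1 + v * s.2 = 0).card := by
        intro a v s1 s2 d1 d2 e1 e2 hD hd hs had
        refine (hline (u1 + s1) (u2 + s2) d1 d2 e1 e2 hD).trans ?_
        refine Finset.card_le_card_of_injOn (fun y => (s1 + y * d1, s2 + y * d2)) ?_ ?_
        · intro y hy
          simp only [Finset.coe_filter, Finset.mem_filter, Finset.mem_univ, true_and, Set.mem_setOf_eq] at hy ⊢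
          refine ⟨?_, ?_⟩
          · rw [← add_assoc, ← add_assoc]; exact hy
          · linear_combination hs + y * had
        · intro y _ y' _ h
          simp only [Prod.mk.injEq, add_right_inj] at h
          rcases hd with hd | hd
          · exact mul_right_cancel₀ hd h.1
          · exact mul_right_cancel₀ hd h.2
      intro a v hav
      by_cases ha : a = 0
      · have hv : v ≠ 0 := by rcases hav with h | h; exact absurd ha h; exact h
        refine key a v 0 (-1 / v) v 0 0 1 ?_ (Or.inl hv) ?_ ?_
        · simpa using hv
        · field_simp; ring
        · rw [ha]; ring
      · refine key a v (-1 / a) 0 v (-a) 1 0 ?_ (Or.inr (by simpa using ha)) ?_ ?_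
        · simpa using ha
        · field_simp; ring
        · ring

theorem PL.toFin {b : ℕ} (hb : 1 ≤ b) {f : F → F → F} (h : PL b f) :
    ∃ l : Fin b → MvPolynomial (Fin 2) F, (∀ i, (l i).totalDegree ≤ 1) ∧
      ∀ x, MvPolynomial.eval x (∏ i, l i) = f (x 0) (x 1) := by
  obtain ⟨κ, s, hs, h⟩ := h
  obtain ⟨s, hs, h⟩ : ∃ s : Multiset (F × F × F), Multiset.card s ≤ b ∧
      ∀ x y, f x y = (s.map fun l => l.1 * x + l.2.1 * y + l.2.2).prod := by
    induction s using Multiset.induction_on with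
    | empty => exact ⟨{(0, 0, κ)}, by simpa using hb, fun x y => by rw [h]; simp⟩
    | cons a s _ =>
      refine ⟨(κ * a.1, κ * a.2.1, κ * a.2.2) ::ₘ s, by simpa using hs, fun x y => ?_⟩
      rw [h]; simp only [Multiset.map_cons, Multiset.prod_cons]; ring
  obtain ⟨L, hL⟩ : ∃ L : List (F × F × F), (L : Multiset (F × F × F)) =
      s + Multiset.replicate (b - Multiset.card s) (0, 0, 1) := Quot.exists_rep _
  have hlen : L.length = b := by
    rw [← Multiset.coe_card, hL]; simp; omega
  subst hlen
  refine ⟨fun i => MvPolynomial.C (L.get i).1 * MvPolynomial.X 0 +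
    MvPolynomial.C (L.get i).2.1 * MvPolynomial.X 1 + MvPolynomial.C (L.get i).2.2, ?_, ?_⟩
  · intro i
    refine (MvPolynomial.totalDegree_add _ _).trans (max_le ((MvPolynomial.totalDegree_add _ _).trans
      (max_le ?_ ?_)) ?_)
    · refine (MvPolynomial.totalDegree_mul _ _).trans ?_
      simp
    · refine (MvPolynomial.totalDegree_mul _ _).trans ?_
      simp
    · simp
  · intro x
    rw [h, map_prod]
    have e : (s.map fun l => l.1 * x 0 + l.2.1 * x 1 + l.2.2).prod =
        ((L : Multiset (F × F × F)).map fun l => l.1 * x 0 + l.2.1 * x 1 + l.2.2).prod := by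
      rw [hL]; simp
    rw [e, Multiset.map_coe, Multiset.prod_coe, ← List.prod_ofFn]
    congr 1
    apply List.ext_get
    · simp
    · intro i h1 h2
      simp
end

/-- A codeword of `R_q(b,2)` of weight at most `(q-b+1)(q-1)` is a product of `b`
polynomials of degree at most 1. -/
theorem stmt8 {F : Type} [Field F] [Fintype F] [DecidableEq F] {b : ℕ}
    (hq : 3 ≤ Fintype.card F) (hb1 : 2 ≤ b) (hb2 : b ≤ Fintype.card F - 1)
    (f : (Fin 2 → F) → F) (hf : RM F b 2 f)
    (hw : wt f ≤ (Fintype.card F - b + 1) * (Fintype.card F - 1)) :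
    ∃ l : Fin b → MvPolynomial (Fin 2) F,
      (∀ i, (l i).totalDegree ≤ 1) ∧
      ∀ x, MvPolynomial.eval x (∏ i, l i) = f x := by
  obtain ⟨P, hP, hPf⟩ := hf
  have h1 := fin b hb1 (by omega) P hP ?_
  · obtain ⟨l, hl1, hl2⟩ := h1.toFin (by omega)
    refine ⟨l, hl1, fun x => ?_⟩
    rw [hl2, ← hPf]
    congr 2
    ext i
    fin_cases i <;> rfl
  · refine le_trans ?_ hw
    unfold wt
    refine Finset.card_le_card_of_injOn (fun v => ![v.1, v.2]) ?_ ?_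
    · intro v hv
      simp only [Finset.coe_filter, Finset.mem_univ, true_and, Set.mem_setOf_eq] at hv ⊢
      rwa [← hPf]
    · rintro ⟨x, y⟩ _ ⟨x', y'⟩ _ h
      have h0 := congrFun h 0
      have h1 := congrFun h 1
      simp at h0 h1
      rw [h0, h1]
end

section
/- Let $q\geq3$ and $2\leq b\leq q-1$. The codewords $f\in R_q(b,2)$ with $|f|=(q-b+1)(q-1)$ (the second weight) are exactly those whose support $S$ is either: (A) the union of $q-b+1$ parallel lines minus their intersection with one non-parallel line, or (B) the union of $q-b+1$ lines through a common point, minus that point. -/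
/-- An affine line in `𝔽_q²`: a nonempty affine subspace whose direction has dimension 1. -/
def IsAffLine (F : Type) [Field F] (L : AffineSubspace F (Fin 2 → F)) : Prop :=
  (L : Set (Fin 2 → F)).Nonempty ∧ Module.finrank F L.direction = 1


open Polynomial in
/-- bivariate functions of degree at most `n` -/
def DD {F : Type} [Field F] (n : ℕ) (f : F → F → F) : Prop :=
  ∃ P : MvPolynomial (Fin 2) F, P.totalDegree ≤ n ∧ ∀ x y, MvPolynomial.eval ![x, y] P = f x y

/-- univariate functions of degree at most `n` -/
def UU {F : Type} [Field F] (n : ℕ) (h : F → F) : Prop :=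
  ∃ g : Polynomial F, g.natDegree ≤ n ∧ ∀ y, g.eval y = h y

theorem UU.card_le {F : Type} [Field F] [Fintype F] [DecidableEq F] {n : ℕ} {h : F → F}
    (H : UU n h) (y0 : F) (h0 : h y0 ≠ 0) :
    (Finset.univ.filter fun y => h y = 0).card ≤ n := by
  obtain ⟨g, hg, hgh⟩ := H
  by_contra hc
  push Not at hc
  apply h0
  have := Polynomial.eq_zero_of_natDegree_lt_card_of_eval_eq_zero' g
    (Finset.univ.filter fun y => h y = 0) (by
      intro i hi
      rw [hgh]; exact (Finset.mem_filter.mp hi).2) (by omega)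
  rw [← hgh, this]; simp

theorem DD.ofUU {F : Type} [Field F] {n : ℕ} {f : F → F → F} (H : DD n f)
    (A B : Polynomial F) (hA : A.natDegree ≤ 1) (hB : B.natDegree ≤ 1) :
    UU n (fun s => f (A.eval s) (B.eval s)) := by
  obtain ⟨P, hP, hf⟩ := H
  refine ⟨∑ d ∈ P.support, Polynomial.C (P.coeff d) * (A ^ d 0 * B ^ d 1), ?_, ?_⟩
  · apply Polynomial.natDegree_sum_le_of_forall_le
    intro d hd
    have h1 := MvPolynomial.le_totalDegree hd
    rw [Finsupp.sum_fintype _ _ (by simp)] at h1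
    simp only [Fin.sum_univ_two] at h1
    refine (Polynomial.natDegree_C_mul_le _ _).trans (Polynomial.natDegree_mul_le.trans ?_)
    have h2 := Polynomial.natDegree_pow_le (p := A) (n := d 0)
    have h3 := Polynomial.natDegree_pow_le (p := B) (n := d 1)
    nlinarith
  · intro y
    beta_reduce; rw [← hf, MvPolynomial.eval_eq']
    simp [Polynomial.eval_finsetSum, Fin.prod_univ_two]

theorem DD.subst {F : Type} [Field F] {n : ℕ} {f : F → F → F} (H : DD n f)
    (A B : MvPolynomial (Fin 2) F) (hA : A.totalDegree ≤ 1) (hB : B.totalDegree ≤ 1) :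
    DD n (fun x y => f (MvPolynomial.eval ![x, y] A) (MvPolynomial.eval ![x, y] B)) := by
  obtain ⟨P, hP, hf⟩ := H
  refine ⟨∑ d ∈ P.support, MvPolynomial.C (P.coeff d) * (A ^ d 0 * B ^ d 1), ?_, ?_⟩
  · apply MvPolynomial.totalDegree_finsetSum_le
    intro d hd
    have h1 := MvPolynomial.le_totalDegree hd
    rw [Finsupp.sum_fintype _ _ (by simp)] at h1
    simp only [Fin.sum_univ_two] at h1
    refine (MvPolynomial.totalDegree_mul _ _).trans ?_
    rw [MvPolynomial.totalDegree_C, zero_add]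
    refine (MvPolynomial.totalDegree_mul _ _).trans ?_
    have h2 := MvPolynomial.totalDegree_pow A (d 0)
    have h3 := MvPolynomial.totalDegree_pow B (d 1)
    nlinarith
  · intro x y
    beta_reduce; rw [← hf, MvPolynomial.eval_eq' _ P]
    simp [Fin.prod_univ_two]

theorem DD.swap {F : Type} [Field F] {n : ℕ} {f : F → F → F} (H : DD n f) :
    DD n (fun x y => f y x) := by
  have := H.subst (MvPolynomial.X 1) (MvPolynomial.X 0) (by simp) (by simp)
  simpa using this

theorem DD.shear {F : Type} [Field F] {n : ℕ} {f : F → F → F} (H : DD n f) (m k : F) :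
    DD n (fun x y => f (x + m * y + k) y) := by
  have := H.subst (MvPolynomial.X 0 + MvPolynomial.C m * MvPolynomial.X 1 + MvPolynomial.C k)
    (MvPolynomial.X 1) (by
      refine (MvPolynomial.totalDegree_add _ _).trans (max_le ?_ (by simp))
      refine (MvPolynomial.totalDegree_add _ _).trans (max_le (by simp) ?_)
      refine (MvPolynomial.totalDegree_mul _ _).trans (by simp)) (by simp)
  simpa using this

theorem DD.line {F : Type} [Field F] {n : ℕ} {f : F → F → F} (H : DD n f) (m k : F) :
    UU n (fun y => f (m * y + k) y) := by
  have := H.ofUU (Polynomial.C m * Polynomial.X + Polynomial.C k) Polynomial.X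
    (by compute_degree) (by simp)
  simpa using this

theorem DD.hline {F : Type} [Field F] {n : ℕ} {f : F → F → F} (H : DD n f) (k : F) :
    UU n (fun x => f x k) := by
  have := H.ofUU Polynomial.X (Polynomial.C k) (by simp) (by simp)
  simpa using this

open Polynomial in
theorem DD.toG {F : Type} [Field F] {n : ℕ} {f : F → F → F} (H : DD n f) :
    ∃ G : F[X][X], (∀ i j, n < i + j → (G.coeff j).coeff i = 0) ∧
      ∀ x y, f x y = (G.eval (C x)).eval y := by
  obtain ⟨P, hP, hf⟩ := H
  refine ⟨∑ d ∈ P.support, C (C (P.coeff d) * X ^ d 1) * X ^ d 0, ?_, ?_⟩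
  · intro i j hij
    simp only [finsetSum_coeff, coeff_C_mul, coeff_X_pow]
    apply Finset.sum_eq_zero
    intro d hd
    have h1 := MvPolynomial.le_totalDegree hd
    rw [Finsupp.sum_fintype _ _ (by simp)] at h1
    simp only [Fin.sum_univ_two] at h1
    split_ifs with hj
    · rw [mul_one, coeff_C_mul, coeff_X_pow, if_neg (by omega), mul_zero]
    · simp
  · intro x y
    beta_reduce; rw [← hf, MvPolynomial.eval_eq']
    simp [Polynomial.eval_finsetSum, Fin.prod_univ_two]
    refine Finset.sum_congr rfl fun d _ => by ring

open Polynomial in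
theorem DD.ofG {F : Type} [Field F] {n : ℕ} (G : F[X][X])
    (hG : ∀ i j, n < i + j → (G.coeff j).coeff i = 0) :
    DD n (fun x y => (G.eval (C x)).eval y) := by
  refine ⟨∑ j ∈ G.support, ∑ i ∈ (G.coeff j).support,
    MvPolynomial.C ((G.coeff j).coeff i) * (MvPolynomial.X 0 ^ j * MvPolynomial.X 1 ^ i), ?_, ?_⟩
  · apply MvPolynomial.totalDegree_finsetSum_le
    intro j _
    apply MvPolynomial.totalDegree_finsetSum_le
    intro i hi
    have : i + j ≤ n := by
      by_contra hc
      push Not at hc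
      exact (mem_support_iff.mp hi) (hG i j hc)
    refine (MvPolynomial.totalDegree_mul _ _).trans ?_
    rw [MvPolynomial.totalDegree_C, zero_add]
    refine (MvPolynomial.totalDegree_mul _ _).trans ?_
    simp; omega
  · intro x y
    simp only [eval_eq_sum (p := G), Polynomial.sum, eval_finsetSum, map_sum, eval_mul, eval_pow,
      eval_C]
    refine Finset.sum_congr rfl fun j _ => ?_
    rw [eval_eq_sum (p := G.coeff j), Polynomial.sum, Finset.sum_mul]
    refine Finset.sum_congr rfl fun i _ => ?_
    simp; ring

open Polynomial in
theorem DD.factor0 {F : Type} [Field F] [Fintype F] {n : ℕ} {f : F → F → F} (H : DD (n + 1) f)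
    (hn : n + 1 < Fintype.card F) (h0 : ∀ y, f 0 y = 0) :
    ∃ g, DD n g ∧ ∀ x y, f x y = x * g x y := by
  obtain ⟨G, hG, hf⟩ := H.toG
  have hc : G.coeff 0 = 0 := by
    have hd : (G.coeff 0).natDegree ≤ n + 1 := by
      rw [natDegree_le_iff_coeff_eq_zero]
      intro N hN
      exact hG N 0 (by omega)
    apply eq_zero_of_natDegree_lt_card_of_eval_eq_zero' _ Finset.univ
    · intro y _
      rw [coeff_zero_eq_eval_zero]
      have := hf 0 y
      rw [h0, C_0] at this
      exact this.symm
    · rw [Finset.card_univ]; omega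
  refine ⟨_, DD.ofG G.divX ?_, ?_⟩
  · intro i j hij
    rw [coeff_divX]
    exact hG _ _ (by omega)
  · intro x y
    have := divX_mul_X_add G
    rw [hc, C_0, add_zero] at this
    rw [hf]
    conv_lhs => rw [← this]
    simp [mul_comm]

theorem DD.factor {F : Type} [Field F] [Fintype F] {n : ℕ} {f : F → F → F} (H : DD (n + 1) f)
    (hn : n + 1 < Fintype.card F) (m k : F) (h0 : ∀ y, f (m * y + k) y = 0) :
    ∃ g, DD n g ∧ ∀ x y, f x y = (x - m * y - k) * g x y := by
  obtain ⟨g, hg, hfg⟩ := (H.shear m k).factor0 hn (by intro y; simpa using h0 y)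
  refine ⟨_, hg.shear (-m) (-k), ?_⟩
  intro x y
  have := hfg (x + -m * y + -k) y
  rw [← sub_eq_zero] at this ⊢
  rw [← this]
  ring_nf

theorem DD.hfactor {F : Type} [Field F] [Fintype F] {n : ℕ} {f : F → F → F} (H : DD (n + 1) f)
    (hn : n + 1 < Fintype.card F) (k : F) (h0 : ∀ x, f x k = 0) :
    ∃ g, DD n g ∧ ∀ x y, f x y = (y - k) * g x y := by
  obtain ⟨g, hg, hfg⟩ := H.swap.factor hn 0 k (by intro y; simpa using h0 y)
  refine ⟨_, hg.swap, ?_⟩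
  intro x y
  have := hfg y x
  simpa using this

theorem DD.zero_const {F : Type} [Field F] {f : F → F → F} (H : DD 0 f) :
    ∃ c, ∀ x y, f x y = c := by
  obtain ⟨P, hP, hf⟩ := H
  rw [Nat.le_zero, MvPolynomial.totalDegree_eq_zero_iff_eq_C] at hP
  refine ⟨P.coeff 0, fun x y => ?_⟩
  rw [← hf, hP]; simp

open Polynomial in
theorem div_bound {F : Type} [Field F] (A B : F[X][X]) (hB : B.Monic) (c n : ℕ)
    (hc : B.natDegree = c) (hBb : ∀ i j, c < i + j → (B.coeff j).coeff i = 0)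
    (hA : ∀ i j, n < i + j → (A.coeff j).coeff i = 0) :
    ∀ i j, n < i + j + c → ((A /ₘ B).coeff j).coeff i = 0 := by
  set K := A /ₘ B with hK
  have key : ∀ s j, K.natDegree < j + s → ∀ i, n < i + j + c → (K.coeff j).coeff i = 0 := by
    intro s
    induction s with
    | zero =>
      intro j hj i _
      rw [coeff_eq_zero_of_natDegree_lt (p := K) (by omega)]; simp
    | succ s ih =>
      intro j hj i hi
      have h1 : (A.coeff (c + j)).coeff i = 0 := hA _ _ (by omega)
      rw [← modByMonic_add_div A B, ← hK, coeff_add] at h1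
      rw [coeff_eq_zero_of_degree_lt (p := A %ₘ B), zero_add, coeff_mul, finsetSum_coeff] at h1
      · rw [Finset.sum_eq_single (c, j)] at h1
        · have : B.coeff c = 1 := by rw [← hc]; exact hB
          simpa [this] using h1
        · rintro ⟨a, l⟩ hal hne
          replace hal : a + l = c + j := Finset.HasAntidiagonal.mem_antidiagonal.mp hal
          rcases lt_trichotomy a c with h | h | h
          · change (B.coeff a * K.coeff l).coeff i = 0
            rw [coeff_mul]
            apply Finset.sum_eq_zero
            rintro ⟨i1, i2⟩ h12
            simp only [Finset.HasAntidiagonal.mem_antidiagonal] at h12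
            by_cases hh : c < i1 + a
            · simp [hBb i1 a hh]
            · simp only
              rw [ih l (by omega) i2 (by omega), mul_zero]
          · exfalso; apply hne; simp; omega
          · simp only
            rw [coeff_eq_zero_of_natDegree_lt (p := B) (by omega)]; simp
        · intro h; simp at h
      · refine (degree_modByMonic_lt A hB).trans_le ?_
        rw [degree_eq_natDegree hB.ne_zero, hc]
        exact_mod_cast Nat.le_add_right _ _
  intro i j h
  exact key (K.natDegree + 1) j (by omega) i h

open Polynomial in
theorem prod_bound {F ι : Type} [Field F] [DecidableEq ι] (T : Finset ι) (a b : ι → F) :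
    ∀ i j, T.card < i + j →
      ((∏ s ∈ T, (C (1 - C (a s) * X) - C (C (b s)) * X) : F[X][X]).coeff j).coeff i = 0 := by
  induction T using Finset.induction_on with
  | empty =>
    intro i j h
    simp at h
    simp [coeff_one]
    split_ifs with hj
    · rw [coeff_one, if_neg (by omega)]
    · simp
  | insert s T hs ih =>
    intro i j h
    rw [Finset.card_insert_of_notMem hs] at h
    rw [Finset.prod_insert hs]
    simp only [sub_mul, coeff_sub, coeff_C_mul, mul_assoc, one_mul]
    have e1 := ih i j (by omega)
    rw [e1]
    have e2 : ((X * ∏ s ∈ T, (C (1 - C (a s) * X) - C (C (b s)) * X) : F[X][X]).coeff j).coeff i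
        = 0 := by
      cases j with
      | zero => simp
      | succ j => rw [coeff_X_mul]; exact ih i j (by omega)
    have e3 : (X * (∏ s ∈ T, (C (1 - C (a s) * X) - C (C (b s)) * X) : F[X][X]).coeff j).coeff i
        = 0 := by
      cases i with
      | zero => simp
      | succ i => rw [coeff_X_mul]; exact ih i j (by omega)
    rw [e2, e3]; simp

open Polynomial in
theorem blocking {F : Type} [Field F] [Fintype F] [DecidableEq F] (S : Finset (F × F)) (t : ℕ)
    (ht : 1 ≤ t) (h1 : ∀ m k, t ≤ (S.filter fun s => s.1 = m * s.2 + k).card)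
    (h2 : ∀ k, t ≤ (S.filter fun s => s.2 = k).card) :
    (t + 1) * (Fintype.card F - 1) + 1 ≤ S.card := by
  have hne : S.Nonempty := by
    have := h2 0
    obtain ⟨s, hs⟩ := Finset.card_pos.mp (lt_of_lt_of_le ht this)
    exact ⟨s, (Finset.mem_filter.mp hs).1⟩
  obtain ⟨s0, hs0⟩ := hne
  set S' := S.erase s0 with hS'
  have hcard : S'.card + 1 = S.card := Finset.card_erase_add_one hs0
  have hline : ∀ u v : F, (u ≠ 0 ∨ v ≠ 0) →
      t ≤ (S'.filter fun s => 1 - (s.2 - s0.2) * v - (s.1 - s0.1) * u = 0).card := by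
    intro u v huv
    by_cases hu : u = 0
    · have hv : v ≠ 0 := by tauto
      refine (h2 (s0.2 + 1 / v)).trans (Finset.card_le_card ?_)
      intro s hs
      rw [Finset.mem_filter] at hs ⊢
      have e : 1 - (s.2 - s0.2) * v - (s.1 - s0.1) * u = 0 := by
        rw [hs.2, hu]; field_simp; ring
      refine ⟨Finset.mem_erase.mpr ⟨?_, hs.1⟩, e⟩
      rintro rfl
      simp at e
    · refine (h1 (-v / u) (s0.1 + (1 + s0.2 * v) / u)).trans (Finset.card_le_card ?_)
      intro s hs
      rw [Finset.mem_filter] at hs ⊢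
      have e : 1 - (s.2 - s0.2) * v - (s.1 - s0.1) * u = 0 := by
        rw [hs.2]; field_simp; ring
      refine ⟨Finset.mem_erase.mpr ⟨?_, hs.1⟩, e⟩
      rintro rfl
      simp at e
  set GG : F[X][X] := ∏ s ∈ S', (C (1 - C (s.2 - s0.2) * X) - C (C (s.1 - s0.1)) * X) with hGG
  have hGGb := prod_bound S' (fun s => s.2 - s0.2) (fun s => s.1 - s0.1)
  set G : F → F[X] := fun v => ∏ s ∈ S', (C (1 - (s.2 - s0.2) * v) - C (s.1 - s0.1) * X) with hG
  have hmap : ∀ v, GG.map (evalRingHom v) = G v := by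
    intro v
    simp [hGG, hG, Polynomial.map_prod]
  set U : Finset F := Finset.univ.erase 0 with hU
  have hUc : U.card = Fintype.card F - 1 := by simp [hU, Finset.card_erase_of_mem]
  set M : F[X] := ∏ u ∈ U, (X - C u) ^ t with hM
  have hMm : M.Monic := monic_prod_of_monic _ _ fun u _ => (monic_X_sub_C u).pow t
  have hMd : M.natDegree = t * (Fintype.card F - 1) := by
    rw [hM, natDegree_prod_of_monic _ _ fun u _ => (monic_X_sub_C u).pow t]
    simp [hUc, mul_comm]
  have hM0 : M.coeff 0 ≠ 0 := by
    rw [coeff_zero_eq_eval_zero, hM, eval_prod, Finset.prod_ne_zero_iff]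
    intro u hu
    have : u ≠ 0 := Finset.ne_of_mem_erase hu
    simp [this]
  have hdvd : ∀ v, M ∣ G v := by
    intro v
    apply Finset.prod_dvd_of_coprime
    · intro a _ b _ hab
      exact (isCoprime_X_sub_C_of_isUnit_sub (sub_ne_zero.mpr hab).isUnit).pow
    · intro u hu
      have hu0 : u ≠ 0 := Finset.ne_of_mem_erase hu
      refine (pow_dvd_pow _ (hline u v (Or.inl hu0))).trans ?_
      rw [← Finset.prod_const]
      refine dvd_trans (Finset.prod_dvd_prod_of_dvd _ _ ?_)
        (Finset.prod_dvd_prod_of_subset _ _ _ (Finset.filter_subset _ _))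
      intro s hs
      rw [dvd_iff_isRoot]
      have := (Finset.mem_filter.mp hs).2
      simp only [IsRoot.def, eval_sub, eval_C, eval_mul, eval_X]
      exact this
  set M' : F[X][X] := M.map C with hM'
  have hM'm : M'.Monic := hMm.map _
  set K := GG /ₘ M' with hK
  have hKb := div_bound GG M' hM'm (t * (Fintype.card F - 1)) S'.card
    (by rw [hM', hMm.natDegree_map, hMd]) (by
      intro i j hij
      rw [hM', coeff_map, coeff_C]
      split_ifs with hi
      · apply coeff_eq_zero_of_natDegree_lt; omega
      · rfl) hGGb
  set H := K.coeff 0 with hH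
  have hHv : ∀ v, H.eval v * M.coeff 0 = (G v).coeff 0 := by
    intro v
    obtain ⟨k, hk⟩ := hdvd v
    have e1 : K.map (evalRingHom v) = k := by
      rw [hK, map_divByMonic _ hM'm, hmap, hM', Polynomial.map_map]
      have : (evalRingHom v).comp C = RingHom.id F := by ext; simp
      rw [this, Polynomial.map_id, hk, mul_divByMonic_cancel_left _ hMm]
    have e2 : H.eval v = k.coeff 0 := by rw [← e1, coeff_map, hH]; rfl
    rw [hk, mul_coeff_zero, e2, mul_comm]
  have hG0 : ∀ v, (G v).coeff 0 = ∏ s ∈ S', (1 - (s.2 - s0.2) * v) := by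
    intro v
    rw [coeff_zero_eq_eval_zero, hG]
    simp [eval_prod]
  have hHne : H ≠ 0 := by
    intro h
    have := hHv 0
    rw [hG0, h] at this
    simp at this
  have hroots : ∀ v ∈ U, H.eval v = 0 := by
    intro v hv
    have hv0 : v ≠ 0 := Finset.ne_of_mem_erase hv
    have e := hHv v
    obtain ⟨s, hs⟩ := Finset.card_pos.mp (lt_of_lt_of_le ht (hline 0 v (Or.inr hv0)))
    rw [Finset.mem_filter] at hs
    rw [hG0, Finset.prod_eq_zero hs.1 (by simpa using hs.2)] at e
    rcases mul_eq_zero.mp e with h | h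
    · exact h
    · exact absurd h hM0
  have hdeg : Fintype.card F - 1 ≤ H.natDegree := by
    by_contra hc
    push Not at hc
    exact hHne (eq_zero_of_natDegree_lt_card_of_eval_eq_zero' H U hroots (by omega))
  have hfin : ¬ S'.card < H.natDegree + 0 + t * (Fintype.card F - 1) := by
    intro hc
    have := hKb _ _ hc
    exact hHne (leadingCoeff_eq_zero.mp this)
  have : (t + 1) * (Fintype.card F - 1) = t * (Fintype.card F - 1) + (Fintype.card F - 1) := by ring
  omega

/-- second-moment counting lemma -/
theorem count_lemma {F : Type} [Field F] [Fintype F] [DecidableEq F] (f A : F → F → F) (c t : ℕ)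
    (hc : 1 ≤ c) (ht : 2 ≤ t) (hct : c + t = Fintype.card F)
    (hcnt : ∀ y, y ≠ 0 → (Finset.univ.filter fun x => f x y = 0).card = c)
    (hle : ∀ m k, ((Finset.univ.erase 0).filter fun y => f (m * y + k) y = 0).card ≤ c)
    (hge : ∀ m k, A k 0 ≠ 0 →
      c ≤ ((Finset.univ.erase 0).filter fun y => f (m * y + k) y = 0).card + 1)
    (hA : (Finset.univ.filter fun k => A k 0 = 0).card ≤ t) : False := by
  set U : Finset F := Finset.univ.erase 0 with hU
  have hUc : (U.card : ℤ) = c + t - 1 := by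
    rw [hU, Finset.card_erase_of_mem (Finset.mem_univ _), Finset.card_univ, ← hct]
    rw [Nat.cast_sub (by omega)]; push_cast; ring
  have hU0 : ∀ y ∈ U, y ≠ 0 := fun y hy => Finset.ne_of_mem_erase hy
  have hq : (Fintype.card F : ℤ) = c + t := by rw [← hct]; push_cast; ring
  set e : F → F → ℤ := fun x y => if f x y = 0 then 1 else 0 with he
  have hee : ∀ x y, e x y * e x y = e x y := by intro x y; simp [he]
  have hex : ∀ y ∈ U, ∑ x, e x y = c := by
    intro y hy
    rw [he]
    simp only [Finset.sum_boole]
    rw [hcnt y (hU0 y hy)]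
  set z : F → F → ℤ := fun m k => ∑ y ∈ U, e (m * y + k) y with hz
  have hzc : ∀ m k, z m k = ((U.filter fun y => f (m * y + k) y = 0).card : ℤ) := by
    intro m k; simp [hz, he]
  have hz1 : ∀ m k, z m k ≤ c := by intro m k; rw [hzc]; exact_mod_cast hle m k
  have hz0 : ∀ m k, 0 ≤ z m k := by intro m k; rw [hzc]; positivity
  have hz2 : ∀ m k, A k 0 ≠ 0 → (c : ℤ) ≤ z m k + 1 := by
    intro m k h; rw [hzc]; exact_mod_cast hge m k h
  have hme : ∀ k, ∀ y ∈ U, ∑ m, e (m * y + k) y = c := by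
    intro k y hy
    rw [← hex y hy]
    exact Fintype.sum_equiv ((Equiv.mulRight₀ y (hU0 y hy)).trans (Equiv.addRight k)) _ _
      (fun m => by simp)
  have h3 : ∀ k, ∑ m, z m k = c * (c + t - 1) := by
    intro k
    rw [hz, Finset.sum_comm, Finset.sum_congr rfl (hme k), Finset.sum_const, nsmul_eq_mul, hUc]
    ring
  have hpair : ∀ y ∈ U, ∀ y' ∈ U,
      ∑ k, ∑ m, e (m * y + k) y * e (m * y' + k) y' = if y = y' then (c + t) * (c : ℤ) else c * c := by
    intro y hy y' hy'
    split_ifs with hyy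
    · subst hyy
      simp only [hee]
      rw [Finset.sum_congr rfl (fun k _ => hme k y hy), Finset.sum_const, nsmul_eq_mul,
        Finset.card_univ, hq]
    · have hb : Function.Bijective (fun p : F × F => (p.2 * y + p.1, p.2 * y' + p.1)) := by
        apply Finite.injective_iff_bijective.mp
        rintro ⟨k, m⟩ ⟨k', m'⟩ h
        simp only [Prod.mk.injEq] at h
        have h4 : (m - m') * (y - y') = 0 := by linear_combination h.1 - h.2
        have h5 : m = m' := by
          rcases mul_eq_zero.mp h4 with h | h
          · exact sub_eq_zero.mp h
          · exact absurd (sub_eq_zero.mp h) hyy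
        subst h5
        have := h.1
        simp at this
        simp [this]
      have e1 := hb.sum_comp (fun p : F × F => e p.1 y * e p.2 y')
      rw [Fintype.sum_prod_type, Fintype.sum_prod_type] at e1
      simp only at e1
      rw [e1]
      rw [← Finset.sum_mul_sum, hex y hy, hex y' hy']
  have h4 : ∑ k, ∑ m, z m k * z m k
      = (c + t - 1) * ((c + t) * c) + (c + t - 1) * (c + t - 2) * (c * c) := by
    have e1 : ∑ k, ∑ m, z m k * z m k =
        ∑ y ∈ U, ∑ y' ∈ U, ∑ k, ∑ m, e (m * y + k) y * e (m * y' + k) y' := by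
      simp only [hz, Finset.sum_mul_sum]
      simp only [Finset.sum_comm (s := Finset.univ) (t := U)]
    rw [e1, Finset.sum_congr rfl (fun y hy => Finset.sum_congr rfl (fun y' hy' => hpair y hy y' hy'))]
    have e2 : ∀ y ∈ U, ∑ y' ∈ U, (if y = y' then (c + t) * (c : ℤ) else c * c)
        = (c + t) * c + (c + t - 2) * (c * c) := by
      intro y hy
      have : ∀ y', (if y = y' then (c + t) * (c : ℤ) else c * c)
        = c * c + if y = y' then (c + t) * (c : ℤ) - c * c else 0 := by
        intro y'; split_ifs <;> ring
      simp only [this]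
      rw [Finset.sum_add_distrib, Finset.sum_const, nsmul_eq_mul, hUc, Finset.sum_ite_eq, if_pos hy]
      ring
    rw [Finset.sum_congr rfl e2, Finset.sum_const, nsmul_eq_mul, hUc]
    ring
  have h5 : ∀ k, ∑ m, z m k * z m k ≤ c * (c * (c + t - 1)) - if A k 0 = 0 then 0 else (c * c - c : ℤ) := by
    intro k
    split_ifs with hk
    · rw [sub_zero, ← h3 k, Finset.mul_sum]
      apply Finset.sum_le_sum
      intro m _
      exact mul_le_mul_of_nonneg_right (hz1 m k) (hz0 m k)
    · have : ∀ m, z m k * z m k = (2 * c - 1) * z m k - c * (c - 1) := by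
        intro m
        have a1 := hz1 m k
        have a2 := hz2 m k hk
        have : z m k = c ∨ z m k = c - 1 := by omega
        rcases this with h | h <;> rw [h] <;> ring
      simp only [this]
      rw [Finset.sum_sub_distrib, ← Finset.mul_sum, h3, Finset.sum_const, nsmul_eq_mul,
        Finset.card_univ, hq]
      apply le_of_eq; ring
  have h6 := Finset.sum_le_sum (s := Finset.univ) (fun k _ => h5 k)
  rw [h4, Finset.sum_sub_distrib, Finset.sum_const, nsmul_eq_mul, Finset.card_univ, hq] at h6
  have h7 : ∑ k, (if A k 0 = 0 then 0 else (c * c - c : ℤ))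
      = ((Finset.univ.filter fun k => ¬ A k 0 = 0).card : ℤ) * (c * c - c) := by
    rw [Finset.sum_ite]; simp; ring
  rw [h7] at h6
  have h8 := Finset.card_filter_add_card_filter_not (s := (Finset.univ : Finset F)) (fun k => A k 0 = 0)
  rw [Finset.card_univ, ← hct] at h8
  have h9 : (c : ℤ) ≤ ((Finset.univ.filter fun k => ¬ A k 0 = 0).card : ℤ) := by
    have : c ≤ (Finset.univ.filter fun k => ¬ A k 0 = 0).card := by omega
    exact_mod_cast this
  have hc' : (1 : ℤ) ≤ c := by exact_mod_cast hc
  have ht' : (2 : ℤ) ≤ t := by exact_mod_cast ht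
  have h10 : (c : ℤ) * (c * c - c) ≤ ((Finset.univ.filter fun k => ¬ A k 0 = 0).card : ℤ) * (c * c - c) :=
    mul_le_mul_of_nonneg_right h9 (by nlinarith)
  have h11 : (c : ℤ) * (t * (t - 1)) ≤ 0 := by linarith
  nlinarith [mul_pos (show (0 : ℤ) < c by linarith) (mul_pos (show (0 : ℤ) < t by linarith) (show (0 : ℤ) < t - 1 by linarith))]

open Polynomial in
theorem lemma2a {F : Type} [Field F] [Fintype F] [DecidableEq F] (f : F → F → F) (c : ℕ)
    (hc : 1 ≤ c) (hcq : c + 2 ≤ Fintype.card F) (hf : DD c f) (q : ℕ) (hq : q = Fintype.card F)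
    (hcnt : ∀ y, y ≠ 0 → (Finset.univ.filter fun x => f x y = 0).card = c) :
    ∃ A : F → F → F, DD (q - c) A ∧ (∀ x y, y ≠ 0 → f x y ≠ 0 → A x y = 0) ∧
      (Finset.univ.filter fun k => A k 0 = 0).card ≤ q - c := by
  obtain ⟨G, hG, hfG⟩ := hf.toG
  have hGd : G.natDegree ≤ c := by
    rw [natDegree_le_iff_coeff_eq_zero]
    intro N hN
    ext i
    exact hG i N (by omega)
  have hmapE : ∀ (P : F[X][X]) x y, (P.map (evalRingHom y)).eval x = (P.eval (C x)).eval y := by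
    intro P x y
    rw [map_evalRingHom_eval]
  have hgd : ∀ y, (G.map (evalRingHom y)).natDegree ≤ c := fun y => natDegree_map_le.trans hGd
  have hac : G.coeff c = C ((G.coeff c).coeff 0) := by
    apply eq_C_of_natDegree_le_zero
    rw [natDegree_le_iff_coeff_eq_zero]
    intro N hN
    exact hG N c (by omega)
  set a := (G.coeff c).coeff 0 with ha
  have ha0 : a ≠ 0 := by
    intro h
    rw [h, C_0] at hac
    have hlt : (G.map (evalRingHom 1)).natDegree < c := by
      refine lt_of_le_of_ne (hgd 1) ?_
      intro h2
      have : (G.map (evalRingHom 1)).coeff c = 0 := by rw [coeff_map, hac]; simp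
      rw [← h2] at this
      have h3 := leadingCoeff_eq_zero.mp this
      rw [h3] at h2; simp at h2; omega
    have h3 := eq_zero_of_natDegree_lt_card_of_eval_eq_zero' (G.map (evalRingHom 1))
      (Finset.univ.filter fun x => f x 1 = 0) (by
        intro x hx
        rw [hmapE, ← hfG]
        exact (Finset.mem_filter.mp hx).2) (by rw [hcnt 1 one_ne_zero]; exact hlt)
    have h4 : (Finset.univ.filter fun x => f x 1 = 0) = Finset.univ := by
      apply Finset.filter_true_of_mem
      intro x _
      rw [hfG, ← hmapE, h3]; simp
    have h5 := hcnt 1 one_ne_zero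
    rw [h4, Finset.card_univ] at h5
    omega
  set G' : F[X][X] := C (C a⁻¹) * G with hG'
  have hG'b : ∀ i j, c < i + j → (G'.coeff j).coeff i = 0 := by
    intro i j hij
    rw [hG', coeff_C_mul, coeff_C_mul, hG i j hij, mul_zero]
  have hG'd : G'.natDegree ≤ c := (natDegree_C_mul_le _ _).trans hGd
  have hG'c : G'.coeff c = 1 := by
    rw [hG', coeff_C_mul, hac, ← C_mul, inv_mul_cancel₀ ha0, C_1]
  have hG'm : G'.Monic := monic_of_natDegree_le_of_coeff_eq_one c hG'd hG'c
  have hG'dd : G'.natDegree = c := by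
    apply le_antisymm hG'd
    apply le_natDegree_of_ne_zero
    rw [hG'c]; exact one_ne_zero
  have hG'e : ∀ x y, (G'.map (evalRingHom y)).eval x = a⁻¹ * f x y := by
    intro x y
    rw [hmapE, hG', hfG]; simp
  have hq1 : 1 < q := by omega
  obtain ⟨N, hN⟩ : ∃ N : F[X][X], N = X ^ q - X := ⟨_, rfl⟩
  have hNd : N.natDegree = q := by
    have h1 : (X : F[X][X]).degree < (X ^ q : F[X][X]).degree := by
      rw [degree_X_pow, degree_X]
      exact mod_cast hq1
    rw [hN, natDegree_eq_of_degree_eq (degree_sub_eq_left_of_degree_lt h1), natDegree_X_pow]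
  have hNm : N.Monic := by
    rw [hN]
    apply monic_X_pow_sub
    rw [degree_X]; exact_mod_cast hq1
  obtain ⟨K, hK⟩ : ∃ K : F[X][X], K = N /ₘ G' := ⟨_, rfl⟩
  have hKb := div_bound N G' hG'm c q hG'dd hG'b (by
    intro i j hij
    rw [hN, coeff_sub, coeff_X_pow, coeff_X]
    split_ifs <;> simp [coeff_one] <;> omega)
  rw [← hK] at hKb
  have hKd : K.natDegree = q - c := by rw [hK, natDegree_divByMonic _ hG'm, hNd, hG'dd]
  have hKm : K.Monic := by
    rw [Monic, hK, leadingCoeff_divByMonic_of_monic hG'm]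
    · exact hNm
    · rw [degree_eq_natDegree hG'm.ne_zero, degree_eq_natDegree hNm.ne_zero, hNd, hG'dd]
      exact_mod_cast (by omega : c ≤ q)
  have hAD : DD (q - c) (fun x y => (K.eval (C x)).eval y) :=
    DD.ofG K (fun i j hij => hKb i j (by omega))
  set A : F → F → F := fun x y => (K.eval (C x)).eval y with hA
  have hcomp : ∀ x y, y ≠ 0 → f x y ≠ 0 → A x y = 0 := by
    intro x y hy hxy
    set g := G'.map (evalRingHom y) with hg
    have hgm : g.Monic := hG'm.map _
    have hgd' : g.natDegree = c := by rw [hg, hG'm.natDegree_map, hG'dd]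
    set R : Finset F := Finset.univ.filter fun x => f x y = 0 with hR
    have hcop : ((R : Set F)).Pairwise (Function.onFun IsCoprime fun r : F => X - C r) := by
      intro r _ s _ hrs
      exact isCoprime_X_sub_C_of_isUnit_sub (sub_ne_zero.mpr hrs).isUnit
    have hd1 : (∏ r ∈ R, (X - C r)) ∣ g := by
      apply Finset.prod_dvd_of_coprime hcop
      intro r hr
      rw [dvd_iff_isRoot, IsRoot.def, hG'e, (Finset.mem_filter.mp hr).2, mul_zero]
    have hd2 : (∏ r ∈ R, (X - C r)) ∣ (X ^ q - X : F[X]) := by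
      apply Finset.prod_dvd_of_coprime hcop
      intro r hr
      rw [dvd_iff_isRoot, IsRoot.def]
      simp [hq, FiniteField.pow_card]
    have hpm : (∏ r ∈ R, (X - C r)).Monic := monic_prod_of_monic _ _ fun r _ => monic_X_sub_C r
    have hpd : (∏ r ∈ R, (X - C r)).natDegree = c := by
      rw [natDegree_prod_of_monic _ _ fun r _ => monic_X_sub_C r]
      simp [hR, hcnt y hy]
    have hpg : g = ∏ r ∈ R, (X - C r) :=
      eq_of_monic_of_dvd_of_natDegree_le hpm hgm hd1 (by omega)
    rw [← hpg] at hd2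
    obtain ⟨k, hk⟩ := hd2
    have hKk : K.map (evalRingHom y) = k := by
      rw [hK, map_divByMonic _ hG'm, ← hg]
      have : N.map (evalRingHom y) = X ^ q - X := by simp [hN]
      rw [this, hk, mul_divByMonic_cancel_left _ hgm]
    have e1 : (g * k).eval x = 0 := by
      rw [← hk]; simp [hq, FiniteField.pow_card]
    rw [eval_mul, hG'e] at e1
    change (K.eval (C x)).eval y = 0
    rw [← hmapE, hKk]
    rcases mul_eq_zero.mp e1 with h | h
    · exact absurd h (mul_ne_zero (inv_ne_zero ha0) hxy)
    · exact h
  refine ⟨A, hAD, hcomp, ?_⟩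
  · by_contra hcon
    push Not at hcon
    have hm0 := hKm.map (evalRingHom (0 : F))
    apply hm0.ne_zero
    apply eq_zero_of_natDegree_lt_card_of_eval_eq_zero' _ (Finset.univ.filter fun k => A k 0 = 0)
    · intro x hx
      rw [hmapE]
      exact (Finset.mem_filter.mp hx).2
    · rw [hKm.natDegree_map, hKd]; exact hcon

theorem lemma2 {F : Type} [Field F] [Fintype F] [DecidableEq F] (f : F → F → F) (c : ℕ)
    (hc : 1 ≤ c) (hcq : c + 2 ≤ Fintype.card F) (hf : DD c f) (h0 : ∀ x, f x 0 ≠ 0)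
    (hcnt : ∀ y, y ≠ 0 → (Finset.univ.filter fun x => f x y = 0).card = c) : False := by
  obtain ⟨q, hq⟩ : ∃ q, q = Fintype.card F := ⟨_, rfl⟩
  obtain ⟨A, hAD, hcomp, hlast⟩ := lemma2a f c hc hcq hf q hq hcnt
  refine count_lemma f A c (q - c) hc (by omega) (by omega) hcnt ?_ ?_ hlast
  · intro m k
    have h1 := (hf.line m k).card_le 0 (by simpa using h0 k)
    refine le_trans (Finset.card_le_card ?_) h1
    exact Finset.filter_subset_filter _ (Finset.subset_univ _)
  · intro m k hk
    have h1 := (hAD.line m k).card_le 0 (by simpa using hk)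
    have h2 := Finset.card_filter_add_card_filter_not (s := (Finset.univ.erase 0 : Finset F))
      (fun y => f (m * y + k) y = 0)
    have h3 : ((Finset.univ.erase 0 : Finset F).filter fun y => ¬ f (m * y + k) y = 0).card ≤ q - c := by
      refine le_trans (Finset.card_le_card ?_) h1
      intro y hy
      rw [Finset.mem_filter] at hy ⊢
      exact ⟨Finset.mem_univ _, hcomp _ _ (Finset.ne_of_mem_erase hy.1) hy.2⟩
    rw [Finset.card_erase_of_mem (Finset.mem_univ _), Finset.card_univ, ← hq] at h2
    omega

def TA {F : Type} [Field F] (b : ℕ) (f : F → F → F) : Prop :=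
  ∃ (K : Finset F) (μ ν : F), K.card + 1 = b ∧ ∀ x y, f x y ≠ 0 ↔ y ∉ K ∧ x ≠ μ * y + ν

def TB {F : Type} [Field F] (b : ℕ) (f : F → F → F) : Prop :=
  ∃ (E : Finset F), E.card + 1 = b ∧ ∀ x y, f x y ≠ 0 ↔ y ≠ 0 ∧ ∀ m ∈ E, x ≠ m * y

open Polynomial in
theorem DD.one_form {F : Type} [Field F] {f : F → F → F} (H : DD 1 f) :
    ∃ α β γ, ∀ x y, f x y = α * x + β * y + γ := by
  obtain ⟨G, hG, hf⟩ := H.toG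
  have h1 : G.natDegree ≤ 1 := by
    rw [natDegree_le_iff_coeff_eq_zero]
    intro N hN
    ext i
    exact hG i N (by omega)
  have h2 : (G.coeff 1).natDegree ≤ 0 := by
    rw [natDegree_le_iff_coeff_eq_zero]
    intro N hN
    exact hG N 1 (by omega)
  have h3 : (G.coeff 0).natDegree ≤ 1 := by
    rw [natDegree_le_iff_coeff_eq_zero]
    intro N hN
    exact hG N 0 (by omega)
  refine ⟨(G.coeff 1).coeff 0, (G.coeff 0).coeff 1, (G.coeff 0).coeff 0, fun x y => ?_⟩
  rw [hf]
  conv_lhs => rw [eq_X_add_C_of_natDegree_le_one h1, eq_C_of_natDegree_le_zero h2,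
    eq_X_add_C_of_natDegree_le_one h3]
  simp
  ring

theorem rows_factor {F : Type} [Field F] [Fintype F] [DecidableEq F] (K : Finset F) :
    ∀ (n : ℕ) (f : F → F → F), DD (n + K.card) f → n + K.card < Fintype.card F →
      (∀ y ∈ K, ∀ x, f x y = 0) →
      ∃ g, DD n g ∧ ∀ x y, f x y = (∏ k ∈ K, (y - k)) * g x y := by
  induction K using Finset.induction_on with
  | empty => intro n f hf _ _; exact ⟨f, by simpa using hf, by simp⟩
  | insert k K hk ih =>
    intro n f hf hn h0
    rw [Finset.card_insert_of_notMem hk] at hf hn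
    obtain ⟨g1, hg1, h1⟩ := DD.hfactor (n := n + K.card) hf hn k (h0 k (Finset.mem_insert_self _ _))
    obtain ⟨g, hg, h2⟩ := ih n g1 hg1 (by omega) (by
      intro y hy x
      have := h0 y (Finset.mem_insert_of_mem hy) x
      rw [h1] at this
      rcases mul_eq_zero.mp this with h | h
      · exfalso; apply hk; rw [← sub_eq_zero.mp h]; exact hy
      · exact h)
    refine ⟨g, hg, fun x y => ?_⟩
    rw [h1, h2, Finset.prod_insert hk, mul_assoc]

theorem F1 {F : Type} [Field F] [Fintype F] [DecidableEq F] (b : ℕ) (f : F → F → F)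
    (hb : 2 ≤ b) (hbq : b + 1 ≤ Fintype.card F) (hf : DD b f)
    (hz : ∑ y, (Finset.univ.filter fun x => f x y = 0).card + b = b * Fintype.card F + 1)
    (y0 y1 : F) (hy : y0 ≠ y1) (h0 : ∀ x, f x y0 = 0) (h1 : ∀ x, f x y1 = 0) : TA b f := by
  obtain ⟨q, hq⟩ : ∃ q, q = Fintype.card F := ⟨_, rfl⟩
  rw [← hq] at hbq hz
  set K : Finset F := Finset.univ.filter fun y => ∀ x, f x y = 0 with hK
  have hKm : ∀ y, y ∈ K ↔ ∀ x, f x y = 0 := by intro y; simp [hK]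
  have hK2 : 2 ≤ K.card := by
    have : ({y0, y1} : Finset F) ⊆ K := by
      intro y hy
      simp only [Finset.mem_insert, Finset.mem_singleton] at hy
      rcases hy with rfl | rfl
      · exact (hKm _).2 h0
      · exact (hKm _).2 h1
    have h2 := Finset.card_le_card this
    rwa [Finset.card_pair hy] at h2
  have hsum : ∑ y, (Finset.univ.filter fun x => f x y = 0).card
      = K.card * q + ∑ y ∈ Kᶜ, (Finset.univ.filter fun x => f x y = 0).card := by
    rw [← Finset.sum_add_sum_compl K]
    congr 1
    rw [Finset.sum_congr rfl (g := fun _ => q), Finset.sum_const, smul_eq_mul]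
    intro y hy
    rw [Finset.filter_true_of_mem (fun x _ => (hKm y).1 hy x), Finset.card_univ, hq]
  have hKc : Kᶜ.card = q - K.card := by rw [Finset.card_compl, hq]
  have hKb : K.card ≤ b := by
    by_contra hcon
    push Not at hcon
    have hall : ∀ x y, f x y = 0 := by
      intro x y
      by_contra hne
      have e1 := (hf.swap.hline x).card_le y hne
      have : K ⊆ Finset.univ.filter fun y => f x y = 0 := by
        intro y hy
        simpa using (hKm y).1 hy x
      have := Finset.card_le_card this
      omega
    simp only [hall] at hz
    simp [← hq] at hz
    nlinarith
  obtain ⟨c, hc⟩ := Nat.exists_eq_add_of_le hKb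
  rw [add_comm] at hc
  rw [hc] at hf
  obtain ⟨R, hR, hfR⟩ := rows_factor K c f hf (by omega) (fun y hy => (hKm y).1 hy)
  have hprod : ∀ y, (∏ k ∈ K, (y - k)) ≠ 0 ↔ y ∉ K := by
    intro y
    rw [Finset.prod_ne_zero_iff]
    constructor
    · intro h hy; exact h y hy (sub_self y)
    · intro h k hk h2; apply h; rw [sub_eq_zero.mp h2]; exact hk
  have hzero : ∀ y ∈ Kᶜ, ∀ x, f x y = 0 ↔ R x y = 0 := by
    intro y hy x
    rw [hfR]
    have := (hprod y).2 (Finset.mem_compl.mp hy)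
    simp [this]
  have hrow : ∀ y ∈ Kᶜ, (Finset.univ.filter fun x => f x y = 0).card ≤ c := by
    intro y hy
    have h2 := Finset.mem_compl.mp hy
    rw [hKm] at h2
    push Not at h2
    obtain ⟨x0, hx0⟩ := h2
    have h3 := (hR.hline y).card_le x0 (by
      intro h; exact hx0 ((hzero y hy x0).2 h))
    simpa only [hzero y hy] using h3
  have hle := Finset.sum_le_card_nsmul _ _ _ hrow
  rw [hKc, smul_eq_mul] at hle
  have hKq : K.card ≤ q := by omega
  obtain ⟨r, hr⟩ := Nat.exists_eq_add_of_le hKq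
  have hr' : q - K.card = r := by omega
  rw [hr'] at hle
  obtain ⟨T, hT⟩ : ∃ T, T = ∑ y ∈ Kᶜ, (Finset.univ.filter fun x => f x y = 0).card := ⟨_, rfl⟩
  rw [← hT] at hle hsum
  rw [hsum] at hz
  obtain ⟨k, hk⟩ : ∃ k, k = K.card := ⟨_, rfl⟩
  rw [← hk] at hK2 hc hr hz
  have hc1 : c = 1 := by
    have hne : c ≠ 0 := by
      rintro rfl
      have : b = k := by omega
      subst this
      omega
    by_contra hc1
    have hc2 : 2 ≤ c := by omega
    subst hc hr
    nlinarith [Nat.mul_le_mul hc2 hK2, mul_le_mul hc2 hK2 (by omega) (by omega)]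
  subst hc1
  obtain ⟨α, β, γ, hform⟩ := hR.one_form
  have hα : α ≠ 0 := by
    intro hα
    have : T = 0 := by
      rw [hT]
      apply Finset.sum_eq_zero
      intro y hy
      rw [Finset.card_eq_zero, Finset.filter_eq_empty_iff]
      intro x _ hx
      rw [hzero y hy, hform, hα] at hx
      apply Finset.mem_compl.mp hy
      rw [hKm]
      intro x'
      rw [hzero y hy, hform, hα]; linear_combination hx
    rw [this] at hz
    subst hc hr
    nlinarith
  refine ⟨K, -β / α, -γ / α, by omega, ?_⟩
  intro x y
  rw [hfR, mul_ne_zero_iff, hprod, hform]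
  have : α * x + β * y + γ = 0 ↔ x = -β / α * y + -γ / α := by
    constructor
    · intro h
      field_simp
      linear_combination h
    · intro h
      rw [h]
      field_simp
      ring
  rw [Ne, this]

theorem sum_lines {F : Type} [Field F] [Fintype F] [DecidableEq F] (Q : F → F → F) (N U : Finset F)
    (k : F) :
    ∑ m ∈ N, (U.filter fun y => Q (m * y + k) y = 0).card
      = ∑ y ∈ U, (N.filter fun m => Q (m * y + k) y = 0).card := by
  simp only [Finset.card_filter]
  rw [Finset.sum_comm]

theorem row_reparam {F : Type} [Field F] [Fintype F] [DecidableEq F] (h : F → F) (y k : F)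
    (hy : y ≠ 0) : (Finset.univ.filter fun m => h (m * y + k) = 0).card
      = (Finset.univ.filter fun x => h x = 0).card := by
  simp only [Finset.card_filter]
  exact Fintype.sum_equiv ((Equiv.mulRight₀ y hy).trans (Equiv.addRight k)) _ _
      (fun m => by simp)

theorem factD {F : Type} [Field F] [Fintype F] [DecidableEq F] (c : ℕ) (Q : F → F → F)
    (hcq : c + 1 ≤ Fintype.card F) (hQ : DD c Q)
    (hcnt : ∀ y, y ≠ 0 → (Finset.univ.filter fun x => Q x y = 0).card = c)
    (k : F) (hk : Q k 0 = 0) : ∃ m, ∀ y, Q (m * y + k) y = 0 := by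
  by_contra hcon
  push Not at hcon
  have h1 : ∀ m ∈ (Finset.univ : Finset F),
      ((Finset.univ.erase 0).filter fun y => Q (m * y + k) y = 0).card ≤ c - 1 := by
    intro m _
    obtain ⟨y0, hy0⟩ := hcon m
    have h2 := (hQ.line m k).card_le y0 hy0
    have h3 : (Finset.univ.erase 0).filter (fun y => Q (m * y + k) y = 0)
        = (Finset.univ.filter fun y => Q (m * y + k) y = 0).erase 0 := by
      ext y; simp
    rw [h3, Finset.card_erase_of_mem (by simp [hk])]
    omega
  have h2 := Finset.sum_le_card_nsmul _ _ _ h1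
  have hc0 : 1 ≤ c := by
    obtain ⟨y0, hy0⟩ := hcon 0
    have h2 := (hQ.line 0 k).card_le y0 hy0
    have : 0 < (Finset.univ.filter fun y => Q (0 * y + k) y = 0).card :=
      Finset.card_pos.mpr ⟨0, by simp [hk]⟩
    omega
  rw [sum_lines, Finset.sum_congr rfl (g := fun _ => c), Finset.sum_const, smul_eq_mul, smul_eq_mul,
    Finset.card_erase_of_mem (Finset.mem_univ _), Finset.card_univ] at h2
  · obtain ⟨c', rfl⟩ := Nat.exists_eq_add_of_le hc0
    obtain ⟨r, hr⟩ := Nat.exists_eq_add_of_le hcq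
    rw [hr] at h2
    have e1 : 1 + c' + 1 + r - 1 = 1 + c' + r := by omega
    have e2 : 1 + c' - 1 = c' := by omega
    rw [e1, e2] at h2
    nlinarith
  · intro y hy
    rw [row_reparam (fun x => Q x y) y k (Finset.ne_of_mem_erase hy)]
    exact hcnt y (Finset.ne_of_mem_erase hy)

theorem cone {F : Type} [Field F] [Fintype F] [DecidableEq F] (e : ℕ) :
    ∀ (N : Finset F) (g : F → F → F), DD e g → N.card + 2 ≤ Fintype.card F →
      (∀ y, y ≠ 0 → (N.filter fun m => g (m * y) y = 0).card = e) →
      ∃ E ⊆ N, E.card = e ∧ ∀ m ∈ N, ∀ y, y ≠ 0 → (g (m * y) y = 0 ↔ m ∈ E) := by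
  induction e with
  | zero =>
    intro N g _ _ h
    refine ⟨∅, by simp, by simp, ?_⟩
    intro m hm y hy
    have := h y hy
    rw [Finset.card_eq_zero, Finset.filter_eq_empty_iff] at this
    simpa using this hm
  | succ e ih =>
    intro N g hg hN h
    have heN : e + 1 ≤ N.card := by
      rw [← h 1 one_ne_zero]; exact Finset.card_filter_le _ _
    obtain ⟨m0, hm0, hv⟩ : ∃ m0 ∈ N, ∀ y, g (m0 * y) y = 0 := by
      by_contra hcon
      push Not at hcon
      have h1 : ∀ m ∈ N,
          ((Finset.univ.erase 0).filter fun y => g (m * y + 0) y = 0).card ≤ e + 1 := by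
        intro m hm
        obtain ⟨y0, hy0⟩ := hcon m hm
        have h2 := (hg.line m 0).card_le y0 (by simpa using hy0)
        refine le_trans (Finset.card_le_card ?_) h2
        exact Finset.filter_subset_filter _ (Finset.subset_univ _)
      have h2 := Finset.sum_le_card_nsmul _ _ _ h1
      rw [sum_lines, Finset.sum_congr rfl (g := fun _ => e + 1), Finset.sum_const, smul_eq_mul,
        smul_eq_mul, Finset.card_erase_of_mem (Finset.mem_univ _), Finset.card_univ] at h2
      · have := Nat.le_of_mul_le_mul_right h2 (by omega)
        omega
      · intro y hy
        simpa using h y (Finset.ne_of_mem_erase hy)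
    obtain ⟨g1, hg1, hgg⟩ := hg.factor (by omega) m0 0 (by simpa using hv)
    have hz : ∀ m, m ≠ m0 → ∀ y, y ≠ 0 → (g (m * y) y = 0 ↔ g1 (m * y) y = 0) := by
      intro m hm y hy
      rw [hgg]
      have : m * y - m0 * y - 0 ≠ 0 := by
        rw [sub_zero, ← sub_mul]
        exact mul_ne_zero (sub_ne_zero.mpr hm) hy
      simp only [mul_eq_zero, this, false_or]
    obtain ⟨E, hEN, hEc, hE⟩ := ih (N.erase m0) g1 hg1
      (by rw [Finset.card_erase_of_mem hm0]; omega) (by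
        intro y hy
        have h1 := h y hy
        have h2 : (N.erase m0).filter (fun m => g1 (m * y) y = 0)
            = (N.filter fun m => g (m * y) y = 0).erase m0 := by
          ext m
          simp only [Finset.mem_filter, Finset.mem_erase]
          constructor
          · rintro ⟨⟨a, b⟩, c⟩; exact ⟨a, b, (hz m a y hy).2 c⟩
          · rintro ⟨a, b, c⟩; exact ⟨⟨a, b⟩, (hz m a y hy).1 c⟩
        rw [h2, Finset.card_erase_of_mem (by simp [hm0, hv]), h1]; rfl)
    have hm0E : m0 ∉ E := fun h => by simpa using hEN h
    refine ⟨insert m0 E, ?_, ?_, ?_⟩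
    · intro m hm
      rcases Finset.mem_insert.mp hm with rfl | h
      · exact hm0
      · exact Finset.mem_of_mem_erase (hEN h)
    · rw [Finset.card_insert_of_notMem hm0E, hEc]
    · intro m hm y hy
      by_cases hmm : m = m0
      · subst hmm; simp [hv]
      · rw [hz m hmm y hy, hE m (Finset.mem_erase.mpr ⟨hmm, hm⟩) y hy]
        simp [hmm]

theorem tb_of {F : Type} [Field F] [Fintype F] [DecidableEq F] (d : ℕ) (f Q : F → F → F)
    (hfQ : ∀ x y, f x y = y * Q x y) (E : Finset F) (hE : E.card = d + 1)
    (h : ∀ m y, y ≠ 0 → (Q (m * y) y = 0 ↔ m ∈ E)) : TB (d + 2) f := by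
  refine ⟨E, by omega, fun x y => ?_⟩
  rw [hfQ, mul_ne_zero_iff]
  refine and_congr_right fun hy => ?_
  have h1 := h (x / y) y hy
  rw [div_mul_cancel₀ _ hy] at h1
  rw [Ne, h1]
  constructor
  · rintro h2 m hm rfl
    apply h2
    rwa [mul_div_cancel_right₀ _ hy]
  · intro h2 h3
    exact h2 _ h3 (div_mul_cancel₀ _ hy).symm

theorem zsum_swap {F : Type} [Field F] [Fintype F] [DecidableEq F] (f : F → F → F) :
    ∑ y, (Finset.univ.filter fun x => f x y = 0).card
      = ∑ x, (Finset.univ.filter fun y => f x y = 0).card := by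
  simp only [Finset.card_filter]
  rw [Finset.sum_comm]

theorem main2_s9 {F : Type} [Field F] [Fintype F] [DecidableEq F] (C : (F → F → F) → Prop)
    (d : ℕ) (f Q : F → F → F) (hbq : d + 3 ≤ Fintype.card F) (hf : DD (d + 2) f)
    (hz : ∑ y, (Finset.univ.filter fun x => f x y = 0).card + (d + 2)
      = (d + 2) * Fintype.card F + 1)
    (hfQ : ∀ x y, f x y = y * Q x y) (hQ : DD (d + 1) Q)
    (hcnt : ∀ y, y ≠ 0 → (Finset.univ.filter fun x => Q x y = 0).card = d + 1)
    (h0 : ∀ y, Q 0 y = 0)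
    (hTA : ∀ f, TA (d + 2) f → C f) (hTB : ∀ f, TB (d + 2) f → C f)
    (hswap : ∀ f : F → F → F, C (fun x y => f y x) → C f) : C f := by
  obtain ⟨R, hR, hQR⟩ := hQ.factor0 (by omega) h0
  have hQR0 : ∀ m y, m ≠ 0 → y ≠ 0 → (Q (m * y) y = 0 ↔ R (m * y) y = 0) := by
    intro m y hm hy
    rw [hQR]
    simp [hm, hy]
  have hm : ∀ y, y ≠ 0 → ((Finset.univ.erase 0).filter fun m => R (m * y) y = 0).card = d := by
    intro y hy
    have h1 := row_reparam (fun x => Q x y) y 0 hy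
    rw [hcnt y hy] at h1
    have h2 : (Finset.univ.erase 0).filter (fun m => R (m * y) y = 0)
        = (Finset.univ.filter fun m => Q (m * y + 0) y = 0).erase 0 := by
      ext m
      simp only [Finset.mem_filter, Finset.mem_erase, Finset.mem_univ, and_true, true_and, add_zero]
      exact and_congr_right fun hm => (hQR0 m y hm hy).symm
    rw [h2, Finset.card_erase_of_mem (by simp [h0]), h1]; rfl
  rcases Nat.eq_zero_or_pos d with rfl | hd
  · apply hTB
    refine tb_of 0 f Q hfQ {0} (by simp) ?_
    intro m y hy
    have h1 := hm y hy
    rw [Finset.card_eq_zero, Finset.filter_eq_empty_iff] at h1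
    by_cases hm0 : m = 0
    · simp [hm0, h0]
    · simp only [Finset.mem_singleton, hm0, iff_false]
      rw [hQR0 m y hm0 hy]
      exact h1 (by simp [hm0])
  obtain ⟨e, rfl⟩ : ∃ e, d = e + 1 := ⟨d - 1, by omega⟩
  by_cases hex : ∃ m0, m0 ≠ 0 ∧ ∀ y, R (m0 * y) y = 0
  · obtain ⟨m0, hm0, hv⟩ := hex
    obtain ⟨g1, hg1, hgg⟩ := hR.factor (by omega) m0 0 (by simpa using hv)
    have hzz : ∀ m, m ≠ m0 → ∀ y, y ≠ 0 → (R (m * y) y = 0 ↔ g1 (m * y) y = 0) := by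
      intro m hm y hy
      rw [hgg]
      have : m * y - m0 * y - 0 ≠ 0 := by
        rw [sub_zero, ← sub_mul]
        exact mul_ne_zero (sub_ne_zero.mpr hm) hy
      simp only [mul_eq_zero, this, false_or]
    obtain ⟨E, hEN, hEc, hE⟩ := cone e ((Finset.univ.erase 0).erase m0) g1 hg1 (by
        rw [Finset.card_erase_of_mem (by simp [hm0]),
          Finset.card_erase_of_mem (Finset.mem_univ _), Finset.card_univ]; omega) (by
        intro y hy
        have h1 := hm y hy
        have h2 : ((Finset.univ.erase 0).erase m0).filter (fun m => g1 (m * y) y = 0)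
            = ((Finset.univ.erase 0).filter fun m => R (m * y) y = 0).erase m0 := by
          ext m
          simp only [Finset.mem_filter, Finset.mem_erase]
          constructor
          · rintro ⟨⟨a, b⟩, c⟩; exact ⟨a, b, (hzz m a y hy).2 c⟩
          · rintro ⟨a, b, c⟩; exact ⟨⟨a, b⟩, (hzz m a y hy).1 c⟩
        rw [h2, Finset.card_erase_of_mem (by simp [hm0, hv]), h1]; rfl)
    have h1 : m0 ∉ E := fun h => by simpa using hEN h
    have h2 : (0 : F) ∉ insert m0 E := by
      intro h
      rcases Finset.mem_insert.mp h with h | h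
      · exact hm0 h.symm
      · simpa using hEN h
    apply hTB
    refine tb_of (e + 1) f Q hfQ (insert 0 (insert m0 E)) ?_ ?_
    · rw [Finset.card_insert_of_notMem h2, Finset.card_insert_of_notMem h1, hEc]
    · intro m y hy
      by_cases hmz : m = 0
      · simp [hmz, h0]
      rw [hQR0 m y hmz hy]
      by_cases hmm : m = m0
      · simp [hmm, hv]
      · rw [hzz m hmm y hy, hE m (by simp [hmz, hmm]) y hy]
        simp [hmz, hmm]
  push Not at hex
  have hle : ∀ m, m ≠ 0 → (Finset.univ.filter fun y => R (m * y + 0) y = 0).card ≤ e + 1 := by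
    intro m hm
    obtain ⟨y0, hy0⟩ := hex m hm
    exact (hR.line m 0).card_le y0 (by simpa using hy0)
  have hle' : ∀ m ∈ (Finset.univ.erase 0 : Finset F),
      ((Finset.univ.erase 0).filter fun y => R (m * y + 0) y = 0).card ≤ e + 1 := by
    intro m hm
    exact le_trans (Finset.card_le_card (Finset.filter_subset_filter _ (Finset.subset_univ _)))
      (hle m (Finset.ne_of_mem_erase hm))
  have hexact : ∀ m ∈ (Finset.univ.erase 0 : Finset F),
      ((Finset.univ.erase 0).filter fun y => R (m * y + 0) y = 0).card = e + 1 := by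
    refine (Finset.sum_eq_sum_iff_of_le hle').1 ?_
    rw [sum_lines]
    apply Finset.sum_congr rfl
    intro y hy
    simpa using hm y (Finset.ne_of_mem_erase hy)
  have hk : ∃ k, R k 0 = 0 := by
    by_contra hcon
    push Not at hcon
    refine lemma2 R (e + 1) (by omega) (by omega) hR hcon ?_
    intro y hy
    have hne : ∃ x0, R x0 y ≠ 0 := by
      by_contra hc
      push Not at hc
      have h1 := hcnt y hy
      rw [Finset.filter_true_of_mem (fun x _ => by rw [hQR, hc, mul_zero]), Finset.card_univ] at h1
      omega
    obtain ⟨x0, hx0⟩ := hne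
    apply le_antisymm ((hR.hline y).card_le x0 hx0)
    rw [← row_reparam (fun x => R x y) y 0 hy, ← hm y hy]
    apply Finset.card_le_card
    intro m
    simp
  obtain ⟨k, hk⟩ := hk
  by_cases hk0 : k = 0
  · subst hk0
    exfalso
    have h1 := hexact 1 (by simp)
    have h2 := hle 1 one_ne_zero
    have h3 : (Finset.univ.erase 0).filter (fun y => R (1 * y + 0) y = 0)
        = (Finset.univ.filter fun y => R (1 * y + 0) y = 0).erase 0 := by
      ext y; simp
    have h4 : 0 < (Finset.univ.filter fun y => R (1 * y + 0) y = 0).card :=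
      Finset.card_pos.mpr ⟨0, by simp [hk]⟩
    rw [h3, Finset.card_erase_of_mem (by simp [hk])] at h1
    omega
  obtain ⟨m, hmv⟩ := factD (e + 1 + 1) Q (by omega) hQ hcnt k (by rw [hQR, hk, mul_zero])
  by_cases hm0 : m = 0
  · subst hm0
    apply hswap
    apply hTA
    refine F1 _ _ (by omega) (by omega) hf.swap ?_ 0 k (Ne.symm hk0) ?_ ?_
    · rw [← zsum_swap]; exact hz
    · intro x; rw [hfQ, h0, mul_zero]
    · intro x
      have := hmv x
      rw [zero_mul, zero_add] at this
      rw [hfQ, this, mul_zero]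
  · exfalso
    have hRv : ∀ y, R (m * y + k) y = 0 := by
      by_contra hc
      push Not at hc
      obtain ⟨y0, hy0⟩ := hc
      have h1 := (hR.line m k).card_le y0 hy0
      have h2 : Finset.univ.erase (-k / m) ⊆ Finset.univ.filter fun y => R (m * y + k) y = 0 := by
        intro y hy
        have h3 := hmv y
        rw [hQR] at h3
        simp only [Finset.mem_filter, Finset.mem_univ, true_and]
        rcases mul_eq_zero.mp h3 with h | h
        · exfalso
          apply Finset.ne_of_mem_erase hy
          field_simp
          linear_combination h
        · exact h
      have h3 := Finset.card_le_card h2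
      rw [Finset.card_erase_of_mem (Finset.mem_univ _), Finset.card_univ] at h3
      omega
    obtain ⟨g1, hg1, hgg⟩ := hR.factor (by omega) m k hRv
    have hiff : ∀ y, R (m * y + 0) y = 0 ↔ g1 (m * y + 0) y = 0 := by
      intro y
      rw [hgg]
      have : m * y + 0 - m * y - k ≠ 0 := by
        intro h; apply hk0; linear_combination -h
      simp only [mul_eq_zero, this, false_or]
    obtain ⟨y0, hy0⟩ := hex m hm0
    have h1 := (hg1.line m 0).card_le y0 (by
      intro h; apply hy0; simpa using (hiff y0).2 h)
    have h2 := hexact m (by simp [hm0])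
    simp only [hiff] at h2
    have h3 := Finset.card_le_card (Finset.filter_subset_filter
      (fun y => g1 (m * y + 0) y = 0) (Finset.subset_univ (Finset.univ.erase (0 : F))))
    omega

theorem main1 {F : Type} [Field F] [Fintype F] [DecidableEq F] (C : (F → F → F) → Prop)
    (b : ℕ) (hb : 2 ≤ b) (f : F → F → F) (hbq : b + 1 ≤ Fintype.card F) (hf : DD b f)
    (hz : ∑ y, (Finset.univ.filter fun x => f x y = 0).card + b
      = b * Fintype.card F + 1)
    (h0 : ∀ x, f x 0 = 0)
    (hTA : ∀ f, TA b f → C f) (hTB : ∀ f, TB b f → C f)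
    (hswap : ∀ f : F → F → F, C (fun x y => f y x) → C f)
    (hshear : ∀ (f : F → F → F) m k, C (fun x y => f (x + m * y + k) y) → C f) : C f := by
  by_cases hrow : ∃ y0, y0 ≠ 0 ∧ ∀ x, f x y0 = 0
  · obtain ⟨y0, hy0, hv⟩ := hrow
    exact hTA _ (F1 b f hb hbq hf hz y0 0 hy0 hv h0)
  push Not at hrow
  obtain ⟨d, rfl⟩ := Nat.exists_eq_add_of_le' hb
  obtain ⟨Q, hQ, hfQ⟩ := DD.hfactor (n := d + 1) hf (by omega) 0 h0
  simp only [sub_zero] at hfQ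
  have hiff : ∀ y, y ≠ 0 → ∀ x, f x y = 0 ↔ Q x y = 0 := by
    intro y hy x
    rw [hfQ]; simp [hy]
  have hle : ∀ y ∈ (Finset.univ.erase 0 : Finset F),
      (Finset.univ.filter fun x => Q x y = 0).card ≤ d + 1 := by
    intro y hy
    have hy' := Finset.ne_of_mem_erase hy
    obtain ⟨x0, hx0⟩ := hrow y hy'
    exact (hQ.hline y).card_le x0 (fun h => hx0 ((hiff y hy' x0).2 h))
  have hcnt0 : ∀ y ∈ (Finset.univ.erase 0 : Finset F),
      (Finset.univ.filter fun x => Q x y = 0).card = d + 1 := by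
    refine (Finset.sum_eq_sum_iff_of_le hle).1 ?_
    have h1 : ∑ y ∈ Finset.univ.erase (0 : F), (Finset.univ.filter fun x => f x y = 0).card
        = ∑ y ∈ Finset.univ.erase (0 : F), (Finset.univ.filter fun x => Q x y = 0).card := by
      apply Finset.sum_congr rfl
      intro y hy
      simp only [hiff y (Finset.ne_of_mem_erase hy)]
    rw [← h1, Finset.sum_const, Finset.card_erase_of_mem (Finset.mem_univ _), Finset.card_univ,
      smul_eq_mul]
    rw [← Finset.sum_erase_add _ _ (Finset.mem_univ (0 : F)),
      Finset.filter_true_of_mem (fun x _ => h0 x), Finset.card_univ] at hz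
    obtain ⟨r, hr⟩ := Nat.exists_eq_add_of_le hbq
    rw [hr] at hz ⊢
    have : d + 2 + 1 + r - 1 = d + 2 + r := by omega
    rw [this]
    nlinarith
  have hcnt : ∀ y, y ≠ 0 → (Finset.univ.filter fun x => Q x y = 0).card = d + 1 :=
    fun y hy => hcnt0 y (Finset.mem_erase.mpr ⟨hy, Finset.mem_univ _⟩)
  have hk : ∃ k, Q k 0 = 0 := by
    by_contra hcon
    push Not at hcon
    exact lemma2 Q (d + 1) (by omega) (by omega) hQ hcon hcnt
  obtain ⟨k, hk⟩ := hk
  obtain ⟨m, hm⟩ := factD (d + 1) Q (by omega) hQ hcnt k hk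
  have hre : ∀ (h : F → F) (a : F), (Finset.univ.filter fun x => h (x + a) = 0).card
      = (Finset.univ.filter fun x => h x = 0).card := by
    intro h a
    simpa using row_reparam h 1 a one_ne_zero
  apply hshear f m k
  refine main2_s9 C d _ (fun x y => Q (x + m * y + k) y) hbq (hf.shear m k) ?_ ?_ (hQ.shear m k) ?_ ?_
    hTA hTB hswap
  · rw [← hz]
    congr 1
    apply Finset.sum_congr rfl
    intro y _
    simp only [add_assoc]
    exact hre (fun x => f x y) (m * y + k)
  · intro x y; exact hfQ _ _
  · intro y hy
    rw [← hcnt y hy]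
    simp only [add_assoc]
    exact hre (fun x => Q x y) (m * y + k)
  · intro y; simp [hm]

theorem main0 {F : Type} [Field F] [Fintype F] [DecidableEq F] (C : (F → F → F) → Prop)
    (b : ℕ) (hb : 2 ≤ b) (f : F → F → F) (hbq : b + 1 ≤ Fintype.card F) (hf : DD b f)
    (hz : ∑ y, (Finset.univ.filter fun x => f x y = 0).card + b
      = b * Fintype.card F + 1)
    (hTA : ∀ f, TA b f → C f) (hTB : ∀ f, TB b f → C f)
    (hswap : ∀ f : F → F → F, C (fun x y => f y x) → C f)
    (hshear : ∀ (f : F → F → F) m k, C (fun x y => f (x + m * y + k) y) → C f) : C f := by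
  have hre : ∀ (h : F → F) (a : F), (Finset.univ.filter fun x => h (x + a) = 0).card
      = (Finset.univ.filter fun x => h x = 0).card := by
    intro h a
    simpa using row_reparam h 1 a one_ne_zero
  -- the case of a vanishing line of the form x = m y + k
  have caseV : ∀ f : F → F → F, DD b f →
      (∑ y, (Finset.univ.filter fun x => f x y = 0).card + b = b * Fintype.card F + 1) →
      ∀ m k, (∀ y, f (m * y + k) y = 0) → C f := by
    intro f hf hz m k hv
    apply hshear f m k
    apply hswap
    refine main1 C b hb _ hbq (hf.shear m k).swap ?_ ?_ hTA hTB hswap hshear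
    · rw [← hz, zsum_swap]
      congr 1
      apply Finset.sum_congr rfl
      intro y _
      simp only [add_assoc]
      exact hre (fun x => f x y) (m * y + k)
    · intro x; simp [hv]
  by_cases hV : ∃ m k, ∀ y, f (m * y + k) y = 0
  · obtain ⟨m, k, h⟩ := hV
    exact caseV f hf hz m k h
  by_cases hH : ∃ k, ∀ x, f x k = 0
  · obtain ⟨k, h⟩ := hH
    apply hswap
    refine caseV _ hf.swap (by rw [← zsum_swap]; exact hz) 0 k ?_
    intro y; simp [h]
  exfalso
  push Not at hV hH
  obtain ⟨q, hq⟩ : ∃ q, q = Fintype.card F := ⟨_, rfl⟩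
  have hu : (Finset.univ : Finset F).card = q := by rw [hq]; rfl
  set S : Finset (F × F) := Finset.univ.filter fun p => f p.1 p.2 ≠ 0 with hS
  have hB := blocking S (q - b) (by omega) ?_ ?_
  · have hSc : S.card = ∑ y, (Finset.univ.filter fun x => f x y ≠ 0).card := by
      rw [hS, Finset.card_filter, Fintype.sum_prod_type, Finset.sum_comm]
      simp only [Finset.card_filter]
    have h2 : S.card + ∑ y, (Finset.univ.filter fun x => f x y = 0).card = q * q := by
      rw [hSc, ← Finset.sum_add_distrib]
      rw [Finset.sum_congr rfl (g := fun _ => q), Finset.sum_const, hu, smul_eq_mul]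
      intro y _
      rw [add_comm, Finset.card_filter_add_card_filter_not, hu]
    rw [← hq] at hB hz hbq
    obtain ⟨r, hr⟩ := Nat.exists_eq_add_of_le hbq
    have e1 : q - b = 1 + r := by omega
    have e2 : q - 1 = b + r := by omega
    rw [e1, e2] at hB
    subst hr
    nlinarith
  · intro m k
    obtain ⟨y0, hy0⟩ := hV m k
    have h1 := (hf.line m k).card_le y0 hy0
    have h2 : (Finset.univ.filter fun y => f (m * y + k) y ≠ 0).card
        ≤ (S.filter fun s => s.1 = m * s.2 + k).card := by
      apply Finset.card_le_card_of_injOn (fun y => (m * y + k, y))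
      · intro y hy
        simpa [hS] using hy
      · intro y _ y' _ h
        exact (Prod.ext_iff.mp h).2
    have h3 := Finset.card_filter_add_card_filter_not (s := (Finset.univ : Finset F))
      (fun y => f (m * y + k) y = 0)
    rw [hu] at h3
    simp only [ne_eq] at h2
    omega
  · intro k
    obtain ⟨y0, hy0⟩ := hH k
    have h1 := (hf.hline k).card_le y0 hy0
    have h2 : (Finset.univ.filter fun x => f x k ≠ 0).card
        ≤ (S.filter fun s => s.2 = k).card := by
      apply Finset.card_le_card_of_injOn (fun x => (x, k))
      · intro y hy
        simpa [hS] using hy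
      · intro y _ y' _ h
        exact (Prod.ext_iff.mp h).1
    have h3 := Finset.card_filter_add_card_filter_not (s := (Finset.univ : Finset F))
      (fun x => f x k = 0)
    rw [hu] at h3
    simp only [ne_eq] at h2
    omega

def TY {F : Type} [Field F] [Fintype F] (b : ℕ) (f : (Fin 2 → F) → F) : Prop :=
    ((∃ L : Finset (AffineSubspace F (Fin 2 → F)),
        L.card = Fintype.card F - b + 1 ∧
        (∀ l ∈ L, IsAffLine F l) ∧
        (∀ l1 ∈ L, ∀ l2 ∈ L, AffineSubspace.direction l1 = AffineSubspace.direction l2) ∧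
        ∃ l' : AffineSubspace F (Fin 2 → F), IsAffLine F l' ∧
          (∀ l ∈ L, AffineSubspace.direction l ≠ AffineSubspace.direction l') ∧
          {x : Fin 2 → F | f x ≠ 0} =
            (⋃ l ∈ L, (l : Set (Fin 2 → F))) \ (l' : Set (Fin 2 → F))) ∨
     (∃ L : Finset (AffineSubspace F (Fin 2 → F)),
        L.card = Fintype.card F - b + 1 ∧
        (∀ l ∈ L, IsAffLine F l) ∧
        ∃ p : Fin 2 → F, (∀ l ∈ L, p ∈ l) ∧
          {x : Fin 2 → F | f x ≠ 0} = (⋃ l ∈ L, (l : Set (Fin 2 → F))) \ {p}))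

theorem IsAffLine.map {F : Type} [Field F] {l : AffineSubspace F (Fin 2 → F)} (h : IsAffLine F l)
    (e : (Fin 2 → F) ≃ᵃ[F] (Fin 2 → F)) : IsAffLine F (l.map (e : (Fin 2 → F) →ᵃ[F] (Fin 2 → F))) := by
  refine ⟨?_, ?_⟩
  · rw [AffineSubspace.coe_map]; exact h.1.image _
  · rw [AffineSubspace.map_direction]
    have := LinearEquiv.finrank_map_eq e.linear l.direction
    rw [h.2] at this
    exact this

theorem mem_map_equiv {F : Type} [Field F] (l : AffineSubspace F (Fin 2 → F))
    (e : (Fin 2 → F) ≃ᵃ[F] (Fin 2 → F)) (x : Fin 2 → F) :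
    x ∈ l.map (e : (Fin 2 → F) →ᵃ[F] (Fin 2 → F)) ↔ e.symm x ∈ l := by
  rw [AffineSubspace.mem_map]
  constructor
  · rintro ⟨y, hy, rfl⟩; simpa using hy
  · intro h; exact ⟨_, h, by simp⟩

theorem map_inj_equiv {F : Type} [Field F] (e : (Fin 2 → F) ≃ᵃ[F] (Fin 2 → F)) :
    Function.Injective (fun l : AffineSubspace F (Fin 2 → F) =>
      l.map (e : (Fin 2 → F) →ᵃ[F] (Fin 2 → F))) := by
  intro l1 l2 h
  ext x
  have h1 := mem_map_equiv l1 e (e x)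
  have h2 := mem_map_equiv l2 e (e x)
  simp only at h
  rw [h] at h1
  simpa using h1.symm.trans h2

theorem TY.equiv {F : Type} [Field F] [Fintype F] (b : ℕ) (f : (Fin 2 → F) → F)
    (e : (Fin 2 → F) ≃ᵃ[F] (Fin 2 → F)) (h : TY b (fun v => f (e v))) : TY b f := by
  classical
  have hf : ∀ x, f x = f (e (e.symm x)) := by intro x; simp
  have hdir : ∀ l1 l2 : AffineSubspace F (Fin 2 → F), 
      (l1.map (e : (Fin 2 → F) →ᵃ[F] (Fin 2 → F))).direction
        = (l2.map (e : (Fin 2 → F) →ᵃ[F] (Fin 2 → F))).direction ↔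
      l1.direction = l2.direction := by
    intro l1 l2
    rw [AffineSubspace.map_direction, AffineSubspace.map_direction]
    exact (Submodule.map_injective_of_injective (f := (e.linear : (Fin 2 → F) →ₗ[F] (Fin 2 → F)))
      e.linear.injective).eq_iff
  rcases h with ⟨L, hc, hl, hpar, l', hl', hnp, hS⟩ | ⟨L, hc, hl, p, hp, hS⟩
  · left
    refine ⟨L.image _, (Finset.card_image_of_injective _ (map_inj_equiv e)).trans hc, ?_, ?_,
      l'.map (e : (Fin 2 → F) →ᵃ[F] (Fin 2 → F)), hl'.map e, ?_, ?_⟩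
    · intro l h
      obtain ⟨l0, h0, rfl⟩ := Finset.mem_image.mp h
      exact (hl l0 h0).map e
    · intro l1 h1 l2 h2
      obtain ⟨l1, hh1, rfl⟩ := Finset.mem_image.mp h1
      obtain ⟨l2, hh2, rfl⟩ := Finset.mem_image.mp h2
      exact (hdir _ _).2 (hpar _ hh1 _ hh2)
    · intro l1 h1
      obtain ⟨l1, hh1, rfl⟩ := Finset.mem_image.mp h1
      rw [Ne, hdir]
      exact hnp _ hh1
    · ext x
      have := Set.ext_iff.mp hS (e.symm x)
      simp only [Set.mem_ofPred_eq, Set.mem_sdiff, Set.mem_iUnion, SetLike.mem_coe, exists_prop,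
        Finset.mem_image, exists_exists_and_eq_and, mem_map_equiv] at this ⊢
      rw [hf, this]
  · right
    refine ⟨L.image _, (Finset.card_image_of_injective _ (map_inj_equiv e)).trans hc, ?_, e p, ?_, ?_⟩
    · intro l h
      obtain ⟨l0, h0, rfl⟩ := Finset.mem_image.mp h
      exact (hl l0 h0).map e
    · intro l1 h1
      obtain ⟨l1, hh1, rfl⟩ := Finset.mem_image.mp h1
      simpa [mem_map_equiv] using hp _ hh1
    · ext x
      have := Set.ext_iff.mp hS (e.symm x)
      simp only [Set.mem_ofPred_eq, Set.mem_sdiff, Set.mem_iUnion, SetLike.mem_coe, exists_prop,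
        Finset.mem_image, exists_exists_and_eq_and, mem_map_equiv, Set.mem_singleton_iff] at this ⊢
      rw [hf, this, e.symm_apply_eq]

def shearL {F : Type} [Field F] (m : F) : (Fin 2 → F) ≃ₗ[F] (Fin 2 → F) where
  toFun v := ![v 0 + m * v 1, v 1]
  invFun v := ![v 0 - m * v 1, v 1]
  map_add' v w := by ext i; fin_cases i <;> simp; ring
  map_smul' c v := by ext i; fin_cases i <;> simp; ring
  left_inv v := by ext i; fin_cases i <;> simp
  right_inv v := by ext i; fin_cases i <;> simp

def swapL {F : Type} [Field F] : (Fin 2 → F) ≃ₗ[F] (Fin 2 → F) where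
  toFun v := ![v 1, v 0]
  invFun v := ![v 1, v 0]
  map_add' v w := by ext i; fin_cases i <;> simp
  map_smul' c v := by ext i; fin_cases i <;> simp
  left_inv v := by ext i; fin_cases i <;> simp
  right_inv v := by ext i; fin_cases i <;> simp

theorem TY.swap {F : Type} [Field F] [Fintype F] (b : ℕ) (f : F → F → F)
    (h : TY b (fun v => f (v 1) (v 0))) : TY b (fun v => f (v 0) (v 1)) := by
  apply TY.equiv b _ (swapL (F := F)).toAffineEquiv
  simpa [swapL] using h

theorem TY.shear {F : Type} [Field F] [Fintype F] (b : ℕ) (f : F → F → F) (m k : F)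
    (h : TY b (fun v => f (v 0 + m * v 1 + k) (v 1))) : TY b (fun v => f (v 0) (v 1)) := by
  apply TY.equiv b _ ((shearL m).toAffineEquiv.trans (AffineEquiv.constVAdd F (Fin 2 → F) ![k, 0]))
  simpa [shearL, add_comm] using h

def ln {F : Type} [Field F] (p v : Fin 2 → F) : AffineSubspace F (Fin 2 → F) :=
  AffineSubspace.mk' p (Submodule.span F {v})

theorem mem_ln {F : Type} [Field F] (p v w : Fin 2 → F) : w ∈ ln p v ↔ ∃ t : F, w = p + t • v := by
  unfold ln
  rw [AffineSubspace.mem_mk', Submodule.mem_span_singleton]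
  refine exists_congr fun t => ?_
  rw [vsub_eq_sub, eq_sub_iff_add_eq]
  constructor
  · intro h; rw [← h, add_comm]
  · intro h; rw [h, add_comm]

theorem ln_line {F : Type} [Field F] (p v : Fin 2 → F) (hv : v ≠ 0) : IsAffLine F (ln p v) := by
  refine ⟨⟨p, AffineSubspace.self_mem_mk' _ _⟩, ?_⟩
  unfold ln
  rw [AffineSubspace.direction_mk', finrank_span_singleton hv]

theorem mem_ln_row {F : Type} [Field F] (y : F) (w : Fin 2 → F) :
    w ∈ ln ![0, y] ![1, 0] ↔ w 1 = y := by
  rw [mem_ln]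
  constructor
  · rintro ⟨t, rfl⟩; simp
  · intro h; refine ⟨w 0, ?_⟩; ext i; fin_cases i <;> simp [h]

theorem mem_ln_sl {F : Type} [Field F] (m k : F) (w : Fin 2 → F) :
    w ∈ ln ![k, 0] ![m, 1] ↔ w 0 = m * w 1 + k := by
  rw [mem_ln]
  constructor
  · rintro ⟨t, rfl⟩; simp; ring
  · intro h; refine ⟨w 1, ?_⟩
    ext i; fin_cases i
    · simp [h]; ring
    · simp

theorem TA.ty {F : Type} [Field F] [Fintype F] [DecidableEq F] (b : ℕ) 
    (hbq : b + 1 ≤ Fintype.card F) (f : F → F → F)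
    (h : TA b f) : TY b (fun v => f (v 0) (v 1)) := by
  classical
  obtain ⟨K, μ, ν, hK, h⟩ := h
  left
  refine ⟨Kᶜ.image fun y => ln ![0, y] ![1, 0], ?_, ?_, ?_, ln ![ν, 0] ![μ, 1], ?_, ?_, ?_⟩
  · rw [Finset.card_image_of_injective, Finset.card_compl]
    · omega
    · intro y y' h
      have : (![0, y] : Fin 2 → F) ∈ ln ![0, y'] (![1, 0] : Fin 2 → F) := by
        simp only at h
        rw [← h, mem_ln_row]; simp
      rw [mem_ln_row] at this
      simpa using this
  · intro l hl
    obtain ⟨y, _, rfl⟩ := Finset.mem_image.mp hl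
    apply ln_line
    intro h; simpa using congrFun h 0
  · intro l1 h1 l2 h2
    obtain ⟨l1, hh1, rfl⟩ := Finset.mem_image.mp h1
    obtain ⟨l2, hh2, rfl⟩ := Finset.mem_image.mp h2
    unfold ln
    rw [AffineSubspace.direction_mk', AffineSubspace.direction_mk']
  · apply ln_line
    intro h; simpa using congrFun h 1
  · intro l1 h1 h2
    obtain ⟨l1, hh1, rfl⟩ := Finset.mem_image.mp h1
    unfold ln at h2
    rw [AffineSubspace.direction_mk', AffineSubspace.direction_mk'] at h2
    have h3 : (![μ, 1] : Fin 2 → F) ∈ Submodule.span F {![1, 0]} := by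
      rw [h2]; exact Submodule.mem_span_singleton_self _
    rw [Submodule.mem_span_singleton] at h3
    obtain ⟨t, ht⟩ := h3
    simpa using congrFun ht 1
  · ext x
    simp only [Set.mem_ofPred_eq, Set.mem_sdiff, Set.mem_iUnion, SetLike.mem_coe, exists_prop,
        Finset.mem_image, exists_exists_and_eq_and, mem_ln_row, mem_ln_sl, h, Finset.mem_compl]
    simp

theorem TB.ty {F : Type} [Field F] [Fintype F] [DecidableEq F] (b : ℕ) 
    (hbq : b + 1 ≤ Fintype.card F) (f : F → F → F)
    (h : TB b f) : TY b (fun v => f (v 0) (v 1)) := by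
  classical
  obtain ⟨E, hE, h⟩ := h
  right
  refine ⟨Eᶜ.image fun m => ln ![0, 0] ![m, 1], ?_, ?_, 0, ?_, ?_⟩
  · rw [Finset.card_image_of_injective, Finset.card_compl]
    · omega
    · intro y y' h
      have : (![y, 1] : Fin 2 → F) ∈ ln ![0, 0] ![y', 1] := by
        simp only at h
        rw [← h, mem_ln_sl]; simp
      rw [mem_ln_sl] at this
      simpa using this
  · intro l hl
    obtain ⟨y, _, rfl⟩ := Finset.mem_image.mp hl
    apply ln_line
    intro h; simpa using congrFun h 1
  · intro l hl
    obtain ⟨y, _, rfl⟩ := Finset.mem_image.mp hl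
    rw [mem_ln_sl]; simp
  · ext x
    simp only [Set.mem_ofPred_eq, Set.mem_sdiff, Set.mem_iUnion, SetLike.mem_coe, exists_prop,
        Finset.mem_image, exists_exists_and_eq_and, mem_ln_sl, h, Finset.mem_compl, add_zero,
        Set.mem_singleton_iff]
    constructor
    · rintro ⟨hy, h2⟩
      refine ⟨⟨x 0 / x 1, fun hm => h2 _ hm (by field_simp), by field_simp⟩, ?_⟩
      rintro rfl; exact hy rfl
    · rintro ⟨⟨m, hm, hx⟩, hne⟩
      have hy : x 1 ≠ 0 := by
        intro hy
        apply hne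
        ext i; fin_cases i
        · simp [hx, hy]
        · simp [hy]
      refine ⟨hy, fun m' hm' h3 => hm ?_⟩
      rw [hx] at h3
      rw [mul_right_cancel₀ hy h3]; exact hm'

theorem line_card {F : Type} [Field F] [Fintype F] (l : AffineSubspace F (Fin 2 → F))
    (h : IsAffLine F l) [DecidablePred (· ∈ l)] :
    (Finset.univ.filter (· ∈ l)).card = Fintype.card F := by
  classical
  obtain ⟨⟨p, hp⟩, h1⟩ := h
  obtain ⟨v, hv, hsp⟩ := finrank_eq_one_iff'.mp h1
  rw [← Finset.card_univ]
  symm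
  apply Finset.card_bij (fun (t : F) _ => p + t • (v : Fin 2 → F))
  · intro t _
    simp only [Finset.mem_filter, Finset.mem_univ, true_and]
    rw [add_comm]
    exact AffineSubspace.vadd_mem_of_mem_direction (l.direction.smul_mem t v.2) hp
  · intro t _ t' _ h
    have h2 := add_left_cancel h
    have hv' : (v : Fin 2 → F) ≠ 0 := by simpa using hv
    exact smul_left_injective F hv' h2
  · intro w hw
    simp only [Finset.mem_filter, Finset.mem_univ, true_and] at hw
    obtain ⟨c, hc⟩ := hsp ⟨w -ᵥ p, AffineSubspace.vsub_mem_direction hw hp⟩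
    refine ⟨c, Finset.mem_univ _, ?_⟩
    have := congrArg Subtype.val hc
    simp only [Submodule.coe_smul, vsub_eq_sub] at this
    rw [this]; simp

theorem two_dir {F : Type} [Field F] (l1 l2 : AffineSubspace F (Fin 2 → F))
    (h1 : IsAffLine F l1) (h2 : IsAffLine F l2) (p p' : Fin 2 → F) (hne : p ≠ p')
    (a1 : p ∈ l1) (a2 : p ∈ l2) (b1 : p' ∈ l1) (b2 : p' ∈ l2) : l1.direction = l2.direction := by
  have key : ∀ l : AffineSubspace F (Fin 2 → F), IsAffLine F l → p ∈ l → p' ∈ l →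
      Submodule.span F {p -ᵥ p'} = l.direction := by
    intro l hl ha hb
    apply Submodule.eq_of_le_of_finrank_eq
    · rw [Submodule.span_singleton_le_iff_mem]
      exact AffineSubspace.vsub_mem_direction ha hb
    · rw [hl.2, finrank_span_singleton]
      exact sub_ne_zero.mpr hne
  rw [← key l1 h1 a1 b1, key l2 h2 a2 b2]

theorem same_pt {F : Type} [Field F] (l1 l2 : AffineSubspace F (Fin 2 → F))
    (hd : l1.direction = l2.direction) (p : Fin 2 → F) (h1 : p ∈ l1) (h2 : p ∈ l2) : l1 = l2 :=
  AffineSubspace.ext_of_direction_eq hd ⟨p, h1, h2⟩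

theorem meet {F : Type} [Field F] (l1 l2 : AffineSubspace F (Fin 2 → F))
    (h1 : IsAffLine F l1) (h2 : IsAffLine F l2) (hd : l1.direction ≠ l2.direction) :
    ∃ p, p ∈ l1 ∧ p ∈ l2 := by
  have hlt : l1.direction < l1.direction ⊔ l2.direction := by
    refine lt_of_le_of_ne le_sup_left fun h => hd ?_
    have h3 : l2.direction ≤ l1.direction := by rw [h]; exact le_sup_right
    exact (Submodule.eq_of_le_of_finrank_eq h3 (by rw [h1.2, h2.2])).symm
  have h3 := Submodule.finrank_lt_finrank_of_lt hlt
  have h4 := Submodule.finrank_le (l1.direction ⊔ l2.direction)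
  have htop : l1.direction ⊔ l2.direction = ⊤ := by
    apply Submodule.eq_top_of_finrank_eq
    rw [h1.2] at h3
    simp only [Module.finrank_fin_fun] at h4 ⊢
    omega
  obtain ⟨p, hp⟩ := AffineSubspace.inter_nonempty_of_nonempty_of_sup_direction_eq_top h1.1 h2.1 htop
  exact ⟨p, hp.1, hp.2⟩

theorem minus_pt {F : Type} [Field F] [Fintype F] [DecidableEq F]
    (l : AffineSubspace F (Fin 2 → F)) (h : IsAffLine F l) (P : (Fin 2 → F) → Prop)
    [DecidablePred fun x => x ∈ l ∧ ¬ P x] (p : Fin 2 → F) (hp : p ∈ l)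
    (hP : ∀ x ∈ l, P x ↔ x = p) :
    (Finset.univ.filter fun x => x ∈ l ∧ ¬ P x).card = Fintype.card F - 1 := by
  classical
  have : (Finset.univ.filter fun x => x ∈ l ∧ ¬ P x) = (Finset.univ.filter (· ∈ l)).erase p := by
    ext x
    simp only [Finset.mem_filter, Finset.mem_univ, true_and, Finset.mem_erase]
    constructor
    · rintro ⟨a, b⟩; exact ⟨fun h => b ((hP x a).2 h), a⟩
    · rintro ⟨a, b⟩; exact ⟨b, fun h => a ((hP x b).1 h)⟩
  rw [this, Finset.card_erase_of_mem (by simpa using hp), line_card l h]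

theorem TY.wt {F : Type} [Field F] [Fintype F] [DecidableEq F] (b : ℕ) (f : (Fin 2 → F) → F)
    (h : TY b f) : wt f = (Fintype.card F - b + 1) * (Fintype.card F - 1) := by
  classical
  unfold _root_.wt
  have main : ∀ (L : Finset (AffineSubspace F (Fin 2 → F))) (P : (Fin 2 → F) → Prop),
      L.card = Fintype.card F - b + 1 → (∀ l ∈ L, IsAffLine F l) →
      (∀ l ∈ L, ∃ p ∈ l, ∀ x ∈ l, P x ↔ x = p) →
      (∀ l1 ∈ L, ∀ l2 ∈ L, l1 ≠ l2 → ∀ x, x ∈ l1 → x ∈ l2 → P x) →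
      (∀ x, f x ≠ 0 ↔ (∃ l ∈ L, x ∈ l) ∧ ¬ P x) →
      (Finset.univ.filter fun x => f x ≠ 0).card
        = (Fintype.card F - b + 1) * (Fintype.card F - 1) := by
    intro L P hc hl hp hd hS
    have : (Finset.univ.filter fun x => f x ≠ 0)
        = L.biUnion fun l => Finset.univ.filter fun x => x ∈ l ∧ ¬ P x := by
      ext x
      simp only [Finset.mem_filter, Finset.mem_univ, true_and, Finset.mem_biUnion, hS]
      constructor
      · rintro ⟨⟨l, a, b⟩, c⟩; exact ⟨l, a, b, c⟩
      · rintro ⟨l, a, b, c⟩; exact ⟨⟨l, a, b⟩, c⟩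
    rw [this, Finset.card_biUnion]
    · rw [Finset.sum_congr rfl (g := fun _ => Fintype.card F - 1), Finset.sum_const, hc,
        smul_eq_mul]
      intro l hll
      obtain ⟨p, h1, h2⟩ := hp l hll
      exact minus_pt l (hl l hll) P p h1 h2
    · intro l1 h1 l2 h2 hne
      rw [Function.onFun, Finset.disjoint_left]
      intro x hx hx'
      simp only [Finset.mem_filter, Finset.mem_univ, true_and] at hx hx'
      exact hx.2 (hd l1 h1 l2 h2 hne x hx.1 hx'.1)
  rcases h with ⟨L, hc, hl, hpar, l', hl', hnp, hS⟩ | ⟨L, hc, hl, p, hp, hS⟩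
  · refine main L (· ∈ l') hc hl ?_ ?_ ?_
    · intro l hll
      obtain ⟨p, h1, h2⟩ := meet l l' (hl l hll) hl' (hnp l hll)
      refine ⟨p, h1, fun x hx => ⟨fun h3 => ?_, fun h3 => h3 ▸ h2⟩⟩
      by_contra hne
      exact hnp l hll (two_dir l l' (hl l hll) hl' x p hne hx h3 h1 h2)
    · intro l1 h1 l2 h2 hne x hx hx'
      exact absurd (same_pt l1 l2 (hpar l1 h1 l2 h2) x hx hx') hne
    · intro x
      have := Set.ext_iff.mp hS x
      simpa using this
  · refine main L (· = p) hc hl ?_ ?_ ?_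
    · intro l hll
      exact ⟨p, hp l hll, fun x _ => Iff.rfl⟩
    · intro l1 h1 l2 h2 hne x hx hx'
      by_contra hxp
      exact hne (same_pt l1 l2 (two_dir l1 l2 (hl l1 h1) (hl l2 h2) x p hxp hx hx' (hp l1 h1)
        (hp l2 h2)) x hx hx')
    · intro x
      have := Set.ext_iff.mp hS x
      simpa using this

theorem wt_rows {F : Type} [Field F] [Fintype F] [DecidableEq F] (f : (Fin 2 → F) → F) :
    wt f + ∑ y, (Finset.univ.filter fun x => f ![x, y] = 0).card
      = Fintype.card F * Fintype.card F := by
  have h1 : wt f = ∑ y, (Finset.univ.filter fun x => f ![x, y] ≠ 0).card := by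
    unfold wt
    simp only [Finset.card_filter]
    rw [Finset.sum_comm, ← Fintype.sum_prod_type' (fun x y => if f ![x, y] ≠ 0 then 1 else 0)]
    refine Fintype.sum_equiv (finTwoArrowEquiv F) _ _ ?_
    intro v
    have : v = ![v 0, v 1] := by ext i; fin_cases i <;> rfl
    change _ = if f ![v 0, v 1] ≠ 0 then 1 else 0
    rw [← this]
  rw [h1, ← Finset.sum_add_distrib]
  rw [Finset.sum_congr rfl (g := fun _ => Fintype.card F), Finset.sum_const, Finset.card_univ,
    smul_eq_mul]
  intro y _
  rw [add_comm, Finset.card_filter_add_card_filter_not, Finset.card_univ]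

theorem TY.of_wt {F : Type} [Field F] [Fintype F] [DecidableEq F] (b : ℕ) (hb : 2 ≤ b)
    (hbq : b + 1 ≤ Fintype.card F) (f : (Fin 2 → F) → F) (hf : RM F b 2 f)
    (h : _root_.wt f = (Fintype.card F - b + 1) * (Fintype.card F - 1)) : TY b f := by
  have hv : f = fun v => (fun x y => f ![x, y]) (v 0) (v 1) := by
    ext v
    have : v = ![v 0, v 1] := by ext i; fin_cases i <;> rfl
    simp only
    rw [← this]
  rw [hv]
  refine main0 (fun g => TY b (fun v => g (v 0) (v 1))) b hb (fun x y => f ![x, y]) hbq ?_ ?_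
    (TA.ty b hbq) (TB.ty b hbq) (TY.swap b) (TY.shear b)
  · obtain ⟨P, h1, h2⟩ := hf
    exact ⟨P, h1, fun x y => h2 _⟩
  · have h1 := wt_rows f
    rw [h] at h1
    obtain ⟨r, hr⟩ := Nat.exists_eq_add_of_le hbq
    rw [hr] at h1 ⊢
    have e1 : b + 1 + r - b + 1 = r + 2 := by omega
    have e2 : b + 1 + r - 1 = b + r := by omega
    rw [e1, e2] at h1
    nlinarith


/-- The second weight codewords of `R_q(b,2)` are exactly those whose support is (A) the
union of `q-b+1` parallel lines minus their intersection with a non-parallel line, or (B)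
the union of `q-b+1` lines through a common point minus that point. -/
theorem stmt9 {F : Type} [Field F] [Fintype F] [DecidableEq F] {b : ℕ}
    (hq : 3 ≤ Fintype.card F) (hb1 : 2 ≤ b) (hb2 : b ≤ Fintype.card F - 1)
    (f : (Fin 2 → F) → F) (hf : RM F b 2 f) :
    wt f = (Fintype.card F - b + 1) * (Fintype.card F - 1) ↔
    ((∃ L : Finset (AffineSubspace F (Fin 2 → F)),
        L.card = Fintype.card F - b + 1 ∧
        (∀ l ∈ L, IsAffLine F l) ∧
        (∀ l1 ∈ L, ∀ l2 ∈ L, AffineSubspace.direction l1 = AffineSubspace.direction l2) ∧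
        ∃ l' : AffineSubspace F (Fin 2 → F), IsAffLine F l' ∧
          (∀ l ∈ L, AffineSubspace.direction l ≠ AffineSubspace.direction l') ∧
          {x : Fin 2 → F | f x ≠ 0} =
            (⋃ l ∈ L, (l : Set (Fin 2 → F))) \ (l' : Set (Fin 2 → F))) ∨
     (∃ L : Finset (AffineSubspace F (Fin 2 → F)),
        L.card = Fintype.card F - b + 1 ∧
        (∀ l ∈ L, IsAffLine F l) ∧
        ∃ p : Fin 2 → F, (∀ l ∈ L, p ∈ l) ∧
          {x : Fin 2 → F | f x ≠ 0} = (⋃ l ∈ L, (l : Set (Fin 2 → F))) \ {p})) :=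
  ⟨TY.of_wt b hb1 (by omega) f hf, TY.wt b f⟩
end
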